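/- The set of eigenvalues of the Hamiltonian H^L ∈ End(H) equals { Σ_{m=1}^{M} ε^L(μ_m) : μ ∈ 𝓜_N }, where for a motif μ ∈ 𝓜_N with elements μ_1 < ⋯ < μ_M the energy is the sum of the single-magnon dispersions ε^L(n) := (q^{N−n}·[n]_q − (n/N)·[N]_q)/(q − q^{−1}) (for the empty motif the energy is 0). -/

import Mathlib

open scoped BigOperators

noncomputable section

namespace Stmt2

/-- The primitive `N`-th root of unity `ω = exp(2πi/N)`. -/
def omega (N : ℕ) : ℂ := Complex.exp (2 * (Real.pi : ℂ) * Complex.I / (N : ℂ))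

/-- The coordinates `z_j = ω^j`. -/
def z (N : ℕ) (j : ℕ) : ℂ := omega N ^ j

/-- The spin-chain Hilbert space `H = (ℂ²)^{⊗N}`, realised as the space of complex functions on
spin configurations.  The sites `1, …, N` are labelled by `ZMod N` (site `j` is `(j : ZMod N)`),
and `false = ↑`, `true = ↓`. -/
abbrev Chain (N : ℕ) := (ZMod N → Bool) → ℂ

/-- The operator acting on the tensor factors at the (distinct) sites `a` and `b` by the
two-site matrix with entries `A out_a out_b in_a in_b`, and by the identity elsewhere. -/
def twoSiteOp {N : ℕ} (A : Bool → Bool → Bool → Bool → ℂ) (a b : ZMod N) :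
    Chain N → Chain N := fun ψ x =>
  ∑ s : Bool × Bool,
    A (x a) (x b) s.1 s.2 * ψ (Function.update (Function.update x a s.1) b s.2)

def fR (q u : ℂ) : ℂ := (u - 1) / (q * u - q⁻¹)

def gR (q u : ℂ) : ℂ := (q - q⁻¹) / (q * u - q⁻¹)

/-- Matrix entries of the R-matrix `Ř(u)` in the ordered basis `(↑↑, ↑↓, ↓↑, ↓↓)`. -/
def RE (q u : ℂ) : Bool → Bool → Bool → Bool → ℂ
  | false, false, false, false => 1
  | false, true, false, true => u * gR q u
  | false, true, true, false => fR q u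
  | true, false, false, true => fR q u
  | true, false, true, false => gR q u
  | true, true, true, true => 1
  | _, _, _, _ => 0

/-- Matrix entries of the Temperley–Lieb generator `e` in the basis `(↑↑, ↑↓, ↓↑, ↓↓)`. -/
def eE (q : ℂ) : Bool → Bool → Bool → Bool → ℂ
  | false, true, false, true => q⁻¹
  | false, true, true, false => -1
  | true, false, false, true => -1
  | true, false, true, false => q
  | _, _, _, _ => 0

/-- `Ř_{k,k+1}(u)` acting on sites `k, k+1`. -/
def Rop (N : ℕ) (q u : ℂ) (k : ℕ) : Chain N → Chain N :=
  twoSiteOp (RE q u) ((k : ℕ) : ZMod N) (((k + 1 : ℕ)) : ZMod N)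

/-- The Temperley–Lieb generator `e_k` acting on sites `k, k+1`. -/
def eop (N : ℕ) (q : ℂ) (k : ℕ) : Chain N → Chain N :=
  twoSiteOp (eE q) ((k : ℕ) : ZMod N) (((k + 1 : ℕ)) : ZMod N)

/-- Composition of a list of operators (the head of the list acts last). -/
def compList {α : Type*} (l : List (α → α)) : α → α := l.foldr (· ∘ ·) id

/-- The long-range spin interaction
`S^L_{[i,j]} = Ř_{j−1,j}(z_j/z_{j−1})⋯Ř_{i+1,i+2}(z_j/z_{i+1}) ∘ e_i ∘
Ř_{i+1,i+2}(z_{i+1}/z_j)⋯Ř_{j−1,j}(z_{j−1}/z_j)` (for `1 ≤ i < j ≤ N`). -/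
def SL (N : ℕ) (q : ℂ) (i j : ℕ) : Chain N → Chain N :=
  compList (((List.range' (i + 1) (j - 1 - i)).reverse).map fun k => Rop N q (z N j / z N k) k) ∘
    eop N q i ∘
      compList ((List.range' (i + 1) (j - 1 - i)).map fun k => Rop N q (z N k / z N j) k)

/-- The long-range spin interaction
`S^R_{[i,j]} = Ř_{i,i+1}(z_{i+1}/z_i)⋯Ř_{j−2,j−1}(z_{j−1}/z_i) ∘ e_{j−1} ∘
Ř_{j−2,j−1}(z_i/z_{j−1})⋯Ř_{i,i+1}(z_i/z_{i+1})` (for `1 ≤ i < j ≤ N`). -/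
def SR (N : ℕ) (q : ℂ) (i j : ℕ) : Chain N → Chain N :=
  compList ((List.range' i (j - 1 - i)).map fun k => Rop N q (z N (k + 1) / z N i) k) ∘
    eop N q (j - 1) ∘
      compList (((List.range' i (j - 1 - i)).reverse).map fun k => Rop N q (z N i / z N (k + 1)) k)

/-- The symmetric q-integer `[n]_q = (qⁿ − q⁻ⁿ)/(q − q⁻¹)`. -/
def qint (q : ℂ) (n : ℕ) : ℂ := (q ^ n - q⁻¹ ^ n) / (q - q⁻¹)

/-- The pair potential `V(x, y) = x·y/((q·x − q⁻¹·y)·(q·y − q⁻¹·x))`. -/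
def pot (q x y : ℂ) : ℂ := x * y / ((q * x - q⁻¹ * y) * (q * y - q⁻¹ * x))

/-- The left q-deformed Haldane–Shastry Hamiltonian
`H^L = ([N]_q/N)·Σ_{1 ≤ i < j ≤ N} V(z_i, z_j)·S^L_{[i,j]}`. -/
def HL (N : ℕ) (q : ℂ) : Chain N → Chain N :=
  (qint q N / (N : ℂ)) • ∑ j ∈ Finset.Icc 1 N, ∑ i ∈ Finset.Ico 1 j,
    pot q (z N i) (z N j) • SL N q i j

/-- The right q-deformed Haldane–Shastry Hamiltonian
`H^R = ([N]_q/N)·Σ_{1 ≤ i < j ≤ N} V(z_i, z_j)·S^R_{[i,j]}`. -/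
def HR (N : ℕ) (q : ℂ) : Chain N → Chain N :=
  (qint q N / (N : ℂ)) • ∑ j ∈ Finset.Icc 1 N, ∑ i ∈ Finset.Ico 1 j,
    pot q (z N i) (z N j) • SR N q i j

/-- A motif: a subset of `{1, …, N−1}` containing no two consecutive integers. -/
def IsMotif (N : ℕ) (μ : Finset ℕ) : Prop :=
  μ ⊆ Finset.Icc 1 (N - 1) ∧ ∀ m ∈ μ, m + 1 ∉ μ

/-- The single-magnon dispersion `ε^L(n) = (q^{N−n}·[n]_q − (n/N)·[N]_q)/(q − q⁻¹)`. -/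
def epsL (N : ℕ) (q : ℂ) (n : ℕ) : ℂ :=
  (q ^ (N - n) * qint q n - ((n : ℂ) / (N : ℂ)) * qint q N) / (q - q⁻¹)

/-! ### The Temperley–Lieb action on a half-infinite chain

The sites are labelled by `ℕ`, so that no boundary conditions on the indices are needed. -/

/-- Vectors of the half-infinite chain. -/
abbrev State := (ℕ → Bool) → ℂ

def tlWeight (q : ℂ) : Bool → Bool → ℂ
  | false, true => 1
  | true, false => -q
  | _, _ => 0

def setPair (y : ℕ → Bool) (k : ℕ) (α β : Bool) : ℕ → Bool :=
  Function.update (Function.update y k α) (k + 1) β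

@[simp] lemma setPair_fst (y : ℕ → Bool) (k : ℕ) (α β : Bool) : setPair y k α β k = α := by
  simp [setPair]

@[simp] lemma setPair_snd (y : ℕ → Bool) (k : ℕ) (α β : Bool) :
    setPair y k α β (k + 1) = β := by
  simp [setPair]

lemma setPair_of_ne (y : ℕ → Bool) (k : ℕ) (α β : Bool) {l : ℕ} (h : l ≠ k) (h' : l ≠ k + 1) :
    setPair y k α β l = y l := by
  simp [setPair, Function.update_of_ne, h, h']

@[simp] lemma setPair_setPair (y : ℕ → Bool) (k : ℕ) (α β α' β' : Bool) :
    setPair (setPair y k α β) k α' β' = setPair y k α' β' := by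
  ext l
  by_cases h : l = k
  · subst h; simp
  · by_cases h' : l = k + 1
    · subst h'; simp
    · simp [setPair_of_ne, h, h']

@[simp] lemma setPair_self (y : ℕ → Bool) (k : ℕ) : setPair y k (y k) (y (k + 1)) = y := by
  simp [setPair]

lemma setPair_comm (y : ℕ → Bool) {k l : ℕ} (h : k + 2 ≤ l) (α β α' β' : Bool) :
    setPair (setPair y k α β) l α' β' = setPair (setPair y l α' β') k α β := by
  ext m
  simp only [setPair, Function.update_apply]
  split_ifs <;> first | rfl | omega

/-- The Temperley–Lieb generator on sites `k, k + 1`. -/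
def tl (q : ℂ) (k : ℕ) : Module.End ℂ State where
  toFun ψ y := tlWeight q (y k) (y (k + 1)) *
    (q⁻¹ * ψ (setPair y k false true) - ψ (setPair y k true false))
  map_add' ψ χ := by ext y; simp only [Pi.add_apply]; ring
  map_smul' c ψ := by
    ext y; simp only [Pi.smul_apply, smul_eq_mul, RingHom.id_apply]; ring

lemma tl_apply (q : ℂ) (k : ℕ) (ψ : State) (y : ℕ → Bool) :
    tl q k ψ y = tlWeight q (y k) (y (k + 1)) *
      (q⁻¹ * ψ (setPair y k false true) - ψ (setPair y k true false)) := rfl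

lemma tl_mul_self (q : ℂ) (k : ℕ) : tl q k * tl q k = (q + q⁻¹) • tl q k := by
  ext ψ y
  simp only [Module.End.mul_apply, tl_apply, setPair_fst, setPair_snd, setPair_setPair, tlWeight,
    LinearMap.smul_apply, Pi.smul_apply, smul_eq_mul]
  ring

def setTriple (y : ℕ → Bool) (k : ℕ) (α β γ : Bool) : ℕ → Bool :=
  Function.update (setPair y k α β) (k + 2) γ

lemma setPair_eq_setTriple (y : ℕ → Bool) (k : ℕ) (α β : Bool) :
    setPair y k α β = setTriple y k α β (y (k + 2)) := by
  ext m
  simp only [setTriple, setPair, Function.update_apply]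
  split_ifs <;> simp_all

lemma setPair_succ_eq_setTriple (y : ℕ → Bool) (k : ℕ) (α β : Bool) :
    setPair y (k + 1) α β = setTriple y k (y k) α β := by
  ext m
  simp only [setTriple, setPair, Function.update_apply]
  split_ifs <;> first | rfl | simp_all

lemma setPair_setTriple (y : ℕ → Bool) (k : ℕ) (α β γ α' β' : Bool) :
    setPair (setTriple y k α β γ) k α' β' = setTriple y k α' β' γ := by
  ext m
  simp only [setTriple, setPair, Function.update_apply]
  split_ifs <;> first | rfl | omega

lemma setPair_succ_setTriple (y : ℕ → Bool) (k : ℕ) (α β γ β' γ' : Bool) :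
    setPair (setTriple y k α β γ) (k + 1) β' γ' = setTriple y k α β' γ' := by
  ext m
  simp only [setTriple, setPair, Function.update_apply]
  split_ifs <;> rfl

lemma setTriple_apply (y : ℕ → Bool) (k : ℕ) (α β γ : Bool) :
    setTriple y k α β γ k = α ∧ setTriple y k α β γ (k + 1) = β ∧
      setTriple y k α β γ (k + 2) = γ := by
  simp [setTriple, setPair]

lemma tl_braid {q : ℂ} (hq : q ≠ 0) (k : ℕ) : tl q k * tl q (k + 1) * tl q k = tl q k := by
  ext ψ y
  simp only [Module.End.mul_apply, tl_apply]
  simp only [setPair_eq_setTriple y k, setPair_setTriple, setPair_succ_setTriple,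
    (setTriple_apply y k _ _ _).1, (setTriple_apply y k _ _ _).2.1,
    show k + 1 + 1 = k + 2 from rfl, (setTriple_apply y k _ _ _).2.2]
  cases y (k + 2) <;> simp [tlWeight] <;> field_simp <;> first | ring1 | simp

lemma tl_braid' {q : ℂ} (hq : q ≠ 0) (k : ℕ) :
    tl q (k + 1) * tl q k * tl q (k + 1) = tl q (k + 1) := by
  ext ψ y
  simp only [Module.End.mul_apply, tl_apply]
  simp only [setPair_succ_eq_setTriple y k, setPair_setTriple, setPair_succ_setTriple,
    (setTriple_apply y k _ _ _).1, (setTriple_apply y k _ _ _).2.1,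
    show k + 1 + 1 = k + 2 from rfl, (setTriple_apply y k _ _ _).2.2]
  cases y k <;> simp [tlWeight] <;> field_simp <;> first | ring1 | simp

lemma tl_comm (q : ℂ) {k l : ℕ} (h : k + 2 ≤ l) : tl q k * tl q l = tl q l * tl q k := by
  ext ψ y
  simp only [Module.End.mul_apply, tl_apply]
  rw [setPair_of_ne y k _ _ (l := l) (by omega) (by omega),
    setPair_of_ne y k _ _ (l := l + 1) (by omega) (by omega),
    setPair_of_ne y k _ _ (l := l) (by omega) (by omega),
    setPair_of_ne y k _ _ (l := l + 1) (by omega) (by omega),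
    setPair_of_ne y l _ _ (l := k) (by omega) (by omega),
    setPair_of_ne y l _ _ (l := k + 1) (by omega) (by omega),
    setPair_of_ne y l _ _ (l := k) (by omega) (by omega),
    setPair_of_ne y l _ _ (l := k + 1) (by omega) (by omega)]
  simp only [setPair_comm y h]
  ring

/-! ### The `R`-matrix and its relations -/

/-- The denominator `q a - q⁻¹ b`. -/
def qsub (q a b : ℂ) : ℂ := q * a - q⁻¹ * b

/-- The coefficient `f(a/b)` of the `R`-matrix. -/
def fcoef (q a b : ℂ) : ℂ := (a - b) / qsub q a b

lemma qsub_eq {q : ℂ} (hq : q ≠ 0) (a b : ℂ) : qsub q a b = (q ^ 2 * a - b) / q := by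
  unfold qsub; field_simp

lemma sq_mul_sub_ne_zero {q a b : ℂ} (hq : q ≠ 0) (h : qsub q a b ≠ 0) :
    q ^ 2 * a - b ≠ 0 := by
  rw [qsub_eq hq] at h
  exact fun h0 => h (by rw [h0, zero_div])

lemma fcoef_eq {q : ℂ} (hq : q ≠ 0) (a b : ℂ) : fcoef q a b = q * (a - b) / (q ^ 2 * a - b) := by
  rw [fcoef, qsub_eq hq, div_div_eq_mul_div, mul_comm]

/-- The operator `Ř_{k,k+1}(a/b) = 1 - f(a/b) e_k`. -/
def rmat (q : ℂ) (k : ℕ) (a b : ℂ) : Module.End ℂ State := 1 - fcoef q a b • tl q k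

lemma yang_baxter_of_relations {A : Type*} [Ring A] [Algebra ℂ A] {x y : A} {d a b c : ℂ}
    (hx : x * x = d • x) (hy : y * y = d • y) (hxy : x * y * x = x) (hyx : y * x * y = y)
    (h : a + c - d * (a * c) + a * b * c = b) :
    (1 - a • x) * (1 - b • y) * (1 - c • x) = (1 - c • y) * (1 - b • x) * (1 - a • y) := by
  have e₁ : (1 - a • x) * (1 - b • y) * (1 - c • x) =
      1 - (a + c - d * (a * c) + a * b * c) • x - b • y + (a * b) • (x * y)
        + (b * c) • (y * x) := by
    simp only [sub_mul, mul_sub, one_mul, mul_one, smul_mul_assoc, mul_smul_comm, smul_sub, hx,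
      hxy, smul_smul]
    module
  have e₂ : (1 - c • y) * (1 - b • x) * (1 - a • y) =
      1 - (a + c - d * (a * c) + a * b * c) • y - b • x + (a * b) • (x * y)
        + (b * c) • (y * x) := by
    simp only [sub_mul, mul_sub, one_mul, mul_one, smul_mul_assoc, mul_smul_comm, smul_sub, hy,
      hyx, smul_smul]
    module
  rw [e₁, e₂, h]
  abel

lemma rmat_mul_rmat {q a b : ℂ} (hq : q ≠ 0) (h : qsub q a b ≠ 0)
    (h' : qsub q b a ≠ 0) (k : ℕ) : rmat q k a b * rmat q k b a = 1 := by
  have key : fcoef q a b + fcoef q b a - (q + q⁻¹) * (fcoef q a b * fcoef q b a) = 0 := by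
    rw [fcoef_eq hq, fcoef_eq hq]
    have := sq_mul_sub_ne_zero hq h
    have := sq_mul_sub_ne_zero hq h'
    field_simp
    ring
  have : rmat q k a b * rmat q k b a = 1 -
      (fcoef q a b + fcoef q b a - (q + q⁻¹) * (fcoef q a b * fcoef q b a)) • tl q k := by
    simp only [rmat, sub_mul, mul_sub, one_mul, mul_one, smul_mul_assoc, mul_smul_comm,
      tl_mul_self, smul_smul]
    module
  rw [this, key, zero_smul, sub_zero]

lemma fcoef_relation {q a b c : ℂ} (hq : q ≠ 0) (hab : qsub q a b ≠ 0)
    (hac : qsub q a c ≠ 0) (hbc : qsub q b c ≠ 0) :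
    fcoef q b c + fcoef q a b - (q + q⁻¹) * (fcoef q b c * fcoef q a b) +
      fcoef q b c * fcoef q a c * fcoef q a b = fcoef q a c := by
  simp only [fcoef_eq hq]
  have := sq_mul_sub_ne_zero hq hab
  have := sq_mul_sub_ne_zero hq hac
  have := sq_mul_sub_ne_zero hq hbc
  field_simp
  ring

lemma yang_baxter {q a b c : ℂ} (hq : q ≠ 0) (hab : qsub q a b ≠ 0)
    (hac : qsub q a c ≠ 0) (hbc : qsub q b c ≠ 0) (k : ℕ) :
    rmat q k b c * rmat q (k + 1) a c * rmat q k a b =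
      rmat q (k + 1) a b * rmat q k a c * rmat q (k + 1) b c :=
  yang_baxter_of_relations (tl_mul_self q k) (tl_mul_self q (k + 1)) (tl_braid hq k)
    (tl_braid' hq k) (fcoef_relation hq hab hac hbc)

lemma rmat_comm_tl (q : ℂ) {k l : ℕ} (h : k + 2 ≤ l ∨ l + 2 ≤ k) (a b : ℂ) :
    rmat q k a b * tl q l = tl q l * rmat q k a b := by
  have : tl q k * tl q l = tl q l * tl q k :=
    h.elim (fun h => tl_comm q h) fun h => (tl_comm q h).symm
  simp [rmat, sub_mul, mul_sub, this]

lemma rmat_comm_rmat (q : ℂ) {k l : ℕ} (h : k + 2 ≤ l ∨ l + 2 ≤ k) (a b c d : ℂ) :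
    rmat q k a b * rmat q l c d = rmat q l c d * rmat q k a b := by
  have : rmat q k a b * tl q l = tl q l * rmat q k a b := rmat_comm_tl q h a b
  rw [rmat.eq_def q l, mul_sub, sub_mul, mul_smul_comm, smul_mul_assoc, this, one_mul, mul_one]

lemma rmat_comm_tl_self (q : ℂ) (k : ℕ) (a b : ℂ) :
    rmat q k a b * tl q k = tl q k * rmat q k a b := by
  simp [rmat, sub_mul, mul_sub]

lemma tl_exchange_of_relations {A : Type*} [Ring A] [Algebra ℂ A] {x y : A}
    {d s u v p p' r r' : ℂ} (hx : x * x = d • x) (hxy : x * y * x = x)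
    (h₁ : u - s * (u * d - u * p) = v - s * (v * d - v * r'))
    (h₂ : v + u * (p * p') = u + v * (r * r'))
    (h₃ : -(u * p') - s * (-(u * d * p') + (v + u * (p * p'))) = -(v * r'))
    (h₄ : -(u * p) = -(v * r) - s * (-(v * d * r) + (u + v * (r * r'))))
    (hyx : y * x * y = y) :
    (1 - s • x) * (v • y + u • ((1 - p • y) * x * (1 - p' • y))) =
      (u • y + v • ((1 - r • y) * x * (1 - r' • y))) * (1 - s • x) := by
  have e₁ : (1 - s • x) * (v • y + u • ((1 - p • y) * x * (1 - p' • y))) =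
      (u - s * (u * d - u * p)) • x + (v + u * (p * p')) • y
        + (-(u * p') - s * (-(u * d * p') + (v + u * (p * p')))) • (x * y)
        + (-(u * p)) • (y * x) := by
    simp only [sub_mul, mul_sub, mul_add, one_mul, mul_one, smul_mul_assoc, mul_smul_comm,
      smul_sub, smul_smul, ← mul_assoc, hx, hxy, hyx]
    module
  have e₂ : (u • y + v • ((1 - r • y) * x * (1 - r' • y))) * (1 - s • x) =
      (v - s * (v * d - v * r')) • x + (u + v * (r * r')) • y + (-(v * r')) • (x * y)
        + (-(v * r) - s * (-(v * d * r) + (u + v * (r * r')))) • (y * x) := by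
    have hyxx : y * x * x = d • (y * x) := by rw [mul_assoc, hx, mul_smul_comm]
    simp only [sub_mul, mul_sub, add_mul, one_mul, mul_one, smul_mul_assoc, mul_smul_comm,
      smul_sub, smul_smul, ← mul_assoc, hx, hxy, hyx, hyxx]
    module
  rw [e₁, e₂, h₁, h₃, h₄, h₂]

/-- The pair potential. -/
def vcoef (q a b : ℂ) : ℂ := a * b / (qsub q a b * qsub q b a)

lemma vcoef_eq {q : ℂ} (hq : q ≠ 0) (a b : ℂ) :
    vcoef q a b = q ^ 2 * a * b / ((q ^ 2 * a - b) * (q ^ 2 * b - a)) := by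
  rw [vcoef, qsub_eq hq, qsub_eq hq, div_mul_div_comm, div_div_eq_mul_div]
  ring

lemma rmat_mul_interaction {q a b c : ℂ} (hq : q ≠ 0) (hab : qsub q a b ≠ 0)
    (hac : qsub q a c ≠ 0) (hca : qsub q c a ≠ 0) (hbc : qsub q b c ≠ 0) (hcb : qsub q c b ≠ 0)
    (k : ℕ) :
    rmat q k a b * (vcoef q b c • tl q (k + 1) +
        vcoef q a c • (rmat q (k + 1) c b * tl q k * rmat q (k + 1) b c)) =
      (vcoef q a c • tl q (k + 1) +
        vcoef q b c • (rmat q (k + 1) c a * tl q k * rmat q (k + 1) a c)) * rmat q k a b := by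
  have h1 := sq_mul_sub_ne_zero hq hab
  have h2 := sq_mul_sub_ne_zero hq hac
  have h3 := sq_mul_sub_ne_zero hq hca
  have h4 := sq_mul_sub_ne_zero hq hbc
  have h5 := sq_mul_sub_ne_zero hq hcb
  refine tl_exchange_of_relations (tl_mul_self q k) (tl_braid hq k) ?_ ?_ ?_ ?_
    (tl_braid' hq k) <;>
  · simp only [fcoef_eq hq, vcoef_eq hq]
    field_simp
    ring

/-! ### Permuting the inhomogeneities -/

section Orderings

variable {P : Type*}

/-- Genericity of the parameters `ζ` of the inhomogeneous chain. -/
structure Generic (q : ℂ) (ζ : P → ℂ) : Prop where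
  q_ne : q ≠ 0
  inj : Function.Injective ζ
  qsub_ne : ∀ a b, qsub q (ζ a) (ζ b) ≠ 0

/-- The `R`-matrix exchanging the particles `a` and `b` at positions `i, i + 1`. -/
def exch (q : ℂ) (ζ : P → ℂ) (i : ℕ) (a b : P) : Module.End ℂ State := rmat q i (ζ a) (ζ b)

/-- Moves the particle `j` from the right of the string `B` to its left. -/
def moveLeft (q : ℂ) (ζ : P → ℂ) (j : P) : ℕ → List P → Module.End ℂ State
  | _, [] => 1
  | i, c :: B => exch q ζ i c j * moveLeft q ζ j (i + 1) B

/-- Moves the particle `j` from the left of the string `B` to its right. -/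
def moveRight (q : ℂ) (ζ : P → ℂ) (j : P) : ℕ → List P → Module.End ℂ State
  | _, [] => 1
  | i, c :: B => moveRight q ζ j (i + 1) B * exch q ζ i j c

/-- The interactions of `j` with all the particles in the string to its left. -/
def interactions (q : ℂ) (ζ : P → ℂ) (j : P) : ℕ → List P → Module.End ℂ State
  | _, [] => 0
  | i, a :: B => vcoef q (ζ a) (ζ j) •
      (moveRight q ζ j (i + 1) B * tl q i * moveLeft q ζ j (i + 1) B) +
        interactions q ζ j (i + 1) B

/-- The sum of the interactions of all the particles of a list with those to their left,
where the chain begins with a fixed list of particles. -/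
def ham (q : ℂ) (ζ : P → ℂ) : List P → List P → Module.End ℂ State
  | _, [] => 0
  | pre, j :: t => interactions q ζ j 1 pre + ham q ζ (pre ++ [j]) t

variable {q : ℂ} {ζ : P → ℂ}

lemma commute_exch {X : Module.End ℂ State} {i : ℕ} (h : Commute X (tl q i)) (a b : P) :
    Commute X (exch q ζ i a b) :=
  (Commute.one_right X).sub_right (h.smul_right _)

lemma commute_moveLeft {X : Module.End ℂ State} (j : P) (B : List P) (i : ℕ)
    (h : ∀ m, i ≤ m → m < i + B.length → Commute X (tl q m)) :
    Commute X (moveLeft q ζ j i B) := by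
  induction B generalizing i with
  | nil => exact Commute.one_right X
  | cons c B ih =>
    simp only [List.length_cons] at h
    exact (commute_exch (h i le_rfl (by omega)) _ _).mul_right
      (ih (i + 1) fun m hm hm' => h m (by omega) (by omega))

lemma commute_moveRight {X : Module.End ℂ State} (j : P) (B : List P) (i : ℕ)
    (h : ∀ m, i ≤ m → m < i + B.length → Commute X (tl q m)) :
    Commute X (moveRight q ζ j i B) := by
  induction B generalizing i with
  | nil => exact Commute.one_right X
  | cons c B ih =>
    simp only [List.length_cons] at h
    exact (ih (i + 1) fun m hm hm' => h m (by omega) (by omega)).mul_right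
      (commute_exch (h i le_rfl (by omega)) _ _)

lemma commute_interactions {X : Module.End ℂ State} (j : P) (B : List P) (i : ℕ)
    (h : ∀ m, i ≤ m → m < i + B.length → Commute X (tl q m)) :
    Commute X (interactions q ζ j i B) := by
  induction B generalizing i with
  | nil => exact Commute.zero_right X
  | cons c B ih =>
    simp only [List.length_cons] at h
    have h' : ∀ m, i + 1 ≤ m → m < i + 1 + B.length → Commute X (tl q m) :=
      fun m hm hm' => h m (by omega) (by omega)
    exact ((((commute_moveRight j B (i + 1) h').mul_right (h i le_rfl (by omega))).mul_right
      (commute_moveLeft j B (i + 1) h')).smul_right _).add_right (ih (i + 1) h')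

lemma commute_ham {X : Module.End ℂ State} (t pre : List P)
    (h : ∀ m, 1 ≤ m → m < pre.length + t.length → Commute X (tl q m)) :
    Commute X (ham q ζ pre t) := by
  induction t generalizing pre with
  | nil => exact Commute.zero_right X
  | cons j t ih =>
    simp only [List.length_cons] at h
    refine (commute_interactions j pre 1 fun m hm hm' => h m hm (by omega)).add_right
      (ih _ fun m hm hm' => h m hm ?_)
    simp only [List.length_append, List.length_cons, List.length_nil] at hm'
    omega

lemma exch_commute_tl {i m : ℕ} (h : i + 2 ≤ m ∨ m + 2 ≤ i) (a b : P) :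
    Commute (exch q ζ i a b) (tl q m) := rmat_comm_tl q h _ _

lemma exch_commute_exch {i m : ℕ} (h : i + 2 ≤ m ∨ m + 2 ≤ i) (a b c d : P) :
    Commute (exch q ζ i a b) (exch q ζ m c d) := rmat_comm_rmat q h _ _ _ _

lemma exch_mul_exch (hζ : Generic q ζ) (i : ℕ) (a b : P) :
    exch q ζ i a b * exch q ζ i b a = 1 :=
  rmat_mul_rmat hζ.q_ne (hζ.qsub_ne a b) (hζ.qsub_ne b a) i

lemma exch_yang_baxter (hζ : Generic q ζ) (i : ℕ) (a b c : P) :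
    exch q ζ i b c * exch q ζ (i + 1) a c * exch q ζ i a b =
      exch q ζ (i + 1) a b * exch q ζ i a c * exch q ζ (i + 1) b c :=
  yang_baxter hζ.q_ne (hζ.qsub_ne a b) (hζ.qsub_ne a c) (hζ.qsub_ne b c) i

lemma moveLeft_append (j : P) (A B : List P) (i : ℕ) :
    moveLeft q ζ j i (A ++ B) = moveLeft q ζ j i A * moveLeft q ζ j (i + A.length) B := by
  induction A generalizing i with
  | nil => simp [moveLeft]
  | cons a A ih =>
    simp only [List.cons_append, moveLeft, ih, List.length_cons, mul_assoc,
      show i + 1 + A.length = i + (A.length + 1) by omega]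

lemma moveRight_append (j : P) (A B : List P) (i : ℕ) :
    moveRight q ζ j i (A ++ B) = moveRight q ζ j (i + A.length) B * moveRight q ζ j i A := by
  induction A generalizing i with
  | nil => simp [moveRight]
  | cons a A ih =>
    simp only [List.cons_append, moveRight, ih, List.length_cons, mul_assoc,
      show i + 1 + A.length = i + (A.length + 1) by omega]

lemma interactions_append (j : P) (A B : List P) (i : ℕ) :
    interactions q ζ j i (A ++ B) =
      moveRight q ζ j (i + A.length) B * interactions q ζ j i A *
        moveLeft q ζ j (i + A.length) B + interactions q ζ j (i + A.length) B := by
  induction A generalizing i with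
  | nil => simp [interactions]
  | cons a A ih =>
    simp only [List.cons_append, interactions, ih, List.length_cons, moveLeft_append,
      moveRight_append, mul_add, add_mul, mul_smul_comm, smul_mul_assoc, mul_assoc,
      show i + 1 + A.length = i + (A.length + 1) by omega, add_assoc]

lemma ham_append (pre s t : List P) :
    ham q ζ pre (s ++ t) = ham q ζ pre s + ham q ζ (pre ++ s) t := by
  induction s generalizing pre with
  | nil => simp [ham]
  | cons j s ih => simp [ham, ih, add_assoc]

lemma exch_mul_moveLeft (hζ : Generic q ζ) (j a b : P) (pre s : List P) (i : ℕ) :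
    exch q ζ (i + pre.length + 1) a b * moveLeft q ζ j i (pre ++ a :: b :: s) =
      moveLeft q ζ j i (pre ++ b :: a :: s) * exch q ζ (i + pre.length) a b := by
  induction pre generalizing i with
  | nil =>
    have hc : Commute (exch q ζ i a b) (moveLeft q ζ j (i + 1 + 1) s) :=
      commute_moveLeft j s _ fun m hm _ => exch_commute_tl (by omega) a b
    simp only [List.nil_append, moveLeft, List.length_nil, add_zero]
    rw [← mul_assoc, ← mul_assoc, ← exch_yang_baxter hζ, mul_assoc, hc.eq]
    simp only [mul_assoc]
  | cons c pre ih =>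
    simp only [List.cons_append, moveLeft, List.length_cons]
    rw [← mul_assoc, (exch_commute_exch (ζ := ζ) (by omega) a b c j).eq, mul_assoc,
      show i + (pre.length + 1) = i + 1 + pre.length by omega, ih, mul_assoc]

lemma exch_mul_moveRight (hζ : Generic q ζ) (j a b : P) (pre s : List P) (i : ℕ) :
    exch q ζ (i + pre.length) a b * moveRight q ζ j i (pre ++ a :: b :: s) =
      moveRight q ζ j i (pre ++ b :: a :: s) * exch q ζ (i + pre.length + 1) a b := by
  induction pre generalizing i with
  | nil =>
    have hc : Commute (exch q ζ i a b) (moveRight q ζ j (i + 1 + 1) s) :=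
      commute_moveRight j s _ fun m hm _ => exch_commute_tl (by omega) a b
    simp only [List.nil_append, moveRight, List.length_nil, add_zero]
    rw [← mul_assoc, ← mul_assoc, hc.eq, mul_assoc, mul_assoc, ← mul_assoc (exch q ζ i a b),
      exch_yang_baxter hζ]
    simp only [mul_assoc]
  | cons c pre ih =>
    simp only [List.cons_append, moveRight, List.length_cons]
    rw [mul_assoc (moveRight _ _ _ _ _), (exch_commute_exch (ζ := ζ) (by omega) j c a b).eq,
      ← mul_assoc, ← mul_assoc, show i + (pre.length + 1) = i + 1 + pre.length by omega, ih]

lemma exch_mul_interactions (hζ : Generic q ζ) (j a b : P) (pre s : List P) (i : ℕ) :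
    exch q ζ (i + pre.length) a b * interactions q ζ j i (pre ++ a :: b :: s) =
      interactions q ζ j i (pre ++ b :: a :: s) * exch q ζ (i + pre.length) a b := by
  induction pre generalizing i with
  | nil =>
    have hl : Commute (exch q ζ i a b) (moveLeft q ζ j (i + 1 + 1) s) :=
      commute_moveLeft j s _ fun m hm _ => exch_commute_tl (by omega) a b
    have hr : Commute (exch q ζ i a b) (moveRight q ζ j (i + 1 + 1) s) :=
      commute_moveRight j s _ fun m hm _ => exch_commute_tl (by omega) a b
    have hi : Commute (exch q ζ i a b) (interactions q ζ j (i + 1 + 1) s) :=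
      commute_interactions j s _ fun m hm _ => exch_commute_tl (by omega) a b
    have key := rmat_mul_interaction hζ.q_ne (hζ.qsub_ne a b) (hζ.qsub_ne a j)
      (hζ.qsub_ne j a) (hζ.qsub_ne b j) (hζ.qsub_ne j b) i
    have split : ∀ a b : P, interactions q ζ j i (a :: b :: s) =
        moveRight q ζ j (i + 1 + 1) s * (vcoef q (ζ b) (ζ j) • tl q (i + 1) +
          vcoef q (ζ a) (ζ j) • (exch q ζ (i + 1) j b * tl q i * exch q ζ (i + 1) b j)) *
          moveLeft q ζ j (i + 1 + 1) s + interactions q ζ j (i + 1 + 1) s := by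
      intro a b
      simp only [interactions, moveLeft, moveRight, mul_add, add_mul, mul_smul_comm,
        smul_mul_assoc, mul_assoc]
      abel
    simp only [List.nil_append, List.length_nil, add_zero]
    rw [split, split, mul_add, hi.eq, add_mul, ← mul_assoc, ← mul_assoc, hr.eq,
      mul_assoc (moveRight _ _ _ _ _), mul_assoc _ _ (exch q ζ i a b), ← hl.eq]
    congr 1
    rw [← mul_assoc, mul_assoc (moveRight _ _ _ _ _) (exch q ζ i a b)]
    exact congrArg (moveRight q ζ j (i + 1 + 1) s * · * moveLeft q ζ j (i + 1 + 1) s) key |>.trans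
      (by rw [← mul_assoc, mul_assoc _ (rmat q i (ζ a) (ζ b))]; rfl)
  | cons c pre ih =>
    have h1 := exch_mul_moveRight hζ j a b pre s (i + 1)
    have h2 := exch_mul_moveLeft hζ j a b pre s (i + 1)
    have h3 := (exch_commute_tl (q := q) (ζ := ζ) (i := i + 1 + pre.length + 1) (m := i)
      (by omega) a b).eq
    simp only [List.cons_append, interactions, List.length_cons]
    rw [show i + (pre.length + 1) = i + 1 + pre.length by omega, mul_add, add_mul, ih,
      mul_smul_comm, smul_mul_assoc, ← mul_assoc, ← mul_assoc, h1, mul_assoc (moveRight _ _ _ _ _),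
      h3, mul_assoc, mul_assoc (tl q i), h2]
    simp only [mul_assoc]

lemma exch_mul_ham_of_append (hζ : Generic q ζ) (a b : P) (pre s t : List P) :
    exch q ζ (pre.length + 1) a b * ham q ζ (pre ++ a :: b :: s) t =
      ham q ζ (pre ++ b :: a :: s) t * exch q ζ (pre.length + 1) a b := by
  induction t generalizing s with
  | nil => simp [ham]
  | cons j t ih =>
    have := exch_mul_interactions hζ j a b pre s 1
    rw [add_comm 1] at this
    have ih' := ih (s ++ [j])
    simp only [ham, mul_add, add_mul, this, List.append_assoc, List.cons_append] at ih' ⊢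
    rw [ih']

lemma vcoef_comm (q a b : ℂ) : vcoef q a b = vcoef q b a := by
  rw [vcoef, vcoef, mul_comm a, mul_comm (qsub q a b)]

/-- The Hamiltonian intertwines the exchange of two neighbouring particles. -/
lemma exch_mul_ham (hζ : Generic q ζ) (a b : P) (pre t : List P) :
    exch q ζ (pre.length + 1) a b * ham q ζ [] (pre ++ a :: b :: t) =
      ham q ζ [] (pre ++ b :: a :: t) * exch q ζ (pre.length + 1) a b := by
  have hc : Commute (exch q ζ (pre.length + 1) a b) (ham q ζ [] pre) :=
    commute_ham pre [] fun m _ hm => exch_commute_tl (by simp at hm; omega) a b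
  have ht := exch_mul_ham_of_append hζ a b pre [] t
  have split : ∀ a b : P, ham q ζ [] (pre ++ a :: b :: t) = ham q ζ [] pre +
      (interactions q ζ a 1 pre + exch q ζ (pre.length + 1) b a * interactions q ζ b 1 pre *
        exch q ζ (pre.length + 1) a b + vcoef q (ζ a) (ζ b) • tl q (pre.length + 1)) +
      ham q ζ (pre ++ [a, b]) t := by
    intro a b
    rw [ham_append, ham, ham]
    simp only [List.nil_append, interactions_append, List.append_assoc, List.cons_append,
      moveLeft, moveRight, interactions, one_mul, mul_one, add_zero, add_comm 1 pre.length]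
    abel
  have he : exch q ζ (pre.length + 1) a b * tl q (pre.length + 1) =
      tl q (pre.length + 1) * exch q ζ (pre.length + 1) a b := rmat_comm_tl_self q _ _ _
  rw [split, split, mul_add, mul_add, add_mul, add_mul, hc.eq, ht]
  congr 2
  simp only [mul_add, add_mul]
  rw [mul_smul_comm, smul_mul_assoc, he, vcoef_comm, ← mul_assoc, ← mul_assoc, exch_mul_exch hζ,
    one_mul, mul_assoc _ (exch q ζ (pre.length + 1) b a), exch_mul_exch hζ, mul_one]
  abel

end Orderings

section Cocycle

variable {P : Type*} {q : ℂ} {ζ : P → ℂ}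

/-- Families of vectors indexed by the orderings of the particles in `base`, related to each
other by the `R`-matrices. -/
def Covariant (q : ℂ) (ζ : P → ℂ) (base : List P) (W : List P → State) : Prop :=
  ∀ pre a b t, (pre ++ a :: b :: t).Perm base →
    W (pre ++ b :: a :: t) = exch q ζ (pre.length + 1) a b (W (pre ++ a :: b :: t))

lemma Covariant.ham_family {base : List P} {W : List P → State} (hζ : Generic q ζ)
    (hW : Covariant q ζ base W) : Covariant q ζ base fun l => ham q ζ [] l (W l) := by
  intro pre a b t h
  have := LinearMap.congr_fun (exch_mul_ham hζ a b pre t) (W (pre ++ a :: b :: t))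
  simp only [Module.End.mul_apply] at this
  simp only [hW pre a b t h, this]

lemma Covariant.eq_of_perm {base : List P} {W W' : List P → State} (hW : Covariant q ζ base W)
    (hW' : Covariant q ζ base W') {l₁ l₂ : List P} (h : l₁.Perm l₂) :
    ∀ pre, (pre ++ l₁).Perm base → W (pre ++ l₁) = W' (pre ++ l₁) →
      W (pre ++ l₂) = W' (pre ++ l₂) := by
  induction h with
  | nil => exact fun _ _ h => h
  | cons x _ ih =>
    intro pre hp he
    simpa using ih (pre ++ [x]) (by simpa using hp) (by simpa using he)
  | swap x y l =>
    intro pre hp he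
    rw [hW pre y x l hp, hW' pre y x l hp, he]
  | trans h₁ _ ih₁ ih₂ =>
    intro pre hp he
    exact ih₂ pre ((h₁.symm.append_left pre).trans hp) (ih₁ pre hp he)

variable [DecidableEq P]

/-- Moves the particle `p` of a string to the front. -/
def moveFront (q : ℂ) (ζ : P → ℂ) (p : P) : ℕ → List P → Module.End ℂ State
  | _, [] => 1
  | i, c :: b => if c = p then 1 else exch q ζ i c p * moveFront q ζ p (i + 1) b

/-- Rearranges a string into a given order. -/
def rearrange (q : ℂ) (ζ : P → ℂ) : ℕ → List P → List P → Module.End ℂ State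
  | _, _, [] => 1
  | i, b, p :: t => rearrange q ζ (i + 1) (b.erase p) t * moveFront q ζ p i b

lemma commute_moveFront {X : Module.End ℂ State} (p : P) (b : List P) (i : ℕ)
    (h : ∀ m, i ≤ m → Commute X (tl q m)) : Commute X (moveFront q ζ p i b) := by
  induction b generalizing i with
  | nil => exact Commute.one_right X
  | cons c b ih =>
    rw [moveFront]
    split_ifs
    · exact Commute.one_right X
    · exact (commute_exch (h i le_rfl) _ _).mul_right (ih (i + 1) fun m hm => h m (by omega))

lemma commute_rearrange {X : Module.End ℂ State} (l b : List P) (i : ℕ)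
    (h : ∀ m, i ≤ m → Commute X (tl q m)) : Commute X (rearrange q ζ i b l) := by
  induction l generalizing i b with
  | nil => exact Commute.one_right X
  | cons p t ih =>
    exact (ih _ (i + 1) fun m hm => h m (by omega)).mul_right (commute_moveFront p b i h)

lemma rearrange_self (i : ℕ) (b : List P) : rearrange q ζ i b b = 1 := by
  induction b generalizing i with
  | nil => rfl
  | cons c b ih => simp [rearrange, moveFront, ih]

lemma moveFront_mul_moveFront (hζ : Generic q ζ) {p p' : P} (hne : p ≠ p') (b : List P) (i : ℕ)
    (hp : p ∈ b) (hp' : p' ∈ b) :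
    moveFront q ζ p (i + 1) (b.erase p') * moveFront q ζ p' i b =
      exch q ζ i p p' * (moveFront q ζ p' (i + 1) (b.erase p) * moveFront q ζ p i b) := by
  induction b generalizing i with
  | nil => simp at hp
  | cons c b ih =>
    by_cases h : c = p
    · subst h
      simp [moveFront, hne]
    by_cases h' : c = p'
    · subst h'
      simp [moveFront, h, ← mul_assoc, exch_mul_exch hζ]
    have hc : ∀ x : P, Commute (exch q ζ i c x) (moveFront q ζ p (i + 1 + 1) (b.erase p')) :=
      fun x => commute_moveFront _ _ _ fun m hm => exch_commute_tl (by omega) _ _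
    have hc' : ∀ x : P, Commute (exch q ζ i c x) (moveFront q ζ p' (i + 1 + 1) (b.erase p)) :=
      fun x => commute_moveFront _ _ _ fun m hm => exch_commute_tl (by omega) _ _
    have hi := ih (i + 1) (by simpa [Ne.symm h] using hp) (by simpa [Ne.symm h'] using hp')
    simp only [List.erase_cons_tail (beq_iff_eq.not.2 h), List.erase_cons_tail (beq_iff_eq.not.2 h'),
      moveFront, if_neg h, if_neg h']
    rw [mul_assoc, ← mul_assoc (moveFront _ _ _ _ _) (exch _ _ _ _ _), ← (hc p').eq, mul_assoc, hi,
      mul_assoc (exch _ _ _ _ _) (moveFront _ _ _ _ _), ← mul_assoc (moveFront _ _ _ _ _) (exch _ _ _ _ _), ← (hc' p).eq]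
    simp only [← mul_assoc]
    rw [← exch_yang_baxter hζ]

lemma rearrange_swap (hζ : Generic q ζ) (pre : List P) (a b : P) (t base : List P) (i : ℕ)
    (hb : base.Nodup) (h : (pre ++ a :: b :: t).Perm base) :
    rearrange q ζ i base (pre ++ b :: a :: t) =
      exch q ζ (i + pre.length) a b * rearrange q ζ i base (pre ++ a :: b :: t) := by
  induction pre generalizing base i with
  | nil =>
    have hne : a ≠ b := by
      have := h.nodup_iff.2 hb
      simp at this
      tauto
    have ha : a ∈ base := h.subset (by simp)
    have hb' : b ∈ base := h.subset (by simp)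
    have hc : Commute (exch q ζ i a b) (rearrange q ζ (i + 1 + 1) ((base.erase b).erase a) t) :=
      commute_rearrange _ _ _ fun m hm => exch_commute_tl (by omega) _ _
    simp only [List.nil_append, rearrange, List.length_nil, add_zero]
    rw [mul_assoc, moveFront_mul_moveFront hζ hne base i ha hb', ← mul_assoc, ← hc.eq,
      List.erase_comm]
    simp only [mul_assoc]
  | cons c pre ih =>
    have h' : (pre ++ a :: b :: t).Perm (base.erase c) := (List.cons_perm_iff_perm_erase.1 h).2
    simp only [List.cons_append, rearrange, List.length_cons]
    rw [ih _ (i + 1) (hb.erase c) h', mul_assoc, show i + 1 + pre.length = i + (pre.length + 1) by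
      omega]

lemma covariant_rearrange (hζ : Generic q ζ) {base : List P} (hb : base.Nodup) (v : State) :
    Covariant q ζ base fun l => rearrange q ζ 1 base l v := by
  intro pre a b t h
  beta_reduce
  rw [rearrange_swap hζ pre a b t base 1 hb h, add_comm]
  rfl

/-- Rearranging the chain intertwines the Hamiltonians of the different orderings. -/
lemma rearrange_ham (hζ : Generic q ζ) {base l : List P} (hb : base.Nodup) (hl : l.Perm base)
    (v : State) :
    rearrange q ζ 1 base l (ham q ζ [] base v) = ham q ζ [] l (rearrange q ζ 1 base l v) :=
  (covariant_rearrange hζ hb (ham q ζ [] base v)).eq_of_perm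
    ((covariant_rearrange hζ hb v).ham_family hζ) hl.symm [] (.refl _)
    (by simp [rearrange_self])

end Cocycle

/-! ### Components of covariant families at domain-wall configurations -/

section Components

variable {P : Type*} {q : ℂ} {ζ : P → ℂ}

/-- The configuration with down spins at the sites `1, …, M`. -/
def wall (M : ℕ) : ℕ → Bool := fun n => decide (1 ≤ n ∧ n ≤ M)

/-- The configuration with down spins at the sites `1, …, M + 1` except for the site `k`. -/
def gap (M k : ℕ) : ℕ → Bool := fun n => decide (1 ≤ n ∧ n ≤ M + 1 ∧ n ≠ k)

lemma gap_last (M : ℕ) : gap M (M + 1) = wall M := by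
  ext n; simp only [gap, wall, decide_eq_decide]; omega

lemma setPair_eq_iff {y y' : ℕ → Bool} {k : ℕ} {α β : Bool} (h : y' k = α) (h' : y' (k + 1) = β)
    (h'' : ∀ n, n ≠ k → n ≠ k + 1 → y n = y' n) : setPair y k α β = y' := by
  ext n
  by_cases h1 : n = k
  · subst h1; simp [h]
  by_cases h2 : n = k + 1
  · subst h2; simp [h']
  rw [setPair_of_ne _ _ _ _ h1 h2, h'' n h1 h2]

lemma setPair_gap (M k : ℕ) (h : 1 ≤ k) (h' : k ≤ M) :
    setPair (gap M k) k false true = gap M k ∧ setPair (gap M k) k true false = gap M (k + 1) ∧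
      setPair (gap M (k + 1)) k false true = gap M k ∧
      setPair (gap M (k + 1)) k true false = gap M (k + 1) := by
  refine ⟨?_, ?_, ?_, ?_⟩ <;> refine setPair_eq_iff ?_ ?_ fun n h1 h2 => ?_ <;>
    simp only [gap, decide_eq_decide, decide_eq_true_eq, decide_eq_false_iff_not] <;> omega

lemma gap_apply (M k : ℕ) (h : 1 ≤ k) (h' : k ≤ M) : gap M k k = false ∧
    gap M k (k + 1) = true ∧ gap M (k + 1) k = true ∧ gap M (k + 1) (k + 1) = false := by
  simp only [gap, decide_eq_true_eq, decide_eq_false_iff_not]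
  omega

lemma tl_apply_gap_succ (hq : q ≠ 0) {ψ : State} {M k : ℕ} (h : 1 ≤ k) (h' : k ≤ M) :
    tl q k ψ (gap M (k + 1)) = q * ψ (gap M (k + 1)) - ψ (gap M k) := by
  obtain ⟨h1, h2, h3, h4⟩ := gap_apply M k h h'
  obtain ⟨e1, e2, e3, e4⟩ := setPair_gap M k h h'
  simp only [tl_apply, tlWeight, *]
  field_simp
  ring

lemma tl_apply_of_eq {ψ : State} {y : ℕ → Bool} {k : ℕ} (h : y k = y (k + 1)) :
    tl q k ψ y = 0 := by
  rw [tl_apply, ← h]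
  cases y k <;> simp [tlWeight]

lemma exch_apply (i : ℕ) (a b : P) (ψ : State) (y : ℕ → Bool) :
    exch q ζ i a b ψ y = ψ y - fcoef q (ζ a) (ζ b) * tl q i ψ y := rfl

lemma exch_apply_of_eq {ψ : State} {y : ℕ → Bool} {k : ℕ} (h : y k = y (k + 1)) (a b : P) :
    exch q ζ k a b ψ y = ψ y := by
  rw [exch_apply, tl_apply_of_eq h, mul_zero, sub_zero]

lemma moveRight_apply_of_eq {ψ : State} {y : ℕ → Bool} (j : P) (B : List P) (i : ℕ)
    (h : ∀ m, i ≤ m → m < i + B.length → y m = y (m + 1)) :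
    moveRight q ζ j i B ψ y = ψ y := by
  induction B generalizing i ψ with
  | nil => rfl
  | cons c B ih =>
    simp only [List.length_cons] at h
    rw [moveRight, Module.End.mul_apply, ih (i + 1) fun m hm hm' => h m (by omega) (by omega),
      exch_apply_of_eq (h i le_rfl (by omega))]

lemma interactions_apply_of_eq {ψ : State} {y : ℕ → Bool} (j : P) (B : List P) (i : ℕ)
    (h : ∀ m, i ≤ m → m < i + B.length → y m = y (m + 1)) :
    interactions q ζ j i B ψ y = 0 := by
  induction B generalizing i with
  | nil => rfl
  | cons c B ih =>
    simp only [List.length_cons] at h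
    have h' : ∀ m, i + 1 ≤ m → m < i + 1 + B.length → y m = y (m + 1) :=
      fun m hm hm' => h m (by omega) (by omega)
    simp only [interactions, LinearMap.add_apply, LinearMap.smul_apply, Pi.add_apply,
      Pi.smul_apply, Module.End.mul_apply]
    rw [moveRight_apply_of_eq j B _ h', tl_apply_of_eq (h i le_rfl (by omega)), ih _ h', smul_zero,
      add_zero]

lemma ham_apply_of_eq {ψ : State} {y : ℕ → Bool} (t pre : List P)
    (h : ∀ m, 1 ≤ m → m < pre.length + t.length → y m = y (m + 1)) :
    ham q ζ pre t ψ y = 0 := by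
  induction t generalizing pre with
  | nil => rfl
  | cons j t ih =>
    simp only [List.length_cons] at h
    rw [ham, LinearMap.add_apply, Pi.add_apply,
      interactions_apply_of_eq j pre 1 fun m hm hm' => h m hm (by omega), ih, add_zero]
    intro m hm hm'
    simp only [List.length_append, List.length_cons, List.length_nil] at hm'
    exact h m hm (by omega)

lemma Covariant.moveLeft_apply {base : List P} {W : List P → State} (hW : Covariant q ζ base W)
    (j : P) (B pre t : List P) (h : (pre ++ B ++ j :: t).Perm base) :
    moveLeft q ζ j (pre.length + 1) B (W (pre ++ B ++ j :: t)) = W (pre ++ j :: (B ++ t)) := by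
  induction B generalizing pre with
  | nil => simp [moveLeft]
  | cons c B ih =>
    have h1 := ih (pre ++ [c]) (by simpa using h)
    have h2 : (pre ++ c :: j :: (B ++ t)).Perm base := by
      refine List.Perm.trans ?_ h
      simp only [List.append_assoc, List.cons_append]
      exact ((List.perm_middle.symm).cons c).append_left pre
    simp only [List.append_assoc, List.cons_append, List.nil_append, List.length_append,
      List.length_cons, List.length_nil, zero_add] at h1 ⊢
    rw [moveLeft, Module.End.mul_apply, h1, ← hW _ _ _ _ h2]

/-- The components at domain walls do not depend on the ordering on the two sides. -/
lemma Covariant.apply_wall_of_perm {base : List P} {W : List P → State}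
    (hW : Covariant q ζ base W) {l₁ l₂ : List P} (h : l₁.Perm l₂) (suf : List P) (M : ℕ) :
    ∀ pre, (pre ++ l₁ ++ suf).Perm base → (M ≤ pre.length ∨ pre.length + l₁.length ≤ M) →
      W (pre ++ l₁ ++ suf) (wall M) = W (pre ++ l₂ ++ suf) (wall M) := by
  induction h with
  | nil => exact fun _ _ _ => rfl
  | cons x _ ih =>
    intro pre hp he
    simpa using ih (pre ++ [x]) (by simpa using hp) (by simp at he ⊢; omega)
  | swap x y l =>
    intro pre hp he
    simp only [List.length_cons] at he
    simp only [List.append_assoc, List.cons_append] at hp ⊢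
    rw [hW pre y x _ hp, exch_apply_of_eq]
    simp only [wall, decide_eq_decide]
    omega
  | trans h₁ _ ih₁ ih₂ =>
    intro pre hp he
    rw [ih₁ pre hp he, ih₂ pre _ (by rwa [← h₁.length_eq])]
    exact ((h₁.symm.append_left pre).append_right suf).trans hp

lemma moveRight_apply_gap (hq : q ≠ 0) {χ : State} {M : ℕ} (j : P) (B : List P) (i : ℕ)
    (hi : 1 ≤ i) (hB : i + B.length = M + 1)
    (hχ : ∀ k, i < k → k ≤ M + 1 → χ (gap M k) = 0) :
    moveRight q ζ j i B χ (wall M) =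
      (B.map fun y => fcoef q (ζ j) (ζ y)).prod * χ (gap M i) := by
  induction B generalizing i χ with
  | nil =>
    simp only [List.length_nil, add_zero] at hB
    simp [moveRight, hB, gap_last]
  | cons c B ih =>
    simp only [List.length_cons] at hB
    rw [moveRight, Module.End.mul_apply, ih (i + 1) (by omega) (by omega), exch_apply,
      tl_apply_gap_succ hq hi (by omega), hχ (i + 1) (by omega) (by omega), List.map_cons,
      List.prod_cons]
    · ring
    · intro k hk hk'
      rw [exch_apply_of_eq, hχ k (by omega) hk']
      simp only [gap, decide_eq_decide]
      omega

end Components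

/-! ### Reduction to domain-wall components -/

section Symmetrised

variable {P : Type*} [DecidableEq P] {q : ℂ} {ζ : P → ℂ}

/-- The ratio `(q ζ_x - q⁻¹ ζ_y) / (ζ_x - ζ_y)`. -/
def hopRatio (q : ℂ) (ζ : P → ℂ) (x y : P) : ℂ := qsub q (ζ x) (ζ y) / (ζ x - ζ y)

/-- The symmetrised sum `∑_{x ∈ S} φ_x ∏_{y ∈ S ∖ x} (q ζ_x - q⁻¹ ζ_y) / (ζ_x - ζ_y)`. -/
def symSum (q : ℂ) (ζ : P → ℂ) (φ : P → ℂ) (S : Finset P) : ℂ :=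
  ∑ x ∈ S, φ x * ∏ y ∈ S.erase x, hopRatio q ζ x y

lemma sum_prod_erase_insert (φ : P → ℂ) (c : P → P → ℂ) {a : P} {S : Finset P} (ha : a ∉ S) :
    ∑ x ∈ insert a S, φ x * ∏ y ∈ (insert a S).erase x, c x y =
      φ a * ∏ y ∈ S, c a y + ∑ x ∈ S, φ x * c x a * ∏ y ∈ S.erase x, c x y := by
  rw [Finset.sum_insert ha, Finset.erase_insert ha]
  congr 1
  refine Finset.sum_congr rfl fun x hx => ?_
  have hxa : x ≠ a := fun h => ha (h ▸ hx)
  rw [Finset.erase_insert_of_ne hxa.symm,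
    Finset.prod_insert fun h => ha (Finset.mem_of_mem_erase h), mul_assoc]

lemma symSum_insert (φ : P → ℂ) {a : P} {S : Finset P} (ha : a ∉ S) :
    symSum q ζ φ (insert a S) = φ a * ∏ y ∈ S, hopRatio q ζ a y +
      ∑ x ∈ S, φ x * hopRatio q ζ x a * ∏ y ∈ S.erase x, hopRatio q ζ x y :=
  sum_prod_erase_insert φ _ ha

lemma symSum_insert_insert (φ : P → ℂ) {a b : P} {S : Finset P} (ha : a ∉ S) (hb : b ∉ S)
    (hab : a ≠ b) :
    symSum q ζ φ (insert a (insert b S)) =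
      φ a * (hopRatio q ζ a b * ∏ y ∈ S, hopRatio q ζ a y) +
      φ b * (hopRatio q ζ b a * ∏ y ∈ S, hopRatio q ζ b y) +
      ∑ x ∈ S, φ x * (hopRatio q ζ x a * hopRatio q ζ x b) *
        ∏ y ∈ S.erase x, hopRatio q ζ x y := by
  have ha' : a ∉ insert b S := by simp [ha, hab]
  rw [symSum_insert φ ha', Finset.prod_insert hb,
    sum_prod_erase_insert (fun x => φ x * hopRatio q ζ x a) _ hb, ← add_assoc, mul_assoc (φ b)]
  simp only [mul_assoc]

lemma symSum_recursion (hζ : Generic q ζ) (φ : P → ℂ) {a b : P} {S : Finset P} (ha : a ∉ S)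
    (hb : b ∉ S) (hab : a ≠ b) :
    (ζ a - ζ b) * symSum q ζ φ (insert a (insert b S)) =
      qsub q (ζ a) (ζ b) * symSum q ζ φ (insert a S) -
        qsub q (ζ b) (ζ a) * symSum q ζ φ (insert b S) - (ζ a - ζ b) * symSum q ζ φ S := by
  have hab' : ζ a - ζ b ≠ 0 := sub_ne_zero.2 (hζ.inj.ne hab)
  have hba' : ζ b - ζ a ≠ 0 := sub_ne_zero.2 (hζ.inj.ne hab.symm)
  rw [symSum_insert_insert φ ha hb hab, symSum_insert φ ha, symSum_insert φ hb, symSum]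
  have hsum : (ζ a - ζ b) * ∑ x ∈ S, φ x * (hopRatio q ζ x a * hopRatio q ζ x b) *
        ∏ y ∈ S.erase x, hopRatio q ζ x y =
      qsub q (ζ a) (ζ b) * (∑ x ∈ S, φ x * hopRatio q ζ x a * ∏ y ∈ S.erase x, hopRatio q ζ x y) -
      qsub q (ζ b) (ζ a) * (∑ x ∈ S, φ x * hopRatio q ζ x b * ∏ y ∈ S.erase x, hopRatio q ζ x y) -
      (ζ a - ζ b) * ∑ x ∈ S, φ x * ∏ y ∈ S.erase x, hopRatio q ζ x y := by
    simp only [Finset.mul_sum, ← Finset.sum_sub_distrib]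
    refine Finset.sum_congr rfl fun x hx => ?_
    have hxa : ζ x - ζ a ≠ 0 := sub_ne_zero.2 (hζ.inj.ne fun h => ha (h ▸ hx))
    have hxb : ζ x - ζ b ≠ 0 := sub_ne_zero.2 (hζ.inj.ne fun h => hb (h ▸ hx))
    have key : (ζ a - ζ b) * (hopRatio q ζ x a * hopRatio q ζ x b) =
        qsub q (ζ a) (ζ b) * hopRatio q ζ x a - qsub q (ζ b) (ζ a) * hopRatio q ζ x b -
          (ζ a - ζ b) := by
      simp only [hopRatio, qsub]
      have := hζ.q_ne
      field_simp
      ring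
    linear_combination (φ x * ∏ y ∈ S.erase x, hopRatio q ζ x y) * key
  have h1 : (ζ a - ζ b) * hopRatio q ζ a b = qsub q (ζ a) (ζ b) := mul_div_cancel₀ _ hab'
  have h2 : (ζ b - ζ a) * hopRatio q ζ b a = qsub q (ζ b) (ζ a) := mul_div_cancel₀ _ hba'
  linear_combination hsum + (φ a * ∏ y ∈ S, hopRatio q ζ a y) * h1 -
    (φ b * ∏ y ∈ S, hopRatio q ζ b y) * h2

/-- The value of `symSum` for constant weights on a set of given size. -/
def symConst (q : ℂ) : ℕ → ℂ
  | 0 => 0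
  | 1 => 1
  | n + 2 => (q + q⁻¹) * symConst q (n + 1) - symConst q n

lemma symSum_one (hζ : Generic q ζ) (S : Finset P) :
    symSum q ζ (fun _ => 1) S = symConst q S.card := by
  induction h : S.card using Nat.strong_induction_on generalizing S with
  | _ n ih =>
    match n with
    | 0 => rw [Finset.card_eq_zero.1 h]; simp [symSum, symConst]
    | 1 =>
      obtain ⟨a, rfl⟩ := Finset.card_eq_one.1 h
      simp [symSum, symConst]
    | n + 2 =>
      obtain ⟨a, S', ha, rfl, hS'⟩ := Finset.card_eq_succ.1 h
      obtain ⟨b, S, hb, rfl, hS⟩ := Finset.card_eq_succ.1 hS'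
      have hab : a ≠ b := fun h => ha (by simp [h])
      have ha' : a ∉ S := fun h => ha (by simp [h])
      have hab' : ζ a - ζ b ≠ 0 := sub_ne_zero.2 (hζ.inj.ne hab)
      have key := symSum_recursion hζ (fun _ => 1) ha' hb hab
      rw [ih (n + 1) (by omega) (insert a S) (by rw [Finset.card_insert_of_notMem ha', hS]),
        ih (n + 1) (by omega) (insert b S) hS', ih n (by omega) S hS] at key
      refine mul_left_cancel₀ hab' (key.trans ?_)
      simp only [symConst, qsub]
      ring

/-- Differences of symmetrised sums that will describe the action of a single interaction. -/
lemma symSum_combination (hζ : Generic q ζ) (φ : P → ℂ) {a j : P} {S : Finset P} (ha : a ∉ S)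
    (hj : j ∉ S) (haj : a ≠ j) :
    (q + q⁻¹) * symSum q ζ φ (insert j S) - symSum q ζ φ S -
        symSum q ζ φ (insert a (insert j S)) =
      -((φ a - φ j) * (hopRatio q ζ a j * ∏ y ∈ S, hopRatio q ζ a y)) +
      ∑ x ∈ S, (φ x - φ j) * ((q + q⁻¹) * hopRatio q ζ x j - 1 -
        hopRatio q ζ x a * hopRatio q ζ x j) * ∏ y ∈ S.erase x, hopRatio q ζ x y := by
  have hsub : ∀ S, symSum q ζ φ S =
      symSum q ζ (fun x => φ x - φ j) S + φ j * symSum q ζ (fun _ => 1) S := by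
    intro S
    simp only [symSum, Finset.mul_sum, ← Finset.sum_add_distrib]
    exact Finset.sum_congr rfl fun x _ => by ring
  have hone : (q + q⁻¹) * symSum q ζ (fun _ => 1) (insert j S) - symSum q ζ (fun _ => 1) S -
      symSum q ζ (fun _ => 1) (insert a (insert j S)) = 0 := by
    have ha' : a ∉ insert j S := by simp [ha, haj]
    simp only [symSum_one hζ, Finset.card_insert_of_notMem ha', Finset.card_insert_of_notMem hj,
      symConst]
    ring
  rw [hsub S, hsub (insert j S), hsub (insert a (insert j S)),
    symSum_insert_insert _ ha hj haj, symSum_insert _ hj,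
    show symSum q ζ (fun x => φ x - φ j) S =
      ∑ x ∈ S, (φ x - φ j) * ∏ y ∈ S.erase x, hopRatio q ζ x y from rfl]
  have hsum : ∑ x ∈ S, (φ x - φ j) * ((q + q⁻¹) * hopRatio q ζ x j - 1 -
        hopRatio q ζ x a * hopRatio q ζ x j) * ∏ y ∈ S.erase x, hopRatio q ζ x y =
      (q + q⁻¹) * (∑ x ∈ S, (φ x - φ j) * hopRatio q ζ x j * ∏ y ∈ S.erase x, hopRatio q ζ x y) -
      (∑ x ∈ S, (φ x - φ j) * ∏ y ∈ S.erase x, hopRatio q ζ x y) -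
      ∑ x ∈ S, (φ x - φ j) * (hopRatio q ζ x a * hopRatio q ζ x j) *
        ∏ y ∈ S.erase x, hopRatio q ζ x y := by
    simp only [Finset.mul_sum, ← Finset.sum_sub_distrib]
    exact Finset.sum_congr rfl fun x _ => by ring
  rw [hsum]
  linear_combination φ j * hone

/-- `F` collects the domain-wall components of the covariant family `W`. -/
def WallComponents (base : List P) (W : List P → State) (F : Finset P → ℂ) : Prop :=
  ∀ A B, (A ++ B).Perm base → W (A ++ B) (wall A.length) = F A.toFinset

lemma Covariant.apply_gap (hζ : Generic q ζ) {base : List P} (hb : base.Nodup)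
    {W : List P → State} (hW : Covariant q ζ base W) {F : Finset P → ℂ}
    (hF : WallComponents base W F) (m : P) (mid pre post : List P) (M : ℕ)
    (hp : (pre ++ m :: mid ++ post).Perm base) (hM : pre.length + mid.length = M) :
    W (pre ++ m :: mid ++ post) (gap M (pre.length + 1)) =
      symSum q ζ (fun x => F ((pre ++ m :: mid).toFinset.erase x)) (m :: mid).toFinset -
        q⁻¹ * symSum q ζ (fun x => F ((pre ++ m :: mid).toFinset.erase x)) mid.toFinset := by
  induction mid generalizing pre m with
  | nil =>
    simp only [List.length_nil, add_zero] at hM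
    subst hM
    have hm : m ∉ pre := by
      have := hp.nodup_iff.2 hb
      simp [List.nodup_append] at this
      exact fun h => this.2.2 m h |>.1 rfl
    have := hF pre (m :: post) (by simpa using hp)
    rw [gap_last]
    simp only [List.append_assoc, List.cons_append, List.nil_append, this]
    have he : pre.toFinset.erase m = pre.toFinset :=
      Finset.erase_eq_of_notMem (by simpa using hm)
    simp [symSum, he]
  | cons b mid ih =>
    simp only [List.length_cons] at hM
    have hp' : (pre ++ m :: b :: (mid ++ post)).Perm base := by simpa using hp
    have hp2 : (pre ++ b :: m :: (mid ++ post)).Perm base :=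
      ((List.Perm.swap m b _).append_left pre).trans hp'
    have hnd := hp'.nodup_iff.2 hb
    have hmb : m ≠ b := by simp [List.nodup_append] at hnd; tauto
    have hm : m ∉ mid := by simp [List.nodup_append] at hnd; tauto
    have hbm : b ∉ mid := by simp [List.nodup_append] at hnd; tauto
    have h1 := ih b (pre ++ [m]) (by simpa using hp) (by simp; omega)
    have h2 := ih m (pre ++ [b]) (by simpa using hp2) (by simp; omega)
    have hset : (pre ++ b :: m :: mid).toFinset = (pre ++ m :: b :: mid).toFinset :=
      List.toFinset_eq_of_perm _ _ ((List.Perm.swap m b _).append_left pre)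
    simp only [List.append_assoc, List.cons_append, List.nil_append, List.length_append,
      List.length_cons, List.length_nil, zero_add, hset] at h1 h2 ⊢
    have hex := congrFun (hW pre m b (mid ++ post) hp') (gap M (pre.length + 1 + 1))
    rw [exch_apply, tl_apply_gap_succ hζ.q_ne (by omega) (by omega), h1, h2] at hex
    have hne : ζ m - ζ b ≠ 0 := sub_ne_zero.2 (hζ.inj.ne hmb)
    have hrec := symSum_recursion hζ (fun x => F ((pre ++ m :: b :: mid).toFinset.erase x))
      (S := mid.toFinset) (by simpa using hm) (by simpa using hbm) hmb
    have hq := hζ.q_ne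
    have hD := hζ.qsub_ne m b
    simp only [List.toFinset_cons]
    simp only [List.toFinset_cons] at hex
    generalize symSum q ζ _ (insert m (insert b mid.toFinset)) = s₁ at *
    generalize symSum q ζ _ (insert m mid.toFinset) = s₂ at *
    generalize symSum q ζ _ (insert b mid.toFinset) = s₃ at *
    generalize symSum q ζ _ mid.toFinset = s₄ at *
    generalize W _ (gap M (pre.length + 1)) = w at *
    have hf : fcoef q (ζ m) (ζ b) * qsub q (ζ m) (ζ b) = ζ m - ζ b := div_mul_cancel₀ _ hD
    have hqq : q * q⁻¹ = 1 := mul_inv_cancel₀ hq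
    have hqs : qsub q (ζ b) (ζ m) - qsub q (ζ m) (ζ b) + (ζ m - ζ b) * (q + q⁻¹) = 0 := by
      simp only [qsub]; ring
    refine mul_left_cancel₀ hne ?_
    linear_combination (-qsub q (ζ m) (ζ b)) * hex - hrec + (q * (s₃ - q⁻¹ * s₄) - w) * hf -
      s₄ * (ζ m - ζ b) * hqq + s₃ * hqs

end Symmetrised

section WallHamiltonian

variable {P : Type*} [DecidableEq P] {q : ℂ} {ζ : P → ℂ}

def hopWeight (q : ℂ) (ζ : P → ℂ) (j x : P) : ℂ :=
  -(ζ x * ζ j) / ((ζ j - ζ x) * qsub q (ζ j) (ζ x))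

/-- The amplitude for a down spin to hop from the particle `x ∈ S` to the particle `j`. -/
def hopAmplitude (q : ℂ) (ζ : P → ℂ) (j x : P) (S : Finset P) : ℂ :=
  hopWeight q ζ j x * ∏ y ∈ S.erase x, hopRatio q ζ x y * fcoef q (ζ j) (ζ y)

lemma Covariant.interaction_apply_wall (hζ : Generic q ζ) {base : List P} (hb : base.Nodup)
    {W : List P → State} (hW : Covariant q ζ base W) {F : Finset P → ℂ}
    (hF : WallComponents base W F) (j a : P) (A pre t : List P) {S : Finset P}
    (hp : (pre ++ a :: A ++ j :: t).Perm base) (hS : (pre ++ a :: A ++ [j]).toFinset = S) :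
    (moveRight q ζ j (pre.length + 1 + 1) A * tl q (pre.length + 1) *
        moveLeft q ζ j (pre.length + 1 + 1) A) (W (pre ++ a :: A ++ j :: t))
        (wall (pre.length + 1 + A.length)) =
      (A.map fun y => fcoef q (ζ j) (ζ y)).prod *
        ((q + q⁻¹) * symSum q ζ (fun x => F (S.erase x)) (insert j A.toFinset) -
          symSum q ζ (fun x => F (S.erase x)) A.toFinset -
          symSum q ζ (fun x => F (S.erase x)) (insert a (insert j A.toFinset))) := by
  have h1 := hW.moveLeft_apply j A (pre ++ [a]) t (by simpa using hp)
  have hp' : (pre ++ a :: j :: A ++ t).Perm base := by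
    refine List.Perm.trans ?_ hp
    simp only [List.append_assoc, List.cons_append]
    exact ((List.perm_middle.symm).cons a).append_left pre
  have h2 := hW.apply_gap hζ hb hF a (j :: A) pre t (pre.length + 1 + A.length) hp'
    (by simp; omega)
  have h3 := hW.apply_gap hζ hb hF j A (pre ++ [a]) t (pre.length + 1 + A.length)
    (by simpa using hp') (by simp)
  have hS1 : (pre ++ a :: j :: A).toFinset = S := by
    rw [← hS]
    exact List.toFinset_eq_of_perm _ _ (((List.perm_append_singleton j A).symm.cons a).append_left
      pre |>.trans (by simp))
  simp only [List.append_assoc, List.cons_append, List.nil_append, List.length_append,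
    List.length_cons, List.length_nil, zero_add, hS1] at h1 h2 h3 ⊢
  rw [Module.End.mul_apply, Module.End.mul_apply, h1,
    moveRight_apply_gap hζ.q_ne j A _ (by omega) (by omega),
    tl_apply_gap_succ hζ.q_ne (by omega) (by omega), h2, h3]
  · simp only [List.toFinset_cons]
    have hqq : q * q⁻¹ = 1 := mul_inv_cancel₀ hζ.q_ne
    linear_combination (-(A.map fun y => fcoef q (ζ j) (ζ y)).prod *
      symSum q ζ (fun x => F (S.erase x)) A.toFinset) * hqq
  · intro k hk hk'
    refine tl_apply_of_eq ?_
    simp only [gap, decide_eq_decide]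
    omega

lemma Covariant.interactions_apply_wall (hζ : Generic q ζ) {base : List P} (hb : base.Nodup)
    {W : List P → State} (hW : Covariant q ζ base W) {F : Finset P → ℂ}
    (hF : WallComponents base W F) (j : P) (A pre t : List P)
    (hp : (pre ++ A ++ j :: t).Perm base) :
    interactions q ζ j (pre.length + 1) A (W (pre ++ A ++ j :: t)) (wall (pre.length + A.length)) =
      ∑ x ∈ A.toFinset, hopAmplitude q ζ j x A.toFinset *
        (F (pre ++ A).toFinset - F ((insert j (pre ++ A).toFinset).erase x)) := by
  induction A generalizing pre with
  | nil => simp [interactions]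
  | cons a A ih =>
    have ih' := ih (pre ++ [a]) (by simpa using hp)
    have hnd := hp.nodup_iff.2 hb
    have ha : a ∉ A.toFinset := by simp [List.nodup_append] at hnd ⊢; tauto
    have haj : a ≠ j := by simp [List.nodup_append] at hnd ⊢; tauto
    have hj : j ∉ A.toFinset := by
      simp [List.nodup_append] at hnd ⊢; exact fun h => (hnd.2.1.2.2.2 j h).1 rfl
    have hjp : j ∉ (pre ++ a :: A).toFinset := by
      have := (List.disjoint_of_nodup_append hnd)
      intro h
      exact this (List.mem_toFinset.1 h) (by simp)
    set S := insert j (pre ++ a :: A).toFinset with hS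
    have hterm := hW.interaction_apply_wall hζ hb hF j a A pre t (S := S) hp (by
      rw [hS]; ext x; simp; tauto)
    rw [symSum_combination hζ _ ha hj haj] at hterm
    have hSj : S.erase j = (pre ++ a :: A).toFinset := Finset.erase_insert hjp
    have hlen : pre.length + 1 + A.length = pre.length + (A.length + 1) := by omega
    simp only [List.append_assoc, List.cons_append, List.nil_append, List.length_append,
      List.length_cons, List.length_nil, zero_add, hlen, ← hS, hSj, interactions,
      LinearMap.add_apply, Pi.add_apply, LinearMap.smul_apply, Pi.smul_apply, smul_eq_mul,
      hopAmplitude] at ih' hterm ⊢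
    rw [hterm, ih', List.toFinset_cons]
    have hprod : (A.map fun y => fcoef q (ζ j) (ζ y)).prod =
        ∏ y ∈ A.toFinset, fcoef q (ζ j) (ζ y) := by
      rw [List.prod_toFinset]
      simp [List.nodup_append] at hnd; tauto
    set F0 := F (pre ++ a :: A).toFinset
    have hins := sum_prod_erase_insert (fun x => hopWeight q ζ j x * (F0 - F (S.erase x)))
      (fun x y => hopRatio q ζ x y * fcoef q (ζ j) (ζ y)) ha
    have hcomm : ∀ (T : Finset P) (p : P → ℂ), ∑ x ∈ T, hopWeight q ζ j x * p x *
        (F0 - F (S.erase x)) = ∑ x ∈ T, hopWeight q ζ j x * (F0 - F (S.erase x)) * p x :=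
      fun T p => Finset.sum_congr rfl fun x _ => by ring
    have hsub : ∀ {x y : P}, x ≠ y → ζ x - ζ y ≠ 0 := fun h => sub_ne_zero.2 (hζ.inj.ne h)
    have hqa : ∀ x y : P, q ^ 2 * ζ x - ζ y ≠ 0 := fun x y =>
      sq_mul_sub_ne_zero hζ.q_ne (hζ.qsub_ne x y)
    have hq := hζ.q_ne
    rw [hcomm, hcomm, hins, hprod, mul_add, mul_add, add_assoc]
    congr 1
    · have hw : vcoef q (ζ a) (ζ j) * hopRatio q ζ a j = hopWeight q ζ j a := by
        have := hsub haj
        have := hsub haj.symm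
        have := hqa a j
        have := hqa j a
        simp only [vcoef_eq hq, hopRatio, hopWeight, qsub_eq hq]
        field_simp
        ring
      rw [Finset.prod_mul_distrib, ← hw]
      ring
    · rw [Finset.mul_sum, Finset.mul_sum, ← Finset.sum_add_distrib]
      refine Finset.sum_congr rfl fun x hx => ?_
      have hxa : x ≠ a := fun h => ha (h ▸ hx)
      have hxj : x ≠ j := fun h => hj (h ▸ hx)
      rw [← Finset.mul_prod_erase _ _ hx, Finset.prod_mul_distrib]
      have hw : vcoef q (ζ a) (ζ j) * fcoef q (ζ j) (ζ x) * ((q + q⁻¹) * hopRatio q ζ x j - 1 -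
          hopRatio q ζ x a * hopRatio q ζ x j) =
          -hopWeight q ζ j x * (hopRatio q ζ x a * fcoef q (ζ j) (ζ a) - 1) := by
        have := hsub haj
        have := hsub haj.symm
        have := hqa a j
        have := hqa j a
        have := hqa j x
        have := hsub hxj
        have := hsub hxj.symm
        have := hsub hxa
        simp only [vcoef_eq hq, fcoef_eq hq, hopRatio, hopWeight, qsub_eq hq]
        field_simp
        ring
      linear_combination ((F (S.erase x) - F0) * (∏ y ∈ A.toFinset.erase x, fcoef q (ζ j) (ζ y)) *
        ∏ y ∈ A.toFinset.erase x, hopRatio q ζ x y) * hw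

lemma Covariant.ham_apply_wall_of_append (hζ : Generic q ζ) {base : List P} (hb : base.Nodup)
    {W : List P → State} (hW : Covariant q ζ base W) {F : Finset P → ℂ}
    (hF : WallComponents base W F) (A B₂ B₁ : List P) (hp : (A ++ B₁ ++ B₂).Perm base) :
    ham q ζ (A ++ B₁) B₂ (W (A ++ B₁ ++ B₂)) (wall A.length) =
      ∑ j ∈ B₂.toFinset, ∑ x ∈ A.toFinset, hopAmplitude q ζ j x A.toFinset *
        (F A.toFinset - F ((insert j A.toFinset).erase x)) := by
  induction B₂ generalizing B₁ with
  | nil => simp [ham]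
  | cons j B₂ ih =>
    have ih' := ih (B₁ ++ [j]) (by simpa using hp)
    have hnd := hp.nodup_iff.2 hb
    have hj : j ∉ B₂.toFinset := by simp [List.nodup_append] at hnd ⊢; tauto
    have h1 := hW.moveLeft_apply j B₁ A B₂ hp
    have hp' : (A ++ [] ++ j :: (B₁ ++ B₂)).Perm base := by
      refine List.Perm.trans ?_ hp
      simp only [List.append_assoc, List.append_nil]
      exact (List.perm_middle.symm).append_left A
    have h2 := hW.interactions_apply_wall hζ hb hF j A [] (B₁ ++ B₂) (by simpa using hp')
    have hz : ∀ m, A.length + 1 ≤ m → m < A.length + 1 + B₁.length →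
        wall A.length m = wall A.length (m + 1) := by
      intro m hm _
      simp only [wall, decide_eq_decide]
      omega
    simp only [List.append_assoc, List.cons_append, List.nil_append, List.length_nil,
      zero_add] at ih' h1 h2 ⊢
    rw [ham, LinearMap.add_apply, Pi.add_apply, List.append_assoc, ih', List.toFinset_cons,
      Finset.sum_insert hj, interactions_append, LinearMap.add_apply, Pi.add_apply,
      add_comm 1 A.length, interactions_apply_of_eq j B₁ _ hz, add_zero, Module.End.mul_apply,
      Module.End.mul_apply, moveRight_apply_of_eq j B₁ _ hz, h1, h2]

lemma Covariant.ham_apply_wall (hζ : Generic q ζ) {base : List P} (hb : base.Nodup)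
    {W : List P → State} (hW : Covariant q ζ base W) {F : Finset P → ℂ}
    (hF : WallComponents base W F) (A B : List P) (hp : (A ++ B).Perm base) :
    ham q ζ [] (A ++ B) (W (A ++ B)) (wall A.length) =
      ∑ j ∈ B.toFinset, ∑ x ∈ A.toFinset, hopAmplitude q ζ j x A.toFinset *
        (F A.toFinset - F ((insert j A.toFinset).erase x)) := by
  have h := hW.ham_apply_wall_of_append hζ hb hF A B [] (by simpa using hp)
  rw [List.append_nil] at h
  rw [ham_append, LinearMap.add_apply, Pi.add_apply, List.nil_append, h, ham_apply_of_eq, zero_add]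
  intro m hm hm'
  simp only [wall, decide_eq_decide]
  simp at hm'
  omega

end WallHamiltonian

section WallMap

variable {P : Type*} {q : ℂ} {ζ : P → ℂ}

/-- A covariant family vanishing at all domain walls vanishes. -/
lemma Covariant.eq_zero (hζ : Generic q ζ) {base : List P} (hb : base.Nodup)
    {W : List P → State} (hW : Covariant q ζ base W)
    (h : ∀ l M, l.Perm base → M ≤ base.length → W l (wall M) = 0) (s : ℕ) :
    ∀ (l : List P) (y : ℕ → Bool), l.Perm base →
      (∀ n, y n = true → 1 ≤ n ∧ n ≤ base.length) →
      ∑ n ∈ Finset.range (base.length + 1), (if y n then n else 0) = s → W l y = 0 := by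
  induction s using Nat.strong_induction_on with
  | _ s ih =>
    intro l y hl hy hs
    by_cases hk : ∃ k, 1 ≤ k ∧ y k = false ∧ y (k + 1) = true
    · obtain ⟨k, hk1, hk2, hk3⟩ := hk
      have hkN := (hy _ hk3).2
      rw [← hl.length_eq] at hkN
      obtain ⟨pre, a, b, t, rfl, hpre⟩ : ∃ pre a b t, l = pre ++ a :: b :: t ∧
          pre.length + 1 = k := by
        refine ⟨l.take (k - 1), l[k - 1], l[k], l.drop (k + 1), ?_, by simp; omega⟩
        rw [← List.drop_eq_getElem_cons (by omega)]
        conv_lhs => rw [← List.take_append_drop (k - 1) l]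
        rw [List.drop_eq_getElem_cons (i := k - 1) (by omega)]
        simp only [show k - 1 + 1 = k by omega]
      set y' := setPair y k true false with hy'
      have hy1 : ∀ n, y' n = true → 1 ≤ n ∧ n ≤ base.length := by
        intro n hn
        by_cases h1 : n = k
        · subst h1; exact ⟨hk1, by rw [← hl.length_eq]; omega⟩
        by_cases h2 : n = k + 1
        · subst h2; simp [hy'] at hn
        exact hy n (by rwa [hy', setPair_of_ne _ _ _ _ h1 h2] at hn)
      have hlt : ∑ n ∈ Finset.range (base.length + 1), (if y' n then n else 0) < s := by
        have hsplit : ∀ w : ℕ → Bool,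
            ∑ n ∈ Finset.range (base.length + 1), (if w n then n else 0) =
              (if w k then k else 0) + ((if w (k + 1) then k + 1 else 0) +
              ∑ n ∈ ((Finset.range (base.length + 1)).erase k).erase (k + 1),
                (if w n then n else 0)) := by
          intro w
          rw [Finset.add_sum_erase _ (fun n => if w n then n else 0)
            (by simp [← hl.length_eq] at hkN ⊢; omega), Finset.add_sum_erase _
            (fun n => if w n then n else 0) (by simp [← hl.length_eq] at hkN ⊢; omega)]
        rw [← hs, hsplit y, hsplit y', hk2, hk3]
        have hrest : ∑ n ∈ ((Finset.range (base.length + 1)).erase k).erase (k + 1),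
            (if y' n then n else 0) =
            ∑ n ∈ ((Finset.range (base.length + 1)).erase k).erase (k + 1),
            (if y n then n else 0) := by
          refine Finset.sum_congr rfl fun n hn => ?_
          simp only [Finset.mem_erase] at hn
          rw [hy', setPair_of_ne _ _ _ _ hn.2.1 hn.1]
        rw [hrest]
        simp [hy']
      have hab : a ≠ b := by
        have := hl.nodup_iff.2 hb
        simp [List.nodup_append] at this
        tauto
      have h1 := ih _ hlt _ y' (((List.Perm.swap a b t).append_left pre).trans hl) hy1 rfl
      have h2 := ih _ hlt _ y' hl hy1 rfl
      have hyy : setPair y k false true = y :=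
        setPair_eq_iff hk2 hk3 fun _ _ _ => rfl
      rw [hW pre a b t hl, hpre, exch_apply, h2, tl_apply, hy', setPair_fst, setPair_snd,
        setPair_setPair, setPair_setPair, hyy, ← hy', h2] at h1
      have hf : fcoef q (ζ a) (ζ b) ≠ 0 :=
        div_ne_zero (sub_ne_zero.2 (hζ.inj.ne hab)) (hζ.qsub_ne a b)
      simpa [tlWeight, hf, hζ.q_ne] using h1
    · push Not at hk
      obtain ⟨M, hM, rfl⟩ : ∃ M, M ≤ base.length ∧ y = wall M := by
        have hmono : ∀ d n, 1 ≤ n → y (n + d) = true → y n = true := by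
          intro d
          induction d with
          | zero => exact fun n _ h => h
          | succ d ihd =>
            intro n hn h
            refine ihd n hn ?_
            by_contra h0
            exact hk (n + d) (by omega) (by simpa using h0) h
        classical
        refine ⟨Nat.findGreatest (fun n => y n = true) base.length, Nat.findGreatest_le _, ?_⟩
        ext n
        rw [Bool.eq_iff_iff, wall, decide_eq_true_eq]
        constructor
        · exact fun h => ⟨(hy n h).1, Nat.le_findGreatest (hy n h).2 h⟩
        · rintro ⟨h1, h2⟩
          have := Nat.findGreatest_of_ne_zero (P := fun n => y n = true) (n := base.length) rfl
            (by omega)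
          obtain ⟨d, hd⟩ := Nat.exists_eq_add_of_le h2
          exact hmono d n h1 (hd ▸ this)
      exact h l M hl hM

variable [Fintype P] [DecidableEq P]

/-- The domain-wall components of all rearrangements of a vector, as a function on the sets of
particles with down spin. -/
def wallMap (q : ℂ) (ζ : P → ℂ) (base : List P) : State →ₗ[ℂ] (Finset P → ℂ) where
  toFun v I := rearrange q ζ 1 base (I.toList ++ Iᶜ.toList) v (wall I.card)
  map_add' v w := by ext I; simp
  map_smul' c v := by ext I; simp

/-- The Hamiltonian acting on functions on sets of particles. -/
def hopHam (q : ℂ) (ζ : P → ℂ) : (Finset P → ℂ) →ₗ[ℂ] (Finset P → ℂ) where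
  toFun F I := ∑ j ∈ Iᶜ, ∑ x ∈ I, hopAmplitude q ζ j x I * (F I - F ((insert j I).erase x))
  map_add' F G := by
    ext I
    simp only [Pi.add_apply, ← Finset.sum_add_distrib]
    exact Finset.sum_congr rfl fun j _ => Finset.sum_congr rfl fun x _ => by ring
  map_smul' c F := by
    ext I
    simp only [Pi.smul_apply, smul_eq_mul, RingHom.id_apply, Finset.mul_sum]
    exact Finset.sum_congr rfl fun j _ => Finset.sum_congr rfl fun x _ => by ring

lemma perm_toList_append_compl {base A B : List P} (hb : base.Nodup) (hmem : ∀ p, p ∈ base)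
    (hp : (A ++ B).Perm base) :
    A.Perm A.toFinset.toList ∧ B.Perm A.toFinsetᶜ.toList := by
  have hnd := List.nodup_append.1 (hp.nodup_iff.2 hb)
  refine ⟨(List.toFinset_toList hnd.1).symm, ?_⟩
  rw [List.perm_ext_iff_of_nodup hnd.2.1 (Finset.nodup_toList _)]
  intro x
  have hx := hp.mem_iff.2 (hmem x)
  simp only [Finset.mem_toList, Finset.mem_compl, List.mem_toFinset]
  rw [List.mem_append] at hx
  exact ⟨fun h h' => hnd.2.2 x h' x h rfl, fun h => hx.resolve_left h⟩

lemma toList_append_compl_perm {base : List P} (hb : base.Nodup) (hmem : ∀ p, p ∈ base)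
    (I : Finset P) : (I.toList ++ Iᶜ.toList).Perm base := by
  rw [List.perm_ext_iff_of_nodup _ hb]
  · intro x
    simp [hmem x, em]
  · refine List.nodup_append.2 ⟨Finset.nodup_toList _, Finset.nodup_toList _, ?_⟩
    rintro x hx y hy rfl
    simp at hx hy
    exact hy hx

lemma wallComponents_wallMap (hζ : Generic q ζ) {base : List P} (hb : base.Nodup)
    (hmem : ∀ p, p ∈ base) (v : State) :
    WallComponents base (fun l => rearrange q ζ 1 base l v) (wallMap q ζ base v) := by
  intro A B hp
  have hW := covariant_rearrange hζ hb v
  obtain ⟨hA, hB⟩ := perm_toList_append_compl hb hmem hp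
  have h1 := hW.apply_wall_of_perm hA B A.length [] (by simpa using hp) (by simp)
  have h2 := hW.apply_wall_of_perm hB [] A.length A.toFinset.toList
    (by simpa using ((hA.symm.append_right B).trans hp)) (by rw [hA.length_eq]; simp)
  simp only [List.nil_append, List.append_nil] at h1 h2
  simp only [h1, h2]
  simp only [wallMap, LinearMap.coe_mk, AddHom.coe_mk]
  rw [hA.length_eq, Finset.length_toList]

/-- The map `wallMap` intertwines the Hamiltonians. -/
lemma wallMap_ham (hζ : Generic q ζ) {base : List P} (hb : base.Nodup) (hmem : ∀ p, p ∈ base)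
    (v : State) : wallMap q ζ base (ham q ζ [] base v) = hopHam q ζ (wallMap q ζ base v) := by
  ext I
  have hp := toList_append_compl_perm hb hmem I
  have h := (covariant_rearrange hζ hb v).ham_apply_wall hζ hb
    (wallComponents_wallMap hζ hb hmem v) I.toList Iᶜ.toList hp
  simp only [Finset.toList_toFinset, Finset.length_toList, ← rearrange_ham hζ hb hp] at h
  exact h

lemma apply_eq_zero_of_wallMap_eq_zero (hζ : Generic q ζ) {base : List P} (hb : base.Nodup)
    (hmem : ∀ p, p ∈ base) {v : State} (hv : wallMap q ζ base v = 0) (y : ℕ → Bool)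
    (hy : ∀ n, y n = true → 1 ≤ n ∧ n ≤ base.length) : v y = 0 := by
  have hF := wallComponents_wallMap hζ hb hmem v
  have := (covariant_rearrange hζ hb v).eq_zero hζ hb (fun l M hl hM => ?_) _ base y
    (List.Perm.refl _) hy rfl
  · simpa [rearrange_self] using this
  · have h := hF (l.take M) (l.drop M) (by rwa [List.take_append_drop])
    rwa [List.take_append_drop, hv, Pi.zero_apply, List.length_take,
      min_eq_left (hM.trans_eq hl.length_eq.symm)] at h

end WallMap

/-! ### The spin chain inside the half-infinite chain -/

section Lift

variable {N : ℕ}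

/-- The label in `{1, …, N}` of a site. -/
def siteLabel (a : ZMod N) : ℕ := if a.val = 0 then N else a.val

lemma siteLabel_mem [NeZero N] (a : ZMod N) : 1 ≤ siteLabel a ∧ siteLabel a ≤ N := by
  have h1 := ZMod.val_lt a
  unfold siteLabel
  split_ifs <;> omega

lemma siteLabel_natCast {k : ℕ} (h1 : 1 ≤ k) (h2 : k ≤ N) : siteLabel (k : ZMod N) = k := by
  unfold siteLabel
  rw [ZMod.val_natCast]
  rcases h2.eq_or_lt with rfl | h
  · simp
  · rw [Nat.mod_eq_of_lt h, if_neg (by omega)]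

lemma natCast_siteLabel [NeZero N] (a : ZMod N) : (siteLabel a : ZMod N) = a := by
  unfold siteLabel
  split_ifs with h
  · rw [(ZMod.val_eq_zero a).1 h]; simp
  · simp

lemma siteLabel_eq_iff [NeZero N] {k : ℕ} (h1 : 1 ≤ k) (h2 : k ≤ N) (a : ZMod N) :
    siteLabel a = k ↔ a = k := by
  constructor
  · rintro rfl
    exact (natCast_siteLabel a).symm
  · rintro rfl
    exact siteLabel_natCast h1 h2

/-- The restriction of a configuration of the half-infinite chain to the sites `1, …, N`. -/
def restrictConfig (y : ℕ → Bool) : ZMod N → Bool := fun a => y (siteLabel a)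

/-- A vector of the spin chain, regarded as a vector of the half-infinite chain. -/
def lift : Chain N →ₗ[ℂ] State where
  toFun ψ y := ψ (restrictConfig y)
  map_add' _ _ := rfl
  map_smul' _ _ := rfl

lemma lift_apply (ψ : Chain N) (y : ℕ → Bool) : lift ψ y = ψ (restrictConfig y) := rfl

lemma restrictConfig_setPair [NeZero N] {k : ℕ} (h1 : 1 ≤ k) (h2 : k < N) (y : ℕ → Bool)
    (α β : Bool) : (restrictConfig (setPair y k α β) : ZMod N → Bool) =
      Function.update (Function.update (restrictConfig y) ((k : ℕ) : ZMod N) α)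
        ((k + 1 : ℕ) : ZMod N) β := by
  ext a
  simp only [restrictConfig, setPair, Function.update_apply, siteLabel_eq_iff h1 h2.le,
    siteLabel_eq_iff (show 1 ≤ k + 1 by omega) h2]

lemma lift_twoSiteOp [NeZero N] (A : Bool → Bool → Bool → Bool → ℂ) {k : ℕ} (h1 : 1 ≤ k)
    (h2 : k < N) (ψ : Chain N) (y : ℕ → Bool) :
    lift (twoSiteOp A ((k : ℕ) : ZMod N) ((k + 1 : ℕ) : ZMod N) ψ) y =
      ∑ s : Bool × Bool, A (y k) (y (k + 1)) s.1 s.2 * lift ψ (setPair y k s.1 s.2) := by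
  simp only [lift_apply, twoSiteOp, restrictConfig_setPair h1 h2]
  refine Finset.sum_congr rfl fun s _ => ?_
  congr 2
  · simp only [restrictConfig, siteLabel_natCast h1 h2.le]
  · simp only [restrictConfig, siteLabel_natCast (show 1 ≤ k + 1 by omega) h2]

lemma lift_eop [NeZero N] {q : ℂ} (hq : q ≠ 0) {k : ℕ} (h1 : 1 ≤ k) (h2 : k < N) (ψ : Chain N) :
    lift (eop N q k ψ) = tl q k (lift ψ) := by
  ext y
  rw [eop, lift_twoSiteOp _ h1 h2, tl_apply, Fintype.sum_prod_type]
  simp only [Fintype.sum_bool]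
  cases y k <;> cases y (k + 1) <;> simp [eE, tlWeight] <;> field_simp <;> ring

lemma lift_Rop [NeZero N] {q a b : ℂ} (hb : b ≠ 0) (hab : qsub q a b ≠ 0) {k : ℕ}
    (h1 : 1 ≤ k) (h2 : k < N) (hq : q ≠ 0) (ψ : Chain N) :
    lift (Rop N q (a / b) k ψ) = rmat q k a b (lift ψ) := by
  have hd : q * (a / b) - q⁻¹ = qsub q a b / b := by
    rw [qsub]; field_simp
  have hf : fR q (a / b) = fcoef q a b := by
    rw [fR, hd, fcoef]; field_simp
  have hg : gR q (a / b) = 1 - q * fcoef q a b := by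
    rw [gR, hd, fcoef]; field_simp; rw [qsub]; field_simp; ring
  have hug : a / b * (1 - q * fcoef q a b) = 1 - q⁻¹ * fcoef q a b := by
    rw [fcoef]; field_simp; rw [qsub]; field_simp; ring
  ext y
  have hy : lift ψ y = lift ψ (setPair y k (y k) (y (k + 1))) := by rw [setPair_self]
  rw [Rop, lift_twoSiteOp _ h1 h2, rmat, LinearMap.sub_apply, LinearMap.smul_apply,
    Pi.sub_apply, Pi.smul_apply, tl_apply, Fintype.sum_prod_type]
  simp only [Fintype.sum_bool, Module.End.one_apply]
  rw [hy]
  cases y k <;> cases y (k + 1) <;> simp only [RE, tlWeight, hf, hg, hug] <;> field_simp <;>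
    first | ring1 | (ring_nf; field_simp)

lemma isPrimitiveRoot_omega [NeZero N] : IsPrimitiveRoot (omega N) N :=
  Complex.isPrimitiveRoot_exp N (NeZero.ne N)

lemma z_ne_zero (j : ℕ) : z N j ≠ 0 := pow_ne_zero _ (Complex.exp_ne_zero _)

lemma z_pow [NeZero N] (j : ℕ) : z N j ^ N = 1 := by
  rw [z, ← pow_mul, mul_comm, pow_mul, isPrimitiveRoot_omega.pow_eq_one, one_pow]

lemma qsub_z_ne_zero [NeZero N] {q : ℂ} (hq : q ≠ 0) (hqN : q ^ (2 * N) ≠ 1) (i j : ℕ) :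
    qsub q (z N i) (z N j) ≠ 0 := by
  intro h
  rw [qsub_eq hq, div_eq_zero_iff, sub_eq_zero] at h
  have := congrArg (· ^ N) (h.resolve_right hq)
  simp only [mul_pow, z_pow, mul_one, ← pow_mul] at this
  exact hqN this

variable {q : ℂ}

lemma compList_append {α : Type*} (l l' : List (α → α)) :
    compList (l ++ l') = compList l ∘ compList l' := by
  induction l with
  | nil => rfl
  | cons a l ih => simp only [compList, List.cons_append, List.foldr_cons] at ih ⊢; rw [ih]; rfl

lemma lift_compList_moveLeft [NeZero N] (hq : q ≠ 0) (hqN : q ^ (2 * N) ≠ 1) (j n : ℕ) :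
    ∀ i, 1 ≤ i → i + n ≤ N → ∀ ψ : Chain N,
      lift (compList ((List.range' i n).map fun k => Rop N q (z N k / z N j) k) ψ) =
        moveLeft q (z N) j i (List.range' i n) (lift ψ) := by
  induction n with
  | zero => intro i _ _ ψ; rfl
  | succ n ih =>
    intro i h1 h2 ψ
    rw [List.range'_succ, List.map_cons, moveLeft, Module.End.mul_apply,
      ← ih (i + 1) (by omega) (by omega)]
    exact lift_Rop (z_ne_zero j) (qsub_z_ne_zero hq hqN i j) h1 (by omega) hq _

lemma lift_compList_moveRight [NeZero N] (hq : q ≠ 0) (hqN : q ^ (2 * N) ≠ 1) (j n : ℕ) :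
    ∀ i, 1 ≤ i → i + n ≤ N → ∀ ψ : Chain N,
      lift (compList ((List.range' i n).reverse.map fun k => Rop N q (z N j / z N k) k) ψ) =
        moveRight q (z N) j i (List.range' i n) (lift ψ) := by
  induction n with
  | zero => intro i _ _ ψ; rfl
  | succ n ih =>
    intro i h1 h2 ψ
    rw [List.range'_succ, List.reverse_cons, List.map_append, compList_append, moveRight,
      Module.End.mul_apply, Function.comp_apply, ih (i + 1) (by omega) (by omega)]
    congr 1
    exact lift_Rop (z_ne_zero i) (qsub_z_ne_zero hq hqN j i) h1 (by omega) hq _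

lemma lift_SL [NeZero N] (hq : q ≠ 0) (hqN : q ^ (2 * N) ≠ 1) {i j : ℕ} (hi : 1 ≤ i)
    (hij : i < j) (hj : j ≤ N) (ψ : Chain N) :
    lift (SL N q i j ψ) = (moveRight q (z N) j (i + 1) (List.range' (i + 1) (j - 1 - i)) *
      tl q i * moveLeft q (z N) j (i + 1) (List.range' (i + 1) (j - 1 - i))) (lift ψ) := by
  rw [Module.End.mul_apply, Module.End.mul_apply,
    ← lift_compList_moveLeft hq hqN j (j - 1 - i) (i + 1) (by omega) (by omega),
    ← lift_eop hq hi (by omega), ← lift_compList_moveRight hq hqN j _ _ (by omega) (by omega)]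
  rfl

lemma interactions_range' {ζ : ℕ → ℂ} (j n : ℕ) : ∀ i,
    interactions q ζ j i (List.range' i n) = ∑ m ∈ Finset.Ico i (i + n), vcoef q (ζ m) (ζ j) •
      (moveRight q ζ j (m + 1) (List.range' (m + 1) (i + n - 1 - m)) * tl q m *
        moveLeft q ζ j (m + 1) (List.range' (m + 1) (i + n - 1 - m))) := by
  induction n with
  | zero => intro i; simp [interactions]
  | succ n ih =>
    intro i
    rw [List.range'_succ, interactions, ih,
      Finset.sum_eq_sum_Ico_succ_bot (show i < i + (n + 1) by omega)]
    simp only [show i + (n + 1) - 1 - i = n by omega, show i + 1 + n = i + (n + 1) by omega]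

lemma ham_range' {ζ : ℕ → ℂ} (n : ℕ) : ∀ m,
    ham q ζ (List.range' 1 m) (List.range' (m + 1) n) =
      ∑ j ∈ Finset.Ico (m + 1) (m + 1 + n), interactions q ζ j 1 (List.range' 1 (j - 1)) := by
  induction n with
  | zero => intro i; simp [ham]
  | succ n ih =>
    intro m
    rw [List.range'_succ, ham, Finset.sum_eq_sum_Ico_succ_bot (by omega)]
    have h := ih (m + 1)
    rw [List.range'_concat] at h
    rw [show m + 1 + (n + 1) = m + 1 + 1 + n by omega, ← h]
    simp [add_comm]

section Reindexing

variable {P Q : Type*} (ζ : Q → ℂ) (g : P → Q)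

lemma moveLeft_map (j : P) (B : List P) (i : ℕ) :
    moveLeft q ζ (g j) i (B.map g) = moveLeft q (ζ ∘ g) j i B := by
  induction B generalizing i with
  | nil => rfl
  | cons a B ih => rw [List.map_cons, moveLeft, moveLeft, ih]; rfl

lemma moveRight_map (j : P) (B : List P) (i : ℕ) :
    moveRight q ζ (g j) i (B.map g) = moveRight q (ζ ∘ g) j i B := by
  induction B generalizing i with
  | nil => rfl
  | cons a B ih => rw [List.map_cons, moveRight, moveRight, ih]; rfl

lemma interactions_map (j : P) (B : List P) (i : ℕ) :
    interactions q ζ (g j) i (B.map g) = interactions q (ζ ∘ g) j i B := by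
  induction B generalizing i with
  | nil => rfl
  | cons a B ih =>
    rw [List.map_cons, interactions, interactions, ih, moveLeft_map, moveRight_map]; rfl

lemma ham_map (t : List P) : ∀ pre : List P,
    ham q ζ (pre.map g) (t.map g) = ham q (ζ ∘ g) pre t := by
  induction t with
  | nil => exact fun _ => rfl
  | cons j t ih =>
    intro pre
    rw [List.map_cons, ham, ham, ← ih, interactions_map, List.map_append]; rfl

end Reindexing

/-- The inhomogeneities of the chain. -/
def param (N : ℕ) (p : Fin N) : ℂ := z N (p + 1)

lemma map_finRange_succ (N : ℕ) :
    (List.finRange N).map (fun p : Fin N => (p : ℕ) + 1) = List.range' 1 N := by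
  refine List.ext_getElem (by simp) fun i h1 h2 => ?_
  simp [add_comm]

lemma param_injective [NeZero N] : Function.Injective (param N) := by
  intro a b h
  simp only [param, z, pow_succ] at h
  exact Fin.ext (isPrimitiveRoot_omega.pow_inj a.2 b.2
    (mul_right_cancel₀ (Complex.exp_ne_zero _) h))

lemma generic_param [NeZero N] (hq : q ≠ 0) (hqN : q ^ (2 * N) ≠ 1) : Generic q (param N) where
  q_ne := hq
  inj := param_injective
  qsub_ne _ _ := qsub_z_ne_zero hq hqN _ _

lemma lift_HL [NeZero N] (hq : q ≠ 0) (hqN : q ^ (2 * N) ≠ 1) (ψ : Chain N) :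
    lift (HL N q ψ) =
      (qint q N / (N : ℂ)) • ham q (param N) [] (List.finRange N) (lift ψ) := by
  have h1 : ham q (param N) [] (List.finRange N) = ham q (z N) [] (List.range' 1 N) := by
    rw [← map_finRange_succ]
    exact (ham_map (z N) (fun p : Fin N => (p : ℕ) + 1) (List.finRange N) []).symm
  have h2 := ham_range' (q := q) (ζ := z N) N 0
  rw [List.range'_zero] at h2
  rw [h1, h2, HL, Pi.smul_apply, map_smul, Finset.sum_apply, map_sum, LinearMap.sum_apply]
  congr 1
  refine Finset.sum_congr (by ext; simp; omega) fun j hj => ?_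
  rw [Finset.mem_Ico] at hj
  rw [interactions_range', Finset.sum_apply, map_sum, LinearMap.sum_apply]
  refine Finset.sum_congr (by rw [show 1 + (j - 1) = j by omega]) fun i hi => ?_
  rw [Finset.mem_Ico] at hi
  rw [Pi.smul_apply, map_smul, lift_SL hq hqN hi.1 (show i < j by omega) (by omega), LinearMap.smul_apply,
    show 1 + (j - 1) - 1 - i = j - 1 - i by omega]
  rfl

/-- The wall components of a vector of the spin chain. -/
def chainMap (N : ℕ) (q : ℂ) : Chain N →ₗ[ℂ] (Finset (Fin N) → ℂ) :=
  wallMap q (param N) (List.finRange N) ∘ₗ lift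

/-- The Hamiltonian in terms of wall components. -/
def kerHam (N : ℕ) (q : ℂ) : (Finset (Fin N) → ℂ) →ₗ[ℂ] (Finset (Fin N) → ℂ) :=
  (qint q N / (N : ℂ)) • hopHam q (param N)

lemma chainMap_HL [NeZero N] (hq : q ≠ 0) (hqN : q ^ (2 * N) ≠ 1) (ψ : Chain N) :
    chainMap N q (HL N q ψ) = kerHam N q (chainMap N q ψ) := by
  rw [chainMap, LinearMap.comp_apply, LinearMap.comp_apply, lift_HL hq hqN, map_smul,
    wallMap_ham (generic_param hq hqN) (List.nodup_finRange N) (List.mem_finRange ·), kerHam,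
    LinearMap.smul_apply]

lemma chainMap_injective [NeZero N] (hq : q ≠ 0) (hqN : q ^ (2 * N) ≠ 1) :
    Function.Injective (chainMap N q) := by
  rw [← LinearMap.ker_eq_bot, LinearMap.ker_eq_bot']
  intro ψ hψ
  ext x
  have h := apply_eq_zero_of_wallMap_eq_zero (generic_param hq hqN) (List.nodup_finRange N)
    (List.mem_finRange ·) hψ
    (fun n => if 1 ≤ n ∧ n ≤ N then x (n : ZMod N) else false) (by
      intro n hn
      rw [List.length_finRange]
      by_contra h
      rw [if_neg h] at hn
      exact absurd hn (by simp))
  rw [lift_apply] at h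
  refine Eq.trans (congrArg ψ (funext fun a => ?_)) h
  simp [restrictConfig, siteLabel_mem, natCast_siteLabel]

lemma chainMap_bijective [NeZero N] (hq : q ≠ 0) (hqN : q ^ (2 * N) ≠ 1) :
    Function.Bijective (chainMap N q) := by
  refine ⟨chainMap_injective hq hqN, ?_⟩
  refine (LinearMap.injective_iff_surjective_of_finrank_eq_finrank ?_).1
    (chainMap_injective hq hqN)
  simp [ZMod.card]

/-- The eigenvalues of the Hamiltonian are those of its left action on wall components. -/
lemma exists_eigenvector_HL_iff [NeZero N] (hq : q ≠ 0) (hqN : q ^ (2 * N) ≠ 1) (E : ℂ) :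
    (∃ ψ : Chain N, ψ ≠ 0 ∧ HL N q ψ = E • ψ) ↔
      ∃ φ : (Finset (Fin N) → ℂ) →ₗ[ℂ] ℂ, φ ≠ 0 ∧ φ ∘ₗ kerHam N q = E • φ := by
  have hb := chainMap_bijective hq hqN
  have h1 : (∃ ψ : Chain N, ψ ≠ 0 ∧ HL N q ψ = E • ψ) ↔
      ∃ F, F ≠ 0 ∧ kerHam N q F = E • F := by
    constructor
    · rintro ⟨ψ, h0, h⟩
      exact ⟨chainMap N q ψ, (map_ne_zero_iff _ hb.1).2 h0, by rw [← chainMap_HL hq hqN, h, map_smul]⟩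
    · rintro ⟨F, h0, h⟩
      obtain ⟨ψ, rfl⟩ := hb.2 F
      exact ⟨ψ, (map_ne_zero_iff _ hb.1).1 h0, hb.1 (by rw [chainMap_HL hq hqN, h, map_smul])⟩
  rw [h1]
  set A := kerHam N q - E • LinearMap.id with hA
  have h2 : (∃ F, F ≠ 0 ∧ kerHam N q F = E • F) ↔ ¬ Function.Injective A := by
    rw [← LinearMap.ker_eq_bot, LinearMap.ker_eq_bot']
    push Not
    refine exists_congr fun F => ?_
    rw [and_comm, hA, LinearMap.sub_apply, sub_eq_zero]; rfl
  rw [h2, LinearMap.injective_iff_surjective, ← LinearMap.range_eq_top]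
  constructor
  · intro h
    obtain ⟨φ, h0, h⟩ := Submodule.exists_le_ker_of_lt_top _ (lt_top_iff_ne_top.2 h)
    refine ⟨φ, h0, ?_⟩
    refine LinearMap.ext fun F => ?_
    have := h (LinearMap.mem_range_self A F)
    rw [LinearMap.mem_ker, hA, LinearMap.sub_apply, map_sub, sub_eq_zero] at this
    rw [LinearMap.comp_apply, this]
    simp
  · rintro ⟨φ, h0, h⟩ htop
    refine h0 (LinearMap.ext fun F => ?_)
    obtain ⟨F, rfl⟩ := LinearMap.range_eq_top.1 htop F
    have := LinearMap.congr_fun h F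
    rw [hA, LinearMap.sub_apply, map_sub]
    simp at this ⊢
    rw [this, sub_self]

end Lift

/-! ### Partial fractions and roots of unity -/

section PartialFractions

open Polynomial

lemma prod_erase_eq_prod_ite {α : Type*} [DecidableEq α] (t : Finset α) (i : α) (g : α → ℂ) :
    ∏ j ∈ t.erase i, g j = ∏ j ∈ t, if j = i then 1 else g j := by
  rw [← Finset.filter_ne', Finset.prod_filter]
  exact Finset.prod_congr rfl fun j _ => by by_cases h : j = i <;> simp [h]

/-- The sum of the residues of a rational function with simple poles and a double zero at
infinity vanishes. -/
lemma sum_residues_eq_zero {ι κ : Type*} [DecidableEq ι] [Fintype κ] [DecidableEq κ]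
    (A : Finset ι) {u : ι → ℂ} {v : κ → ℂ} {c : ℂ} (hu : Function.Injective u)
    (hv : Function.Injective v) (huv : ∀ a ∈ A, ∀ b, u a ≠ v b) (hc : ∀ a ∈ A, u a ≠ c)
    (hvc : ∀ b, v b ≠ c) {p : ℂ[X]} (hp : p.degree < (A.card + Fintype.card κ : ℕ)) :
    ∑ a ∈ A, p.eval (u a) /
        ((∏ a' ∈ A.erase a, (u a - u a')) * (∏ b, (u a - v b)) * (u a - c)) +
      ∑ b, p.eval (v b) /
        ((∏ a ∈ A, (v b - u a)) * (∏ b' ∈ Finset.univ.erase b, (v b - v b')) * (v b - c)) +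
      p.eval c / ((∏ a ∈ A, (c - u a)) * ∏ b, (c - v b)) = 0 := by
  set s : Finset (Option (ι ⊕ κ)) := Finset.insertNone (A.disjSum Finset.univ) with hs
  set f : Option (ι ⊕ κ) → ℂ := fun i => i.elim c (Sum.elim u v) with hf
  have hcard : s.card = A.card + Fintype.card κ + 1 := by
    rw [hs, Finset.card_insertNone, Finset.card_disjSum, Finset.card_univ]
  have hinj : Set.InjOn f s := by
    rintro (_ | (a | b)) ha (_ | (a' | b')) ha' h <;> simp [hs, hf] at ha ha' h ⊢
    · exact hc _ ha' h.symm
    · exact hvc _ h.symm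
    · exact hc _ ha h
    · exact hu h
    · exact huv _ ha _ h
    · exact hvc _ h
    · exact huv _ ha' _ h.symm
    · exact hv h
  have key := Lagrange.coeff_eq_sum hinj (P := p) (by
    rw [hcard]; exact hp.trans (by exact_mod_cast Nat.lt_succ_self _))
  rw [hcard, Nat.add_sub_cancel, coeff_eq_zero_of_degree_lt hp] at key
  rw [key, hs]
  simp only [prod_erase_eq_prod_ite, Finset.sum_insertNone, Finset.prod_insertNone, Finset.sum_disjSum,
    Finset.prod_disjSum, hf, Option.elim_none, Option.elim_some, Sum.elim_inl, Sum.elim_inr,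
    reduceCtorEq, if_false, if_true, Option.some.injEq, Sum.inl.injEq, Sum.inr.injEq, one_mul]
  rw [add_comm]
  refine congrArg₂ _ rfl (congrArg₂ _ (Finset.sum_congr rfl fun i _ => ?_)
    (Finset.sum_congr rfl fun i _ => ?_)) <;> congr 1 <;> ring

end PartialFractions

section RootsOfUnity

open Polynomial

variable {N : ℕ} {q : ℂ}

lemma param_ne_zero (p : Fin N) : param N p ≠ 0 := z_ne_zero _

variable [NeZero N]

lemma param_pow (p : Fin N) : param N p ^ N = 1 := z_pow _

lemma nodal_param : Lagrange.nodal Finset.univ (param N) = X ^ N - 1 := by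
  rw [X_pow_sub_one_eq_prod (Nat.pos_of_ne_zero (NeZero.ne N)) (isPrimitiveRoot_omega (N := N)),
    Lagrange.nodal_eq, ← Finset.prod_image (g := param N) (f := fun w => X - C w)
      param_injective.injOn]
  refine Finset.prod_congr (Finset.eq_of_subset_of_card_le ?_ ?_) fun _ _ => rfl
  · intro w hw
    obtain ⟨p, -, rfl⟩ := Finset.mem_image.1 hw
    exact (mem_nthRootsFinset (Nat.pos_of_ne_zero (NeZero.ne N)) _).2 (param_pow p)
  · rw [isPrimitiveRoot_omega.card_nthRootsFinset, Finset.card_image_of_injective _ param_injective]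
    simp

lemma prod_sub_param (w : ℂ) : ∏ p, (w - param N p) = w ^ N - 1 := by
  rw [← Lagrange.eval_nodal, nodal_param]; simp

lemma prod_qsub_param (hq : q ≠ 0) (w : ℂ) :
    ∏ p, qsub q w (param N p) = q ^ N * w ^ N - q⁻¹ ^ N := by
  have h : ∀ p : Fin N, qsub q w (param N p) = q⁻¹ * (q ^ 2 * w - param N p) := by
    intro p; rw [qsub]; field_simp
  simp only [h, Finset.prod_mul_distrib, prod_sub_param, Finset.prod_const, Finset.card_univ,
    Fintype.card_fin]
  rw [inv_pow]
  field_simp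
  ring

lemma prod_erase_sub_param (p : Fin N) :
    ∏ p' ∈ Finset.univ.erase p, (param N p - param N p') = N / param N p := by
  have h := Lagrange.eval_nodal_derivative_eval_node_eq (v := param N) (Finset.mem_univ p)
  rw [Lagrange.eval_nodal] at h
  rw [← h, nodal_param]
  have h1 : param N p ^ (N - 1) * param N p = 1 := by
    rw [← pow_succ, Nat.sub_add_cancel (Nat.pos_of_ne_zero (NeZero.ne N)), param_pow]
  rw [derivative_sub, derivative_X_pow]
  simp
  field_simp [param_ne_zero p]
  rw [mul_assoc, h1, mul_one]

lemma sum_div_sub_param {w : ℂ} (hw : ∀ p : Fin N, w ≠ param N p) :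
    (∑ p, w / (w - param N p)) * (w ^ N - 1) = N * w ^ N := by
  have h := congrArg (eval w) (Lagrange.derivative_nodal (s := Finset.univ) (v := param N))
  rw [nodal_param] at h
  simp [derivative_X_pow, eval_finsetSum, Lagrange.eval_nodal] at h
  rw [Finset.sum_mul]
  have h2 : ∀ p : Fin N, w / (w - param N p) * (w ^ N - 1) =
      w * ∏ p' ∈ Finset.univ.erase p, (w - param N p') := by
    intro p
    rw [← prod_sub_param, ← Finset.mul_prod_erase _ _ (Finset.mem_univ p)]
    field_simp [sub_ne_zero.2 (hw p)]
  rw [Finset.sum_congr rfl fun p _ => h2 p, ← Finset.mul_sum, ← h]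
  obtain ⟨m, rfl⟩ := Nat.exists_eq_succ_of_ne_zero (NeZero.ne N)
  simp [pow_succ]
  ring

end RootsOfUnity

/-! ### The Hamiltonian on product functions -/

section ProductFunctions

open Polynomial

variable {N : ℕ} {q : ℂ}

lemma sq_ne_one_of_pow_ne_one (hqN : q ^ (2 * N) ≠ 1) : q ^ 2 ≠ 1 := by
  intro h
  rw [pow_mul, h, one_pow] at hqN
  exact hqN rfl

lemma sub_inv_ne_zero (hq : q ≠ 0) (hqN : q ^ (2 * N) ≠ 1) : q - q⁻¹ ≠ 0 := by
  intro h
  refine sq_ne_one_of_pow_ne_one hqN ?_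
  field_simp at h
  linear_combination h

/-- The residue weight of the point `ζ_x` in the set `A`. -/
def resWeight (q : ℂ) (N : ℕ) (A : Finset (Fin N)) (x : Fin N) : ℂ :=
  (∏ k ∈ A, qsub q (param N x) (param N k)) / ∏ k ∈ A.erase x, (param N x - param N k)

lemma resWeight_eq {A : Finset (Fin N)} {x : Fin N} (hx : x ∈ A) : resWeight q N A x =
    (q - q⁻¹) * param N x * ∏ k ∈ A.erase x, hopRatio q (param N) x k := by
  simp only [hopRatio]
  rw [resWeight, ← Finset.mul_prod_erase _ _ hx, Finset.prod_div_distrib, qsub, ← sub_mul,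
    mul_div_assoc]

/-- The function on sets of particles with values `f ζ_x` in the set and `g ζ_y` outside. -/
def productFun (N : ℕ) (f g : ℂ → ℂ) (I : Finset (Fin N)) : ℂ :=
  (∏ x ∈ I, f (param N x)) * ∏ y ∈ Iᶜ, g (param N y)

lemma productFun_swap {f g : ℂ → ℂ} {I : Finset (Fin N)} {j x : Fin N} (hj : j ∈ Iᶜ)
    (hx : x ∈ I) :
    productFun N f g ((insert j I).erase x) * (f (param N x) * g (param N j)) =
      productFun N f g I * (f (param N j) * g (param N x)) := by
  have hjI : j ∉ I := Finset.mem_compl.1 hj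
  have hne : j ≠ x := fun h => hjI (h ▸ hx)
  have h1 : ((insert j I).erase x)ᶜ = insert x (Iᶜ.erase j) := by
    ext k
    simp only [Finset.mem_compl, Finset.mem_erase, Finset.mem_insert]
    by_cases h : k = x
    · subst h; simp
    · simp [h]
  rw [productFun, productFun, h1, Finset.erase_insert_of_ne hne,
    Finset.prod_insert (by simp [hjI]), Finset.prod_insert (by simp [hx]),
    ← Finset.mul_prod_erase I _ hx, ← Finset.mul_prod_erase Iᶜ _ hj]
  ring

variable [NeZero N]

lemma prod_hopRatio_param (hq : q ≠ 0) (hqN : q ^ (2 * N) ≠ 1) (j : Fin N) :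
    ∏ k ∈ Finset.univ.erase j, hopRatio q (param N) j k = qint q N / N := by
  have hκ := sub_inv_ne_zero hq hqN
  have hj := param_ne_zero j
  have h := prod_qsub_param (N := N) hq (param N j)
  rw [← Finset.mul_prod_erase _ _ (Finset.mem_univ j), param_pow, mul_one, qsub, ← sub_mul] at h
  simp only [hopRatio]
  rw [Finset.prod_div_distrib, prod_erase_sub_param, qint, ← h]
  generalize q - q⁻¹ = κ at hκ
  field_simp

lemma mul_hopAmplitude (hq : q ≠ 0) (hqN : q ^ (2 * N) ≠ 1) {I : Finset (Fin N)} {j x : Fin N}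
    (hj : j ∈ Iᶜ) (hx : x ∈ I) :
    (q - q⁻¹) ^ 2 * (qint q N / N * hopAmplitude q (param N) j x I) =
      - (resWeight q N I x * resWeight q N Iᶜ j / (param N j - param N x) ^ 2) := by
  have hg := generic_param (N := N) hq hqN
  have hjI : j ∉ I := Finset.mem_compl.1 hj
  have hjx : param N j - param N x ≠ 0 :=
    sub_ne_zero.2 fun h => hjI (param_injective h ▸ hx)
  have hsplit : (Finset.univ : Finset (Fin N)).erase j = Iᶜ.erase j ∪ I := by
    ext k; simp; by_cases h : k = j
    · subst h; simp [hjI]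
    · simp [h]; tauto
  have hdisj : Disjoint (Iᶜ.erase j) I := by
    rw [Finset.disjoint_left]; intro k hk; exact Finset.mem_compl.1 (Finset.mem_of_mem_erase hk)
  have hcancel : (∏ y ∈ I.erase x, hopRatio q (param N) j y) *
      ∏ y ∈ I.erase x, fcoef q (param N j) (param N y) = 1 := by
    rw [← Finset.prod_mul_distrib]
    refine Finset.prod_eq_one fun y hy => ?_
    have h1 : param N j - param N y ≠ 0 :=
      sub_ne_zero.2 fun h => hjI (param_injective h ▸ Finset.mem_of_mem_erase hy)
    rw [hopRatio, fcoef]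
    field_simp [hg.qsub_ne j y]
  rw [← prod_hopRatio_param hq hqN j, hsplit, Finset.prod_union hdisj,
    ← Finset.mul_prod_erase I _ hx, hopAmplitude, Finset.prod_mul_distrib, resWeight_eq hx,
    resWeight_eq hj, hopWeight]
  have h2 : hopRatio q (param N) j x = qsub q (param N j) (param N x) / (param N j - param N x) :=
    rfl
  rw [h2]
  have h3 := hg.qsub_ne j x
  generalize q - q⁻¹ = κ
  field_simp
  linear_combination (-(κ ^ 2 * (param N x) * (param N j) * (∏ x ∈ Iᶜ.erase j, hopRatio q (param N) j x) *
    ∏ x_1 ∈ I.erase x, hopRatio q (param N) x x_1)) * hcancel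

lemma kerHam_productFun (hq : q ≠ 0) (hqN : q ^ (2 * N) ≠ 1) {f g : ℂ → ℂ}
    (hf : ∀ p, f (param N p) ≠ 0) (hg : ∀ p, g (param N p) ≠ 0) (I : Finset (Fin N)) :
    (q - q⁻¹) ^ 2 * kerHam N q (productFun N f g) I =
      - (productFun N f g I * ∑ x ∈ I, resWeight q N I x * ∑ j ∈ Iᶜ, resWeight q N Iᶜ j *
        ((f (param N x) * g (param N j) - f (param N j) * g (param N x)) /
          ((param N j - param N x) ^ 2 * (f (param N x) * g (param N j))))) := by
  have h0 : kerHam N q (productFun N f g) I = ∑ j ∈ Iᶜ, ∑ x ∈ I, qint q N / N *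
      hopAmplitude q (param N) j x I *
        (productFun N f g I - productFun N f g ((insert j I).erase x)) := by
    simp only [kerHam, hopHam, LinearMap.smul_apply, LinearMap.coe_mk, AddHom.coe_mk,
      Pi.smul_apply, smul_eq_mul, Finset.mul_sum, mul_assoc]
  rw [h0, Finset.sum_comm]
  simp only [Finset.mul_sum, ← Finset.sum_neg_distrib]
  refine Finset.sum_congr rfl fun x hx => Finset.sum_congr rfl fun j hj => ?_
  have hfx := hf x
  have hgj := hg j
  have hd : productFun N f g I - productFun N f g ((insert j I).erase x) =
      productFun N f g I * ((f (param N x) * g (param N j) - f (param N j) * g (param N x)) /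
        (f (param N x) * g (param N j))) := by
    field_simp
    linear_combination -productFun_swap (f := f) (g := g) hj hx
  rw [hd, ← mul_assoc, mul_hopAmplitude hq hqN hj hx]
  have hjx : param N j - param N x ≠ 0 :=
    sub_ne_zero.2 fun h => Finset.mem_compl.1 hj (param_injective h ▸ hx)
  field_simp

end ProductFunctions

section ProductPolynomials

open Polynomial

variable {N : ℕ} {q : ℂ} {r : ℕ}

/-- The polynomial `∏_{k ∈ A} (q X - q⁻¹ ζ_k)`. -/
def qnodal (q : ℂ) (N : ℕ) (A : Finset (Fin N)) : ℂ[X] :=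
  ∏ k ∈ A, (C q * X - C (q⁻¹ * param N k))

lemma eval_qnodal (A : Finset (Fin N)) (w : ℂ) :
    (qnodal q N A).eval w = ∏ k ∈ A, qsub q w (param N k) := by
  simp [qnodal, eval_prod, qsub]

lemma degree_qnodal_le (A : Finset (Fin N)) : (qnodal q N A).degree ≤ (A.card : ℕ) := by
  rw [qnodal, ← nsmul_one, ← Finset.sum_const]
  refine (degree_prod_le _ _).trans (Finset.sum_le_sum fun k _ => ?_)
  refine (degree_sub_le _ _).trans (max_le (degree_C_mul_X_le _) ?_)
  exact degree_C_le.trans (by exact_mod_cast zero_le_one)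

/-- The product of the two-point ratios over the points of `A`. -/
def ratioProd (q : ℂ) (N : ℕ) (A : Finset (Fin N)) (w : ℂ) : ℂ :=
  ∏ k ∈ A, qsub q w (param N k) / (w - param N k)

/-- The monic polynomial function with roots `s`. -/
def rootProd {r : ℕ} (s : Fin r → ℂ) (w : ℂ) : ℂ := ∏ n, (w - s n)

lemma eval_nodal_eq_rootProd (s : Fin r → ℂ) (w : ℂ) :
    (Lagrange.nodal Finset.univ s).eval w = rootProd s w := Lagrange.eval_nodal

lemma eval_derivative_nodal {s : Fin r → ℂ} {w : ℂ} (hw : ∀ n, w ≠ s n) :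
    (derivative (Lagrange.nodal Finset.univ s)).eval w =
      rootProd s w * ∑ n, 1 / (w - s n) := by
  rw [Lagrange.derivative_nodal, eval_finsetSum, Finset.mul_sum]
  refine Finset.sum_congr rfl fun n hn => ?_
  rw [Lagrange.eval_nodal, rootProd, ← Finset.mul_prod_erase _ _ hn]
  field_simp [sub_ne_zero.2 (hw n)]

variable [NeZero N]

lemma sum_resWeight_compl {s t : Fin r → ℂ} (ht : Function.Injective t)
    (hsp : ∀ n p, s n ≠ param N p) (htp : ∀ m p, t m ≠ param N p) {J : Finset (Fin N)}
    {x : Fin N} (hx : x ∉ J) :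
    ∑ j ∈ J, resWeight q N J j *
        ((rootProd s (param N x) * rootProd t (param N j) -
            rootProd s (param N j) * rootProd t (param N x)) /
          ((param N j - param N x) ^ 2 * (rootProd s (param N x) * rootProd t (param N j)))) =
      ∑ m, ratioProd q N J (t m) * rootProd s (t m) /
          (∏ m' ∈ Finset.univ.erase m, (t m - t m')) *
          (rootProd t (param N x) / (rootProd s (param N x) * (param N x - t m) ^ 2)) -
        ratioProd q N J (param N x) *
          (∑ m, 1 / (param N x - t m) - ∑ n, 1 / (param N x - s n)) := by
  set a := param N x with ha
  have hS : rootProd s a ≠ 0 := Finset.prod_ne_zero_iff.2 fun n _ => sub_ne_zero.2 (hsp n x).symm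
  have hT : ∀ p, rootProd t (param N p) ≠ 0 := fun p =>
    Finset.prod_ne_zero_iff.2 fun n _ => sub_ne_zero.2 (htp n p).symm
  set R := C (rootProd s a) * Lagrange.nodal Finset.univ t -
    C (rootProd t a) * Lagrange.nodal Finset.univ s with hR
  have hRe : ∀ w, R.eval w = rootProd s a * rootProd t w - rootProd t a * rootProd s w := by
    intro w; simp [hR, eval_nodal_eq_rootProd]
  obtain ⟨Q, hQ⟩ : X - C a ∣ R := by
    rw [dvd_iff_isRoot, IsRoot, hRe]; ring
  have hQe : ∀ w, (w - a) * Q.eval w = rootProd s a * rootProd t w - rootProd t a * rootProd s w := by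
    intro w; rw [← hRe, hQ]; simp
  have hQa : Q.eval a = rootProd s a * rootProd t a *
      (∑ m, 1 / (a - t m) - ∑ n, 1 / (a - s n)) := by
    have h := congrArg (fun P => (derivative P).eval a) hQ
    simp [hR] at h
    rw [← h, eval_derivative_nodal fun n => (hsp n x).symm,
      eval_derivative_nodal fun n => (htp n x).symm]
    ring
  have hdeg : (qnodal q N J * Q).degree < (J.card + Fintype.card (Fin r) : ℕ) := by
    rcases eq_or_ne Q 0 with rfl | hQ0
    · rw [mul_zero, degree_zero]; exact WithBot.bot_lt_coe _
    have h1 : R.degree ≤ (r : ℕ) := by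
      have hn : ∀ v : Fin r → ℂ, (Lagrange.nodal Finset.univ v).degree = (r : ℕ) := by
        intro v; rw [Lagrange.degree_nodal]; simp
      refine (degree_sub_le _ _).trans (max_le ?_ ?_)
      · exact ((degree_C_mul hS).trans (hn t)).le
      · exact ((degree_C_mul (hT x)).trans (hn s)).le
    rw [hQ, degree_mul, degree_X_sub_C, degree_eq_natDegree hQ0] at h1
    have h2 : Q.natDegree < r := by
      have : 1 + Q.natDegree ≤ r := by exact_mod_cast h1
      omega
    refine (degree_mul_le _ _).trans_lt ?_
    rw [Fintype.card_fin, Nat.cast_add, degree_eq_natDegree hQ0]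
    calc (qnodal q N J).degree + (Q.natDegree : WithBot ℕ)
        ≤ ((J.card + Q.natDegree : ℕ) : WithBot ℕ) := by
          rw [Nat.cast_add]; exact add_le_add (degree_qnodal_le J) le_rfl
      _ < _ := by exact_mod_cast Nat.add_lt_add_left h2 _
  have key := sum_residues_eq_zero J (u := param N) (v := t) (c := a) param_injective ht
    (fun j _ m => (htp m j).symm) (fun j hj h => hx (param_injective h ▸ hj)) (fun m => htp m x) hdeg
  have e1 : ∀ j ∈ J, (qnodal q N J * Q).eval (param N j) /
      ((∏ a' ∈ J.erase j, (param N j - param N a')) * (∏ b, (param N j - t b)) * (param N j - a)) =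
      rootProd s a * (resWeight q N J j *
        ((rootProd s a * rootProd t (param N j) - rootProd s (param N j) * rootProd t a) /
          ((param N j - a) ^ 2 * (rootProd s a * rootProd t (param N j))))) := by
    intro j hj
    have h0 : param N j - a ≠ 0 := sub_ne_zero.2 fun h => hx (param_injective h ▸ hj)
    have h1 := hQe (param N j)
    have h2 : ∏ b, (param N j - t b) = rootProd t (param N j) := rfl
    have h3 : ∏ a' ∈ J.erase j, (param N j - param N a') ≠ 0 :=
      Finset.prod_ne_zero_iff.2 fun k hk => sub_ne_zero.2 fun h =>
        Finset.ne_of_mem_erase hk (param_injective h).symm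
    have h4 := hT j
    rw [h2, eval_mul, eval_qnodal, resWeight]
    field_simp
    linear_combination (∏ k ∈ J, qsub q (param N j) (param N k)) * h1
  have e2 : ∀ m, (qnodal q N J * Q).eval (t m) /
      ((∏ j ∈ J, (t m - param N j)) * (∏ m' ∈ Finset.univ.erase m, (t m - t m')) * (t m - a)) =
      - (rootProd s a * (ratioProd q N J (t m) * rootProd s (t m) /
          (∏ m' ∈ Finset.univ.erase m, (t m - t m')) *
          (rootProd t a / (rootProd s a * (a - t m) ^ 2)))) := by
    intro m
    have h0 : t m - a ≠ 0 := sub_ne_zero.2 (htp m x)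
    have h0' : a - t m ≠ 0 := sub_ne_zero.2 (htp m x).symm
    have h1 := hQe (t m)
    have h2 : rootProd t (t m) = 0 := Finset.prod_eq_zero (Finset.mem_univ m) (sub_self _)
    have h3 : ∏ m' ∈ Finset.univ.erase m, (t m - t m') ≠ 0 :=
      Finset.prod_ne_zero_iff.2 fun k hk => sub_ne_zero.2 fun h =>
        Finset.ne_of_mem_erase hk (ht h).symm
    have h4 : ∏ j ∈ J, (t m - param N j) ≠ 0 :=
      Finset.prod_ne_zero_iff.2 fun k hk => sub_ne_zero.2 (htp m k)
    have h5 : Q.eval (t m) = - (rootProd t a * rootProd s (t m)) / (t m - a) := by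
      rw [eq_div_iff h0]; rw [h2] at h1; linear_combination h1
    rw [eval_mul, eval_qnodal, ratioProd, Finset.prod_div_distrib, h5,
      show (a - t m) ^ 2 = (t m - a) ^ 2 by ring]
    field_simp
  rw [Finset.sum_congr rfl e1, Finset.sum_congr rfl fun m _ => e2 m, eval_mul, eval_qnodal, hQa,
    Finset.sum_neg_distrib, ← Finset.mul_sum, ← Finset.mul_sum] at key
  have e3 : (∏ k ∈ J, qsub q a (param N k)) * (rootProd s a * rootProd t a *
      (∑ m, 1 / (a - t m) - ∑ n, 1 / (a - s n))) /
      ((∏ j ∈ J, (a - param N j)) * ∏ b, (a - t b)) =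
      rootProd s a * (ratioProd q N J a * (∑ m, 1 / (a - t m) - ∑ n, 1 / (a - s n))) := by
    have h2 : ∏ b, (a - t b) = rootProd t a := rfl
    have h4 : ∏ j ∈ J, (a - param N j) ≠ 0 :=
      Finset.prod_ne_zero_iff.2 fun k hk => sub_ne_zero.2 fun h => hx (param_injective h ▸ hk)
    have h5 : rootProd t a ≠ 0 := hT x
    rw [h2, ratioProd, Finset.prod_div_distrib]
    field_simp
  rw [e3] at key
  refine mul_left_cancel₀ hS ?_
  linear_combination key

lemma sum_resWeight {s t : Fin r → ℂ} (hs : Function.Injective s)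
    (hst : ∀ n m, s n ≠ t m) (hsp : ∀ n p, s n ≠ param N p) (htp : ∀ m p, t m ≠ param N p)
    (I : Finset (Fin N)) (m : Fin r) :
    ∑ x ∈ I, resWeight q N I x *
        (rootProd t (param N x) / (rootProd s (param N x) * (param N x - t m) ^ 2)) =
      - (ratioProd q N I (t m) * (∏ m' ∈ Finset.univ.erase m, (t m - t m')) / rootProd s (t m)) -
        ∑ n, ratioProd q N I (s n) * (∏ m' ∈ Finset.univ.erase m, (s n - t m')) /
          ((∏ n' ∈ Finset.univ.erase n, (s n - s n')) * (s n - t m)) := by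
  set P := ∏ m' ∈ Finset.univ.erase m, (X - C (t m')) with hP
  have hPe : ∀ w, P.eval w = ∏ m' ∈ Finset.univ.erase m, (w - t m') := by
    intro w; simp [hP, eval_prod]
  have hPT : ∀ w, rootProd t w = (w - t m) * P.eval w := by
    intro w; rw [hPe, rootProd, ← Finset.mul_prod_erase _ _ (Finset.mem_univ m)]
  have hdeg : (qnodal q N I * P).degree < (I.card + Fintype.card (Fin r) : ℕ) := by
    refine (degree_mul_le _ _).trans_lt ?_
    have h1 : P.degree = ((Finset.univ.erase m).card : ℕ) := by
      rw [hP, degree_prod]; simp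
    have h2 : (Finset.univ.erase m).card < Fintype.card (Fin r) :=
      Finset.card_erase_lt_of_mem (Finset.mem_univ m)
    calc (qnodal q N I).degree + P.degree
        ≤ ((I.card + (Finset.univ.erase m).card : ℕ) : WithBot ℕ) := by
          rw [Nat.cast_add, h1]; exact add_le_add (degree_qnodal_le I) le_rfl
      _ < _ := by exact_mod_cast Nat.add_lt_add_left h2 _
  have key := sum_residues_eq_zero I (u := param N) (v := s) (c := t m) param_injective hs
    (fun x _ n => (hsp n x).symm) (fun x _ => (htp m x).symm) (fun n => hst n m) hdeg
  have e1 : ∀ x ∈ I, (qnodal q N I * P).eval (param N x) /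
      ((∏ a' ∈ I.erase x, (param N x - param N a')) * (∏ b, (param N x - s b)) *
        (param N x - t m)) = resWeight q N I x *
        (rootProd t (param N x) / (rootProd s (param N x) * (param N x - t m) ^ 2)) := by
    intro x _
    have h0 : param N x - t m ≠ 0 := sub_ne_zero.2 (htp m x).symm
    have h1 : ∏ b, (param N x - s b) = rootProd s (param N x) := rfl
    have h2 : ∏ a' ∈ I.erase x, (param N x - param N a') ≠ 0 :=
      Finset.prod_ne_zero_iff.2 fun k hk => sub_ne_zero.2 fun h =>
        Finset.ne_of_mem_erase hk (param_injective h).symm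
    have h3 : rootProd s (param N x) ≠ 0 :=
      Finset.prod_ne_zero_iff.2 fun n _ => sub_ne_zero.2 (hsp n x).symm
    rw [h1, hPT, eval_mul, eval_qnodal, resWeight]
    field_simp
  have e2 : ∀ n, (qnodal q N I * P).eval (s n) /
      ((∏ a ∈ I, (s n - param N a)) * (∏ b' ∈ Finset.univ.erase n, (s n - s b')) *
        (s n - t m)) = ratioProd q N I (s n) * (∏ m' ∈ Finset.univ.erase m, (s n - t m')) /
          ((∏ n' ∈ Finset.univ.erase n, (s n - s n')) * (s n - t m)) := by
    intro n
    rw [eval_mul, eval_qnodal, hPe, ratioProd, Finset.prod_div_distrib]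
    simp only [div_eq_mul_inv, mul_inv]
    ring
  have e3 : (qnodal q N I * P).eval (t m) / ((∏ a ∈ I, (t m - param N a)) * ∏ b, (t m - s b)) =
      ratioProd q N I (t m) * (∏ m' ∈ Finset.univ.erase m, (t m - t m')) / rootProd s (t m) := by
    rw [eval_mul, eval_qnodal, hPe, ratioProd, Finset.prod_div_distrib, rootProd]
    simp only [div_eq_mul_inv, mul_inv]
    ring
  rw [Finset.sum_congr rfl e1, Finset.sum_congr rfl fun n _ => e2 n, e3] at key
  linear_combination key

/-- The coefficient with which `s n` and `t m` are simultaneously shifted. -/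
def shiftCoef {r : ℕ} (s t : Fin r → ℂ) (n m : Fin r) : ℂ :=
  (∏ n' ∈ Finset.univ.erase n, (t m - s n') / (s n - s n')) *
    ∏ m' ∈ Finset.univ.erase m, (s n - t m') / (t m - t m')

lemma resWeight_mul_ratioProd (hq : q ≠ 0) {I : Finset (Fin N)} {x : Fin N} (hx : x ∈ I) :
    resWeight q N I x * ratioProd q N Iᶜ (param N x) =
      (q ^ N - q⁻¹ ^ N) / N * param N x := by
  have h1 := prod_qsub_param (N := N) hq (param N x)
  have h2 := prod_erase_sub_param x
  have h3 : Finset.univ.erase x = I.erase x ∪ Iᶜ := by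
    ext k; simp only [Finset.mem_erase, Finset.mem_univ, Finset.mem_union, Finset.mem_compl]
    by_cases h : k = x
    · subst h; simp [hx]
    · simp [h]; tauto
  rw [h3, Finset.prod_union (by
    rw [Finset.disjoint_left]; intro k hk
    simpa using Finset.mem_of_mem_erase hk)] at h2
  rw [← Finset.prod_mul_prod_compl I, param_pow, mul_one] at h1
  rw [resWeight, ratioProd, Finset.prod_div_distrib, div_mul_div_comm, h1, h2, div_div_eq_mul_div,
    mul_div_right_comm]

lemma ratioProd_mul_compl (hq : q ≠ 0) (I : Finset (Fin N)) {w : ℂ} (hw : ∀ p, w ≠ param N p) :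
    ratioProd q N I w * ratioProd q N Iᶜ w =
      q⁻¹ ^ N + (q ^ N - q⁻¹ ^ N) / N * ∑ p, w / (w - param N p) := by
  have hN : (N : ℂ) ≠ 0 := Nat.cast_ne_zero.2 (NeZero.ne N)
  have h0 : w ^ N - 1 ≠ 0 := by
    rw [← prod_sub_param]; exact Finset.prod_ne_zero_iff.2 fun p _ => sub_ne_zero.2 (hw p)
  have h1 := sum_div_sub_param hw
  rw [ratioProd, ratioProd, Finset.prod_mul_prod_compl I
    (fun k => qsub q w (param N k) / (w - param N k)), Finset.prod_div_distrib,
    prod_qsub_param hq, prod_sub_param, ← eq_div_iff h0] at *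
  rw [h1]
  generalize q⁻¹ = q'
  field_simp
  ring

/-- The action of the Hamiltonian on the generating functions `∏_{x ∈ I} S(ζ_x) ∏_{y ∉ I} T(ζ_y)`. -/
lemma kerHam_rootProd (hq : q ≠ 0) (hqN : q ^ (2 * N) ≠ 1) {s t : Fin r → ℂ}
    (hs : Function.Injective s) (ht : Function.Injective t) (hst : ∀ n m, s n ≠ t m)
    (hsp : ∀ n p, s n ≠ param N p) (htp : ∀ m p, t m ≠ param N p) (I : Finset (Fin N)) :
    (q - q⁻¹) ^ 2 * kerHam N q (productFun N (rootProd s) (rootProd t)) I =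
      productFun N (rootProd s) (rootProd t) I * (r * q⁻¹ ^ N + (q ^ N - q⁻¹ ^ N) / N *
        (∑ n, ∑ x ∈ I, s n / (s n - param N x) + ∑ m, ∑ y ∈ Iᶜ, t m / (t m - param N y)) -
        ∑ m, ∑ n, shiftCoef s t n m * (ratioProd q N I (s n) * ratioProd q N Iᶜ (t m))) := by
  rw [kerHam_productFun hq hqN
    (fun p => Finset.prod_ne_zero_iff.2 fun n _ => sub_ne_zero.2 (hsp n p).symm)
    (fun p => Finset.prod_ne_zero_iff.2 fun n _ => sub_ne_zero.2 (htp n p).symm), ← mul_neg]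
  congr 1
  rw [Finset.sum_congr rfl fun x hx => congrArg _ (sum_resWeight_compl ht hsp htp
    (J := Iᶜ) (x := x) (by simpa using hx))]
  have e1 : ∑ x ∈ I, resWeight q N I x * ∑ m, ratioProd q N Iᶜ (t m) * rootProd s (t m) /
      (∏ m' ∈ Finset.univ.erase m, (t m - t m')) *
      (rootProd t (param N x) / (rootProd s (param N x) * (param N x - t m) ^ 2)) =
      ∑ m, (∑ n, shiftCoef s t n m * (ratioProd q N I (s n) * ratioProd q N Iᶜ (t m)) -
        ratioProd q N I (t m) * ratioProd q N Iᶜ (t m)) := by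
    simp only [Finset.mul_sum]
    rw [Finset.sum_comm]
    refine Finset.sum_congr rfl fun m _ => ?_
    rw [Finset.sum_congr rfl fun x _ => mul_left_comm _ _ _, ← Finset.mul_sum,
      sum_resWeight hs hst hsp htp, mul_sub, Finset.mul_sum]
    have h1 : ∏ m' ∈ Finset.univ.erase m, (t m - t m') ≠ 0 :=
      Finset.prod_ne_zero_iff.2 fun k hk => sub_ne_zero.2 fun h =>
        Finset.ne_of_mem_erase hk (ht h).symm
    have h2 : rootProd s (t m) ≠ 0 :=
      Finset.prod_ne_zero_iff.2 fun n _ => sub_ne_zero.2 (hst n m).symm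
    have h3 : ∀ n, ratioProd q N Iᶜ (t m) * rootProd s (t m) /
        (∏ m' ∈ Finset.univ.erase m, (t m - t m')) *
        (ratioProd q N I (s n) * (∏ m' ∈ Finset.univ.erase m, (s n - t m')) /
          ((∏ n' ∈ Finset.univ.erase n, (s n - s n')) * (s n - t m))) =
        -(shiftCoef s t n m * (ratioProd q N I (s n) * ratioProd q N Iᶜ (t m))) := by
      intro n
      have h4 : ∏ n' ∈ Finset.univ.erase n, (s n - s n') ≠ 0 :=
        Finset.prod_ne_zero_iff.2 fun k hk => sub_ne_zero.2 fun h =>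
          Finset.ne_of_mem_erase hk (hs h).symm
      have h5 := sub_ne_zero.2 (hst n m)
      rw [shiftCoef, Finset.prod_div_distrib, Finset.prod_div_distrib, rootProd,
        ← Finset.mul_prod_erase _ _ (Finset.mem_univ n)]
      field_simp
      ring
    rw [Finset.sum_congr rfl fun n _ => h3 n, Finset.sum_neg_distrib]
    field_simp
    ring
  have e2 : ∀ v : Fin r → ℂ, (∀ m p, v m ≠ param N p) →
      ∑ x ∈ I, resWeight q N I x * (ratioProd q N Iᶜ (param N x) * ∑ m, 1 / (param N x - v m)) =
      (q ^ N - q⁻¹ ^ N) / N * (r * I.card - ∑ m, ∑ x ∈ I, v m / (v m - param N x)) := by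
    intro v hv
    have h : (r * I.card : ℂ) = ∑ m : Fin r, ∑ x ∈ I, 1 := by simp
    rw [h, Finset.sum_comm, Finset.sum_comm (t := I), ← Finset.sum_sub_distrib, Finset.mul_sum]
    refine Finset.sum_congr rfl fun x hx => ?_
    rw [← mul_assoc, resWeight_mul_ratioProd hq hx, mul_assoc, ← Finset.sum_sub_distrib,
      Finset.mul_sum]
    congr 1
    refine Finset.sum_congr rfl fun m _ => ?_
    have h1 := sub_ne_zero.2 (hv m x)
    have h2 := sub_ne_zero.2 (hv m x).symm
    field_simp
    ring
  have e3 : ∑ m, ratioProd q N I (t m) * ratioProd q N Iᶜ (t m) =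
      r * q⁻¹ ^ N + (q ^ N - q⁻¹ ^ N) / N * (∑ m, ∑ x ∈ I, t m / (t m - param N x) +
        ∑ m, ∑ y ∈ Iᶜ, t m / (t m - param N y)) := by
    rw [← Finset.sum_add_distrib, Finset.mul_sum]
    simp only [ratioProd_mul_compl hq I (htp _), Finset.sum_add_distrib, Finset.sum_const,
      Finset.card_univ, Fintype.card_fin, nsmul_eq_mul, Finset.sum_add_sum_compl]
  simp only [mul_sub, Finset.sum_sub_distrib]
  rw [e1, e2 s hsp, e2 t htp, Finset.sum_sub_distrib, e3]
  ring

end ProductPolynomials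

/-! ### Leading weighted components of multivariate polynomials -/

section LeadingWeights

open MvPolynomial Filter Topology

variable {σ : Type*} {γ : σ → ℕ}

/-- All monomials of `p` have weight at most `w`. -/
def WeightLE (γ : σ → ℕ) (p : MvPolynomial σ ℂ) (w : ℕ) : Prop :=
  ∀ d ∈ p.support, Finsupp.weight γ d ≤ w

lemma WeightLE.mono {p : MvPolynomial σ ℂ} {w w' : ℕ} (h : WeightLE γ p w) (hw : w ≤ w') :
    WeightLE γ p w' := fun d hd => (h d hd).trans hw

lemma weightLE_C (c : ℂ) (w : ℕ) : WeightLE γ (C c) w := by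
  classical
  intro d hd
  have : d = 0 := by
    by_contra h
    rw [mem_support_iff, coeff_C, if_neg (Ne.symm h)] at hd
    exact hd rfl
  simp [this]

lemma weightLE_X (i : σ) : WeightLE γ (X i : MvPolynomial σ ℂ) (γ i) := by
  intro d hd
  rw [support_X, Finset.mem_singleton] at hd
  rw [hd, Finsupp.weight_single, one_smul]

lemma WeightLE.add {p p' : MvPolynomial σ ℂ} {w : ℕ} (h : WeightLE γ p w) (h' : WeightLE γ p' w) :
    WeightLE γ (p + p') w := by
  classical
  intro d hd
  rcases Finset.mem_union.1 (support_add hd) with hd | hd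
  exacts [h d hd, h' d hd]

lemma WeightLE.neg {p : MvPolynomial σ ℂ} {w : ℕ} (h : WeightLE γ p w) : WeightLE γ (-p) w :=
  fun d hd => h d (by rwa [support_neg] at hd)

lemma WeightLE.sub {p p' : MvPolynomial σ ℂ} {w : ℕ} (h : WeightLE γ p w) (h' : WeightLE γ p' w) :
    WeightLE γ (p - p') w := by
  rw [sub_eq_add_neg]; exact h.add h'.neg

lemma WeightLE.mul {p p' : MvPolynomial σ ℂ} {w w' : ℕ} (h : WeightLE γ p w)
    (h' : WeightLE γ p' w') : WeightLE γ (p * p') (w + w') := by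
  classical
  intro d hd
  obtain ⟨a, ha, b, hb, rfl⟩ := Finset.mem_add.1 (support_mul _ _ hd)
  rw [map_add]
  exact add_le_add (h a ha) (h' b hb)

lemma WeightLE.sum {ι : Type*} (s : Finset ι) {p : ι → MvPolynomial σ ℂ} {w : ℕ}
    (h : ∀ i ∈ s, WeightLE γ (p i) w) : WeightLE γ (∑ i ∈ s, p i) w := by
  classical
  induction s using Finset.induction_on with
  | empty => intro d hd; simp at hd
  | insert a s ha ih =>
    rw [Finset.sum_insert ha]
    exact (h a (by simp)).add (ih fun i hi => h i (by simp [hi]))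

lemma WeightLE.prod {ι : Type*} (s : Finset ι) {p : ι → MvPolynomial σ ℂ} {w : ι → ℕ}
    (h : ∀ i ∈ s, WeightLE γ (p i) (w i)) : WeightLE γ (∏ i ∈ s, p i) (∑ i ∈ s, w i) := by
  classical
  induction s using Finset.induction_on with
  | empty => simpa using weightLE_C (γ := γ) 1 0
  | insert a s ha ih =>
    rw [Finset.prod_insert ha, Finset.sum_insert ha]
    exact (h a (by simp)).mul (ih fun i hi => h i (by simp [hi]))

/-- The point `v` with coordinates rescaled by powers of `ε⁻¹`. -/
def scaled (γ : σ → ℕ) (v : σ → ℂ) (ε : ℂ) (i : σ) : ℂ := ε⁻¹ ^ γ i * v i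

lemma eval_monomial_scaled [Fintype σ] (v : σ → ℂ) (ε : ℂ) (d : σ →₀ ℕ) :
    ∏ i, scaled γ v ε i ^ d i = ε⁻¹ ^ Finsupp.weight γ d * ∏ i, v i ^ d i := by
  simp only [scaled, mul_pow, Finset.prod_mul_distrib, ← pow_mul]
  rw [Finset.prod_pow_eq_pow_sum, Finsupp.weight_eq_sum]
  simp only [smul_eq_mul, mul_comm]

lemma tendsto_pow_nhdsNE (k : ℕ) : Tendsto (fun ε : ℂ => ε ^ k) (𝓝[≠] 0) (𝓝 (0 ^ k)) :=
  ((continuous_id.pow k).tendsto 0).mono_left nhdsWithin_le_nhds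

lemma tendsto_eval_scaled [Fintype σ] {p : MvPolynomial σ ℂ} {w : ℕ} (h : WeightLE γ p w)
    (v : σ → ℂ) :
    Tendsto (fun ε => ε ^ w * eval (scaled γ v ε) p) (𝓝[≠] 0)
      (𝓝 (eval v (weightedHomogeneousComponent γ w p))) := by
  have h1 : eval v (weightedHomogeneousComponent γ w p) =
      ∑ d ∈ p.support, 0 ^ (w - Finsupp.weight γ d) * (coeff d p * ∏ i, v i ^ d i) := by
    rw [weightedHomogeneousComponent_apply, map_sum, Finset.sum_filter]
    refine Finset.sum_congr rfl fun d hd => ?_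
    rcases (h d hd).eq_or_lt with h0 | h0
    · rw [if_pos h0, h0, Nat.sub_self, pow_zero, one_mul, eval_monomial, Finsupp.prod_fintype _ _
        (by simp)]
    · rw [if_neg h0.ne, zero_pow (by omega), zero_mul]
  rw [h1]
  refine (tendsto_finsetSum _ fun d _ => (tendsto_pow_nhdsNE _).mul_const _).congr' ?_
  filter_upwards [self_mem_nhdsWithin] with ε hε
  have hε : ε ≠ 0 := hε
  rw [eval_eq', Finset.mul_sum]
  refine Finset.sum_congr rfl fun d hd => ?_
  rw [eval_monomial_scaled]
  have : ε ^ w = ε ^ (w - Finsupp.weight γ d) * ε ^ Finsupp.weight γ d := by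
    rw [← pow_add, Nat.sub_add_cancel (h d hd)]
  rw [this, inv_pow]
  field_simp

/-- A point with distinct nonzero coordinates. -/
def IsGenericPoint (v : σ → ℂ) : Prop := Function.Injective v ∧ ∀ i, v i ≠ 0

lemma eq_zero_of_eval_generic [Fintype σ] {p : MvPolynomial σ ℂ}
    (h : ∀ v, IsGenericPoint v → eval v p = 0) : p = 0 := by
  classical
  set D : MvPolynomial σ ℂ := (∏ i, X i) * ∏ x ∈ Finset.univ.offDiag, (X x.1 - X x.2) with hD
  have hD0 : D ≠ 0 := by
    refine mul_ne_zero (Finset.prod_ne_zero_iff.2 fun i _ => X_ne_zero i)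
      (Finset.prod_ne_zero_iff.2 fun x hx => ?_)
    rw [sub_ne_zero]
    exact fun h => (Finset.mem_offDiag.1 hx).2.2 (X_injective h)
  refine (mul_eq_zero.1 (?_ : p * D = 0)).resolve_right hD0
  refine MvPolynomial.funext fun v => ?_
  rw [map_mul, map_zero]
  by_cases hv : IsGenericPoint v
  · rw [h v hv, zero_mul]
  · have : eval v D = 0 := by
      rw [hD, map_mul, map_prod, map_prod]
      simp only [eval_X, map_sub]
      by_contra h0
      rw [← ne_eq, mul_ne_zero_iff, Finset.prod_ne_zero_iff, Finset.prod_ne_zero_iff] at h0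
      refine hv ⟨fun i j hij => ?_, fun i => h0.1 i (Finset.mem_univ i)⟩
      by_contra hne
      exact h0.2 (i, j) (by simp [hne]) (sub_eq_zero.2 hij)
    rw [this, mul_zero]

lemma exists_weightLE (γ : σ → ℕ) {p : MvPolynomial σ ℂ} (hp : p ≠ 0) :
    ∃ d ∈ p.support, WeightLE γ p (Finsupp.weight γ d) :=
  Finset.exists_max_image p.support (Finsupp.weight γ) (support_nonempty.2 hp)

lemma weightLE_of_tendsto [Fintype σ] {p : MvPolynomial σ ℂ} {w : ℕ}
    (h : ∀ v, IsGenericPoint v → ∃ c,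
      Tendsto (fun ε => ε ^ w * eval (scaled γ v ε) p) (𝓝[≠] 0) (𝓝 c)) : WeightLE γ p w := by
  classical
  rcases eq_or_ne p 0 with rfl | hp
  · intro d hd; simp at hd
  obtain ⟨d, hd, hW⟩ := exists_weightLE γ hp
  refine hW.mono (le_of_not_gt fun hlt => ?_)
  have h0 : weightedHomogeneousComponent γ (Finsupp.weight γ d) p = 0 := by
    refine eq_zero_of_eval_generic fun v hv => ?_
    obtain ⟨c, hc⟩ := h v hv
    refine tendsto_nhds_unique (tendsto_eval_scaled hW v) ?_
    have := (tendsto_pow_nhdsNE (Finsupp.weight γ d - w)).mul hc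
    rw [zero_pow (by omega), zero_mul] at this
    refine this.congr fun ε => ?_
    rw [← mul_assoc, ← pow_add, Nat.sub_add_cancel hlt.le]
  have := coeff_weightedHomogeneousComponent (w := γ) (Finsupp.weight γ d) p d
  rw [h0, if_pos rfl, coeff_zero] at this
  exact mem_support_iff.1 hd this.symm

/-- The Euler derivation. -/
def euler (σ : Type*) : Derivation ℂ (MvPolynomial σ ℂ) (MvPolynomial σ ℂ) := mkDerivation ℂ X

lemma coeff_euler (p : MvPolynomial σ ℂ) (d : σ →₀ ℕ) :
    coeff d (euler σ p) = (d.degree : ℂ) * coeff d p := by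
  classical
  induction p using MvPolynomial.induction_on' with
  | monomial s a =>
    have h : euler σ (monomial s a) = monomial s ((s.degree : ℂ) * a) := by
      rw [euler, mkDerivation_monomial, Finsupp.degree_apply, Nat.cast_sum, Finset.sum_mul, map_sum,
        Finsupp.sum, Finset.smul_sum]
      refine Finset.sum_congr rfl fun i hi => ?_
      have hi : s i ≠ 0 := Finsupp.mem_support_iff.1 hi
      rw [smul_eq_mul, X, monomial_mul, smul_monomial, smul_eq_mul, mul_one, mul_comm a,
        tsub_add_cancel_of_le (Finsupp.single_le_iff.2 (Nat.one_le_iff_ne_zero.2 hi))]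
    rw [h, coeff_monomial, coeff_monomial]
    split_ifs with hs
    · rw [hs]
    · rw [mul_zero]
  | add a b ih1 ih2 => rw [map_add, coeff_add, coeff_add, ih1, ih2, mul_add]

lemma WeightLE.euler {p : MvPolynomial σ ℂ} {w : ℕ} (h : WeightLE γ p w) :
    WeightLE γ (euler σ p) w := by
  intro d hd
  refine h d (mem_support_iff.2 fun h0 => mem_support_iff.1 hd ?_)
  rw [coeff_euler, h0, mul_zero]

lemma eval_euler_prod {ι : Type*} (s : Finset ι) (i : ι → σ) (c : ι → ℂ) {v : σ → ℂ}
    (hv : ∀ k ∈ s, v (i k) ≠ c k) :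
    eval v (Stmt2.euler σ (∏ k ∈ s, (C (c k) - X (i k)))) =
      (∏ k ∈ s, (c k - v (i k))) * ∑ k ∈ s, v (i k) / (v (i k) - c k) := by
  classical
  induction s using Finset.induction_on with
  | empty => simp
  | insert a s ha ih =>
    have h1 : eval v (Stmt2.euler σ (C (c a) - X (i a))) = - v (i a) := by
      simp [Stmt2.euler]
    have h2 := sub_ne_zero.2 (hv a (by simp))
    rw [Finset.prod_insert ha, Derivation.leibniz, map_add, smul_eq_mul, smul_eq_mul, map_mul,
      map_mul, ih fun k hk => hv k (by simp [hk]), h1, Finset.prod_insert ha, Finset.sum_insert ha,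
      map_prod]
    simp only [map_sub, eval_C, eval_X]
    field_simp
    ring

/-! ### Divisibility by differences of variables -/

lemma aeval_update_eq_zero [DecidableEq σ] {a b : σ} {p : MvPolynomial σ ℂ}
    (h : ∀ v : σ → ℂ, v a = v b → eval v p = 0) :
    aeval (Function.update X a (X b) : σ → MvPolynomial σ ℂ) p = 0 := by
  refine MvPolynomial.funext fun v => ?_
  change aeval v (bind₁ (Function.update X a (X b)) p) = _
  rw [aeval_bind₁, map_zero]
  refine h _ ?_
  by_cases hab : b = a
  · rw [hab]
  · simp [Function.update_of_ne hab]

lemma X_sub_X_dvd {a b : σ} {p : MvPolynomial σ ℂ}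
    (h : ∀ v : σ → ℂ, v a = v b → eval v p = 0) : X a - X b ∣ p := by
  classical
  have h0 := aeval_update_eq_zero h
  rw [← Ideal.mem_span_singleton, ← Ideal.Quotient.eq_zero_iff_mem]
  have h1 : (Ideal.Quotient.mkₐ ℂ (Ideal.span {X a - X b})).comp
      (aeval (Function.update X a (X b) : σ → MvPolynomial σ ℂ)) =
      Ideal.Quotient.mkₐ ℂ (Ideal.span {X a - X b}) := by
    refine MvPolynomial.algHom_ext fun i => ?_
    by_cases hi : i = a
    · subst hi
      simp
      rw [Ideal.Quotient.eq, Ideal.mem_span_singleton]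
      exact ⟨-1, by ring⟩
    · simp [hi]
  have h2 := AlgHom.congr_fun h1 p
  rw [AlgHom.comp_apply, h0, map_zero] at h2
  exact h2.symm

/-- Multiplication by `X a - X b` with `γ a < γ b` multiplies the leading part by `X b`. -/
lemma mem_support_sub_mul {a b : σ} (hab : γ a < γ b) {p : MvPolynomial σ ℂ} {d : σ →₀ ℕ}
    (hd : d ∈ p.support) (hp : WeightLE γ p (Finsupp.weight γ d)) :
    d + Finsupp.single b 1 ∈ ((X a - X b) * p).support ∧
      WeightLE γ ((X a - X b) * p) (Finsupp.weight γ (d + Finsupp.single b 1)) := by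
  classical
  refine ⟨?_, ?_⟩
  · rw [mem_support_iff, sub_mul, coeff_sub, mul_comm (X b), coeff_mul_X, mul_comm, coeff_mul_X']
    split_ifs with ha
    · have : coeff (d + Finsupp.single b 1 - Finsupp.single a 1) p = 0 := by
        by_contra h0
        have h1 := hp _ (mem_support_iff.2 h0)
        have h2 : Finsupp.weight γ (d + Finsupp.single b 1 - Finsupp.single a 1) + γ a =
            Finsupp.weight γ d + γ b := by
          have := Finsupp.weight_sub_single_add (w := γ) (Finsupp.mem_support_iff.1 ha)
          rw [this, map_add, Finsupp.weight_single, one_smul]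
        omega
      rw [this, zero_sub, neg_ne_zero]
      exact mem_support_iff.1 hd
    · rw [zero_sub, neg_ne_zero]
      exact mem_support_iff.1 hd
  · rw [map_add, Finsupp.weight_single, one_smul, add_comm]
    exact (((weightLE_X a).mono hab.le).sub (weightLE_X b)).mul hp

end LeadingWeights

/-! ### The generating polynomial of a linear functional -/

section GeneratingPolynomial

open MvPolynomial

variable {N : ℕ} {q : ℂ} {r : ℕ}

/-- The polynomial `∏_{x ∈ I} ∏_n (ζ_x - s_n) ∏_{y ∉ I} ∏_n (ζ_y - t_n)` in the variables
`s_n = X (n, false)` and `t_n = X (n, true)`. -/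
def setPoly (N r : ℕ) (I : Finset (Fin N)) : MvPolynomial (Fin r × Bool) ℂ :=
  ∏ k : Fin N × Fin r, (C (param N k.1) - X (k.2, decide (k.1 ∉ I)))

/-- The values of a linear functional on the functions `setPoly`. -/
def genPoly (r : ℕ) : ((Finset (Fin N) → ℂ) →ₗ[ℂ] ℂ) →ₗ[ℂ] MvPolynomial (Fin r × Bool) ℂ where
  toFun φ := ∑ I, φ (Pi.single I 1) • setPoly N r I
  map_add' φ φ' := by simp [add_smul, Finset.sum_add_distrib]
  map_smul' a φ := by simp [mul_smul, Finset.smul_sum]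

/-- The function on sets of particles at a given point of the variables. -/
def setFun (N : ℕ) {r : ℕ} (u : Fin r × Bool → ℂ) : Finset (Fin N) → ℂ :=
  productFun N (rootProd fun n => u (n, false)) (rootProd fun n => u (n, true))

lemma eval_setPoly (u : Fin r × Bool → ℂ) (I : Finset (Fin N)) :
    eval u (setPoly N r I) = setFun N u I := by
  rw [setPoly, map_prod, Fintype.prod_prod_type, ← Finset.prod_mul_prod_compl I, setFun, productFun]
  simp only [map_sub, eval_C, eval_X]
  congr 1
  · refine Finset.prod_congr rfl fun x hx => ?_
    simp [hx, rootProd]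
  · refine Finset.prod_congr rfl fun x hx => ?_
    simp [Finset.mem_compl.1 hx, rootProd]

lemma map_eq_sum_single (φ : (Finset (Fin N) → ℂ) →ₗ[ℂ] ℂ) (F : Finset (Fin N) → ℂ) :
    φ F = ∑ I, φ (Pi.single I 1) * F I := by
  conv_lhs => rw [← Finset.univ_sum_single F]
  rw [map_sum]
  refine Finset.sum_congr rfl fun I _ => ?_
  rw [← mul_comm (F I), ← smul_eq_mul, ← map_smul, ← Pi.single_smul', smul_eq_mul, mul_one]

lemma eval_genPoly (φ : (Finset (Fin N) → ℂ) →ₗ[ℂ] ℂ) (u : Fin r × Bool → ℂ) :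
    eval u (genPoly r φ) = φ (setFun N u) := by
  rw [map_eq_sum_single φ]
  simp [genPoly, smul_eval, eval_setPoly]

lemma eval_euler_genPoly (φ : (Finset (Fin N) → ℂ) →ₗ[ℂ] ℂ) {u : Fin r × Bool → ℂ}
    (hu : ∀ i p, u i ≠ param N p) :
    eval u (euler _ (genPoly r φ)) = φ fun I => setFun N u I *
      (∑ n, ∑ x ∈ I, u (n, false) / (u (n, false) - param N x) +
        ∑ m, ∑ y ∈ Iᶜ, u (m, true) / (u (m, true) - param N y)) := by
  rw [map_eq_sum_single φ]
  simp only [genPoly, LinearMap.coe_mk, AddHom.coe_mk, map_sum]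
  refine Finset.sum_congr rfl fun I _ => ?_
  rw [Derivation.map_smul, smul_eval]
  congr 1
  rw [setPoly, eval_euler_prod _ _ _ fun k _ => hu _ _]
  congr 1
  · rw [← eval_setPoly, setPoly, map_prod]; simp
  · rw [Fintype.sum_prod_type, ← Finset.sum_add_sum_compl I, Finset.sum_comm (s := I),
      Finset.sum_comm (s := Iᶜ)]
    congr 1
    · refine Finset.sum_congr rfl fun n _ => Finset.sum_congr rfl fun x hx => ?_
      simp [hx]
    · refine Finset.sum_congr rfl fun n _ => Finset.sum_congr rfl fun x hx => ?_
      simp [Finset.mem_compl.1 hx]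

/-- The point with `s_n` and `t_m` multiplied by `q²`. -/
def shiftPair (q : ℂ) {r : ℕ} (n m : Fin r) (u : Fin r × Bool → ℂ) (i : Fin r × Bool) : ℂ :=
  if i = (n, false) ∨ i = (m, true) then q ^ 2 * u i else u i

lemma rootProd_mul_ratio {s s' : Fin r → ℂ} (hq : q ≠ 0) {n : Fin r} (hn : s' n = q ^ 2 * s n)
    (hs : ∀ k, k ≠ n → s' k = s k) {w : ℂ} (hw : s n ≠ w) :
    rootProd s w * (qsub q (s n) w / (s n - w)) = q⁻¹ * rootProd s' w := by
  have h := sub_ne_zero.2 hw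
  rw [rootProd, rootProd, ← Finset.mul_prod_erase _ _ (Finset.mem_univ n),
    ← Finset.mul_prod_erase _ (fun k => w - s' k) (Finset.mem_univ n), hn, qsub,
    Finset.prod_congr rfl fun k hk => by rw [← hs k (Finset.ne_of_mem_erase hk)]]
  field_simp
  ring

lemma setFun_mul_ratioProd (hq : q ≠ 0) {u : Fin r × Bool → ℂ} (hu : ∀ i p, u i ≠ param N p)
    (n m : Fin r) (I : Finset (Fin N)) :
    setFun N u I * (ratioProd q N I (u (n, false)) * ratioProd q N Iᶜ (u (m, true))) =
      q⁻¹ ^ N * setFun N (shiftPair q n m u) I := by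
  have hc : q⁻¹ ^ N = q⁻¹ ^ I.card * q⁻¹ ^ (Iᶜ).card := by
    rw [← pow_add, Finset.card_add_card_compl, Fintype.card_fin]
  rw [hc, setFun, setFun, productFun, productFun, ratioProd, ratioProd, mul_mul_mul_comm,
    ← Finset.prod_mul_distrib, ← Finset.prod_mul_distrib, mul_mul_mul_comm,
    ← Finset.prod_const, ← Finset.prod_const, ← Finset.prod_mul_distrib, ← Finset.prod_mul_distrib]
  congr 1
  · refine Finset.prod_congr rfl fun x _ =>
      rootProd_mul_ratio (s := fun n => u (n, false)) hq ?_ ?_ (hu _ _)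
    · simp [shiftPair]
    · intro k hk; simp [shiftPair, hk]
  · refine Finset.prod_congr rfl fun x _ =>
      rootProd_mul_ratio (s := fun n => u (n, true)) hq ?_ ?_ (hu _ _)
    · simp [shiftPair]
    · intro k hk; simp [shiftPair, hk]

variable [NeZero N]

lemma eval_genPoly_kerHam (hq : q ≠ 0) (hqN : q ^ (2 * N) ≠ 1)
    (φ : (Finset (Fin N) → ℂ) →ₗ[ℂ] ℂ) {u : Fin r × Bool → ℂ} (hu : Function.Injective u)
    (hup : ∀ i p, u i ≠ param N p) :
    (q - q⁻¹) ^ 2 * eval u (genPoly r (φ ∘ₗ kerHam N q)) =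
      r * q⁻¹ ^ N * eval u (genPoly r φ) +
        (q ^ N - q⁻¹ ^ N) / N * eval u (euler _ (genPoly r φ)) -
        ∑ m, ∑ n, shiftCoef (fun k => u (k, false)) (fun k => u (k, true)) n m *
          (q⁻¹ ^ N * eval (shiftPair q n m u) (genPoly r φ)) := by
  have key : (q - q⁻¹) ^ 2 • kerHam N q (setFun N u) =
      (r * q⁻¹ ^ N) • setFun N u + ((q ^ N - q⁻¹ ^ N) / N) • (fun I => setFun N u I *
      (∑ n, ∑ x ∈ I, u (n, false) / (u (n, false) - param N x) +
        ∑ m, ∑ y ∈ Iᶜ, u (m, true) / (u (m, true) - param N y))) -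
      ∑ m, ∑ n, (shiftCoef (fun k => u (k, false)) (fun k => u (k, true)) n m * q⁻¹ ^ N) •
        setFun N (shiftPair q n m u) := by
    funext I
    have hinj : ∀ b, Function.Injective fun k : Fin r => u (k, b) :=
      fun b i j h => congrArg Prod.fst (hu h)
    have h := kerHam_rootProd hq hqN (hinj false) (hinj true)
      (fun n m h => by simpa using hu h) (fun n => hup _) (fun m => hup _) I
    rw [Pi.smul_apply, smul_eq_mul]
    refine h.trans ?_
    simp only [Pi.sub_apply, Pi.add_apply, Pi.smul_apply, Finset.sum_apply, smul_eq_mul, mul_assoc]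
    simp only [← setFun_mul_ratioProd hq hup]
    rw [mul_sub, mul_add, Finset.mul_sum]
    simp only [Finset.mul_sum, setFun]
    refine congrArg₂ _ ?_ (Finset.sum_congr rfl fun m _ => Finset.sum_congr rfl fun n _ => by ring)
    ring
  rw [eval_genPoly, LinearMap.comp_apply, eval_genPoly, eval_euler_genPoly φ hup, ← smul_eq_mul,
    ← map_smul, key]
  simp [eval_genPoly, mul_assoc]

end GeneratingPolynomial

/-! ### Triangularity of the Hamiltonian -/

section ScaledDifferences

open Filter Topology

variable {σ : Type*} {γ : σ → ℕ} {v : σ → ℂ}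

/-- The normalised difference of two rescaled coordinates. -/
def scaledDiff (γ : σ → ℕ) (v : σ → ℂ) (i j : σ) (ε : ℂ) : ℂ :=
  ε ^ (max (γ i) (γ j) - γ i) * v i - ε ^ (max (γ i) (γ j) - γ j) * v j

lemma scaled_sub_scaled (i j : σ) {ε : ℂ} (hε : ε ≠ 0) :
    scaled γ v ε i - scaled γ v ε j = ε⁻¹ ^ max (γ i) (γ j) * scaledDiff γ v i j ε := by
  have h : ∀ a : ℕ, a ≤ max (γ i) (γ j) →
      ε⁻¹ ^ a = ε⁻¹ ^ max (γ i) (γ j) * ε ^ (max (γ i) (γ j) - a) := by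
    intro a ha
    rw [← Nat.sub_add_cancel ha, pow_add, Nat.add_sub_cancel, mul_right_comm, ← mul_pow,
      inv_mul_cancel₀ hε, one_pow, one_mul]
  rw [scaled, scaled, scaledDiff, h (γ i) (le_max_left _ _), h (γ j) (le_max_right _ _)]
  ring

lemma tendsto_scaledDiff (i j : σ) :
    Tendsto (scaledDiff γ v i j) (𝓝[≠] 0) (𝓝 (scaledDiff γ v i j 0)) :=
  ((tendsto_pow_nhdsNE _).mul_const _).sub ((tendsto_pow_nhdsNE _).mul_const _)

lemma scaledDiff_zero_ne_zero (hv : IsGenericPoint v) {i j : σ} (hij : i ≠ j) :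
    scaledDiff γ v i j 0 ≠ 0 := by
  rw [scaledDiff]
  rcases lt_trichotomy (γ i) (γ j) with h | h | h
  · rw [max_eq_right h.le, Nat.sub_self, zero_pow (by omega)]
    simpa using hv.2 j
  · rw [h, max_self, Nat.sub_self]
    simpa [sub_eq_zero] using fun h => hij (hv.1 h)
  · rw [max_eq_left h.le, Nat.sub_self, zero_pow (Nat.sub_ne_zero_of_lt h)]
    simpa using hv.2 i

lemma tendsto_ratio (hv : IsGenericPoint v) {a b c d i j k l : σ} {e : ℕ} (hab : a ≠ b)
    (hcd : c ≠ d)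
    (he : max (γ i) (γ j) + max (γ k) (γ l) + e = max (γ a) (γ b) + max (γ c) (γ d)) :
    Tendsto (fun ε => (scaled γ v ε i - scaled γ v ε j) / (scaled γ v ε a - scaled γ v ε b) *
        ((scaled γ v ε k - scaled γ v ε l) / (scaled γ v ε c - scaled γ v ε d)))
      (𝓝[≠] 0) (𝓝 (0 ^ e * (scaledDiff γ v i j 0 / scaledDiff γ v a b 0 *
        (scaledDiff γ v k l 0 / scaledDiff γ v c d 0)))) := by
  refine ((tendsto_pow_nhdsNE e).mul (((tendsto_scaledDiff i j).div (tendsto_scaledDiff a b)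
    (scaledDiff_zero_ne_zero hv hab)).mul ((tendsto_scaledDiff k l).div (tendsto_scaledDiff c d)
    (scaledDiff_zero_ne_zero hv hcd)))).congr' ?_
  filter_upwards [self_mem_nhdsWithin] with ε hε
  have hε : ε ≠ 0 := hε
  simp only [scaled_sub_scaled _ _ hε, Pi.div_apply]
  rw [mul_div_mul_comm, mul_div_mul_comm, mul_mul_mul_comm (_ / _) _ (_ / _), div_mul_div_comm (_ ^ _),
    ← pow_add, ← pow_add, ← he, pow_add _ (max (γ i) (γ j) + max (γ k) (γ l))]
  congr 1
  rw [inv_pow _ e]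
  field_simp

lemma eventually_scaled_injective [Finite σ] (hv : IsGenericPoint v) :
    ∀ᶠ ε in 𝓝[≠] (0 : ℂ), Function.Injective (scaled γ v ε) := by
  have h : ∀ᶠ ε in 𝓝[≠] (0 : ℂ), ∀ i j, i ≠ j → scaledDiff γ v i j ε ≠ 0 := by
    simp only [eventually_all]
    intro i j hij
    exact (tendsto_scaledDiff i j).eventually_ne (scaledDiff_zero_ne_zero hv hij)
  filter_upwards [h, self_mem_nhdsWithin] with ε h hε i j hij
  have hε : ε ≠ 0 := hε
  by_contra hne
  have := sub_eq_zero.2 hij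
  rw [scaled_sub_scaled _ _ hε, mul_eq_zero] at this
  exact this.elim (pow_ne_zero _ (inv_ne_zero hε)) (h i j hne)

lemma eventually_scaled_ne [Finite σ] {ι : Type*} [Finite ι] (hv : IsGenericPoint v)
    (hγ : ∀ i, γ i ≠ 0) (c : ι → ℂ) :
    ∀ᶠ ε in 𝓝[≠] (0 : ℂ), ∀ i p, scaled γ v ε i ≠ c p := by
  have h : ∀ᶠ ε in 𝓝[≠] (0 : ℂ), ∀ i p, v i - ε ^ γ i * c p ≠ 0 := by
    simp only [eventually_all]
    intro i p
    refine Tendsto.eventually_ne (b₁ := v i - 0 ^ γ i * c p)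
      (tendsto_const_nhds.sub ((tendsto_pow_nhdsNE _).mul_const _)) ?_
    rw [zero_pow (hγ i), zero_mul, sub_zero]
    exact hv.2 i
  filter_upwards [h, self_mem_nhdsWithin] with ε h hε i p hip
  have hε : ε ≠ 0 := hε
  refine h i p ?_
  rw [← hip, scaled, inv_pow]
  field_simp
  ring

end ScaledDifferences

section PairWeights

open MvPolynomial Filter Topology

variable {N r : ℕ}

/-- The weight of the variables of the `n`-th pair. -/
def pairWeight (N r : ℕ) (i : Fin r × Bool) : ℕ := (N + 1) ^ (i.1 : ℕ)

lemma pairWeight_ne_zero (i : Fin r × Bool) : pairWeight N r i ≠ 0 := pow_ne_zero _ (by omega)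

lemma pairWeight_lt {i j : Fin r × Bool} (hN : N ≠ 0) (h : i.1 < j.1) :
    pairWeight N r i < pairWeight N r j := Nat.pow_lt_pow_right (by omega) h

/-- The degree of a monomial in the variables of the `n`-th pair. -/
def pairDegree {r : ℕ} (d : Fin r × Bool →₀ ℕ) (n : Fin r) : ℕ := d (n, false) + d (n, true)

/-- The weight of monomials with given degrees in the pairs of variables. -/
def levelWeight (N : ℕ) {r : ℕ} (δ : Fin r → ℕ) : ℕ := ∑ n, δ n * (N + 1) ^ (n : ℕ)

lemma weight_pairWeight (d : Fin r × Bool →₀ ℕ) :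
    Finsupp.weight (pairWeight N r) d = levelWeight N (pairDegree d) := by
  rw [Finsupp.weight_eq_sum, Fintype.sum_prod_type, levelWeight]
  refine Finset.sum_congr rfl fun n _ => ?_
  simp [pairWeight, pairDegree]
  ring

lemma levelWeight_injective {δ δ' : Fin r → ℕ} (hδ : ∀ n, δ n ≤ N) (hδ' : ∀ n, δ' n ≤ N)
    (h : levelWeight N δ = levelWeight N δ') : δ = δ' := by
  have key : finFunctionFinEquiv (fun n => (⟨δ n, Nat.lt_succ_of_le (hδ n)⟩ : Fin (N + 1))) =
      finFunctionFinEquiv (fun n => (⟨δ' n, Nat.lt_succ_of_le (hδ' n)⟩ : Fin (N + 1))) := by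
    ext
    rw [finFunctionFinEquiv_apply, finFunctionFinEquiv_apply]
    exact h
  funext n
  exact congrArg Fin.val (congrFun (finFunctionFinEquiv.injective key) n)

lemma pairDegree_le {φ : (Finset (Fin N) → ℂ) →ₗ[ℂ] ℂ} {d : Fin r × Bool →₀ ℕ}
    (hd : d ∈ (genPoly r φ).support) (n : Fin r) : pairDegree d n ≤ N := by
  classical
  set γ : Fin r × Bool → ℕ := fun i => if i.1 = n then 1 else 0 with hγ
  have h : WeightLE γ (genPoly r φ) N := by
    refine WeightLE.sum _ fun I _ => ?_
    rw [smul_eq_C_mul]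
    refine ((weightLE_C _ 0).mul (w' := N) ?_).mono (zero_add N).le
    have h2 := WeightLE.prod (γ := γ) Finset.univ (w := fun k => if k.2 = n then 1 else 0)
      (p := fun k : Fin N × Fin r => C (param N k.1) - X (k.2, decide (k.1 ∉ I)))
      fun k _ => (weightLE_C _ _).sub (weightLE_X _)
    refine h2.mono ?_
    rw [Fintype.sum_prod_type]
    simp
  have h1 := h d hd
  rw [Finsupp.weight_eq_sum, Fintype.sum_prod_type, Finset.sum_eq_single n] at h1
  · simpa [hγ, pairDegree, add_comm] using h1
  · intro b _ hb; simp [hγ, hb]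
  · simp

lemma shiftPair_scaled (q : ℂ) (n m : Fin r) (γ : Fin r × Bool → ℕ) (v : Fin r × Bool → ℂ) (ε : ℂ) :
    shiftPair q n m (scaled γ v ε) = scaled γ (shiftPair q n m v) ε := by
  funext i
  simp only [shiftPair, scaled]
  split_ifs <;> ring

lemma tendsto_shiftCoef_self (hN : N ≠ 0) {v : Fin r × Bool → ℂ} (hv : IsGenericPoint v)
    (n : Fin r) :
    Tendsto (fun ε => shiftCoef (fun k => scaled (pairWeight N r) v ε (k, false))
      (fun k => scaled (pairWeight N r) v ε (k, true)) n n) (𝓝[≠] 0) (𝓝 1) := by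
  simp only [shiftCoef, ← Finset.prod_mul_distrib]
  rw [← Finset.prod_const_one (s := Finset.univ.erase n)]
  refine tendsto_finsetProd _ fun k hk => ?_
  have hk := Finset.ne_of_mem_erase hk
  have h := tendsto_ratio (γ := pairWeight N r) hv (i := (n, true)) (j := (k, false))
    (k := (n, false)) (l := (k, true)) (a := (n, false)) (b := (k, false)) (c := (n, true))
    (d := (k, true)) (e := 0) (by simp [hk.symm]) (by simp [hk.symm]) rfl
  convert! h using 2
  have h1 := hv.2 (n, true)
  have h2 := hv.2 (n, false)
  have h3 := hv.2 (k, true)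
  have h4 := hv.2 (k, false)
  rcases hk.lt_or_gt with hlt | hlt
  · have hw : ∀ b b', pairWeight N r (k, b) < pairWeight N r (n, b') :=
      fun b b' => pairWeight_lt hN hlt
    simp only [scaledDiff, max_eq_left (hw _ _).le, Nat.sub_self, pow_zero,
      zero_pow (Nat.sub_ne_zero_of_lt (hw _ _))]
    field_simp
    simp
    field_simp
  · have hw : ∀ b b', pairWeight N r (n, b) < pairWeight N r (k, b') :=
      fun b b' => pairWeight_lt hN hlt
    simp only [scaledDiff, max_eq_right (hw _ _).le, Nat.sub_self, pow_zero,
      zero_pow (Nat.sub_ne_zero_of_lt (hw _ _))]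
    field_simp
    simp
    field_simp

lemma tendsto_shiftCoef_of_ne (hN : N ≠ 0) {v : Fin r × Bool → ℂ} (hv : IsGenericPoint v)
    {n m : Fin r} (hnm : n ≠ m) :
    Tendsto (fun ε => shiftCoef (fun k => scaled (pairWeight N r) v ε (k, false))
      (fun k => scaled (pairWeight N r) v ε (k, true)) n m) (𝓝[≠] 0) (𝓝 0) := by
  have hm : m ∈ Finset.univ.erase n := by simp [hnm.symm]
  have hn : n ∈ Finset.univ.erase m := by simp [hnm]
  have hw : pairWeight N r (n, false) ≠ pairWeight N r (m, false) := by
    rcases hnm.lt_or_gt with h | h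
    exacts [(pairWeight_lt hN h).ne, (pairWeight_lt hN h).ne']
  have h1 := tendsto_ratio (γ := pairWeight N r) hv (i := (m, true)) (j := (m, false))
    (k := (n, false)) (l := (n, true)) (a := (n, false)) (b := (m, false)) (c := (m, true))
    (d := (n, true)) (e := 2 * max (pairWeight N r (n, false)) (pairWeight N r (m, false)) -
      pairWeight N r (n, false) - pairWeight N r (m, false))
    (by simp [hnm]) (by simp [hnm.symm]) (by simp only [pairWeight]; omega)
  rw [zero_pow (by omega), zero_mul] at h1
  have h2 := tendsto_finsetProd ((Finset.univ.erase n).erase m) fun k hk => by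
    have hkm := Finset.ne_of_mem_erase hk
    have hkn := Finset.ne_of_mem_erase (Finset.mem_of_mem_erase hk)
    exact tendsto_ratio (γ := pairWeight N r) hv (i := (m, true)) (j := (k, false))
      (k := (n, false)) (l := (k, true)) (a := (n, false)) (b := (k, false)) (c := (m, true))
      (d := (k, true)) (e := 0) (by simp [hkn.symm]) (by simp [hkm.symm])
      (by simp only [pairWeight]; omega)
  have h3 := h1.mul h2
  rw [zero_mul] at h3
  refine h3.congr fun ε => ?_
  rw [shiftCoef, ← Finset.mul_prod_erase _ _ hm, ← Finset.mul_prod_erase _ _ hn,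
    Finset.erase_right_comm (a := m), Finset.prod_mul_distrib]
  ring

end PairWeights

section Transfer

open MvPolynomial Filter Topology

variable {N : ℕ} {q : ℂ} {r : ℕ} {φ : (Finset (Fin N) → ℂ) →ₗ[ℂ] ℂ} {δ : Fin r → ℕ}

/-- The leading component of the generating polynomial at the level `δ`. -/
def leadingPart (φ : (Finset (Fin N) → ℂ) →ₗ[ℂ] ℂ) (δ : Fin r → ℕ) :
    MvPolynomial (Fin r × Bool) ℂ :=
  weightedHomogeneousComponent (pairWeight N r) (levelWeight N δ) (genPoly r φ)

lemma pairDegree_eq_of_mem_support (hδ : ∀ n, δ n ≤ N) {d : Fin r × Bool →₀ ℕ}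
    (hd : d ∈ (leadingPart φ δ).support) : pairDegree d = δ := by
  classical
  rw [mem_support_iff, leadingPart, coeff_weightedHomogeneousComponent, ne_eq, ite_eq_right_iff,
    Classical.not_imp, weight_pairWeight] at hd
  exact levelWeight_injective (pairDegree_le (mem_support_iff.2 hd.2)) hδ hd.1

lemma leadingPart_euler (hδ : ∀ n, δ n ≤ N) :
    weightedHomogeneousComponent (pairWeight N r) (levelWeight N δ) (euler _ (genPoly r φ)) =
      (∑ n, (δ n : ℂ)) • leadingPart φ δ := by
  classical
  ext d
  by_cases hd : d ∈ (leadingPart φ δ).support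
  · rw [coeff_weightedHomogeneousComponent, coeff_euler, coeff_smul, leadingPart,
      coeff_weightedHomogeneousComponent]
    split_ifs
    · rw [← pairDegree_eq_of_mem_support hδ hd, smul_eq_mul]
      congr 1
      rw [Finsupp.degree_eq_sum, Fintype.sum_prod_type]
      simp [pairDegree, add_comm]
    · simp
  · have hd' := notMem_support_iff.1 hd
    rw [coeff_smul, hd', smul_zero, coeff_weightedHomogeneousComponent, coeff_euler]
    rw [leadingPart, coeff_weightedHomogeneousComponent] at hd'
    split_ifs at hd' ⊢
    · rw [hd', mul_zero]
    · rfl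

lemma eval_shiftPair_leadingPart (hδ : ∀ n, δ n ≤ N) (n : Fin r) (v : Fin r × Bool → ℂ) :
    eval (shiftPair q n n v) (leadingPart φ δ) = (q ^ 2) ^ δ n * eval v (leadingPart φ δ) := by
  rw [eval_eq', eval_eq', Finset.mul_sum]
  refine Finset.sum_congr rfl fun d hd => ?_
  rw [mul_left_comm, ← pairDegree_eq_of_mem_support hδ hd]
  congr 1
  rw [Fintype.prod_prod_type, Fintype.prod_prod_type,
    ← Finset.mul_prod_erase _ _ (Finset.mem_univ n), ← Finset.mul_prod_erase _
      (fun k => ∏ b, v (k, b) ^ d (k, b)) (Finset.mem_univ n), ← mul_assoc]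
  congr 1
  · simp [shiftPair, pairDegree]
    ring
  · refine Finset.prod_congr rfl fun k hk => ?_
    simp [shiftPair, Finset.ne_of_mem_erase hk]

/-- The energy of the level `δ`. -/
def levelEnergy (q : ℂ) (N : ℕ) {r : ℕ} (δ : Fin r → ℕ) : ℂ :=
  ∑ n, (q⁻¹ ^ N + (q ^ N - q⁻¹ ^ N) / N * δ n - q⁻¹ ^ N * (q ^ 2) ^ δ n) / (q - q⁻¹) ^ 2

variable [NeZero N]

lemma tendsto_genPoly_kerHam (hq : q ≠ 0) (hqN : q ^ (2 * N) ≠ 1) (hδ : ∀ n, δ n ≤ N)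
    (h : WeightLE (pairWeight N r) (genPoly r φ) (levelWeight N δ))
    {v : Fin r × Bool → ℂ} (hv : IsGenericPoint v) :
    Tendsto (fun ε => ε ^ levelWeight N δ *
        eval (scaled (pairWeight N r) v ε) (genPoly r (φ ∘ₗ kerHam N q))) (𝓝[≠] 0)
      (𝓝 (levelEnergy q N δ * eval v (leadingPart φ δ))) := by
  have hκ : q - q⁻¹ ≠ 0 := sub_inv_ne_zero (N := N) hq hqN
  have h1 := tendsto_eval_scaled h v
  have h2 := tendsto_eval_scaled h.euler v
  rw [leadingPart_euler hδ, smul_eval] at h2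
  have h3 : Tendsto (fun ε => ∑ m, ∑ n,
      shiftCoef (fun k => scaled (pairWeight N r) v ε (k, false))
        (fun k => scaled (pairWeight N r) v ε (k, true)) n m *
      (q⁻¹ ^ N * (ε ^ levelWeight N δ *
        eval (shiftPair q n m (scaled (pairWeight N r) v ε)) (genPoly r φ)))) (𝓝[≠] 0)
      (𝓝 (∑ m, ∑ n, if n = m then q⁻¹ ^ N * ((q ^ 2) ^ δ m * eval v (leadingPart φ δ)) else 0)) := by
    refine tendsto_finsetSum _ fun m _ => tendsto_finsetSum _ fun n _ => ?_
    simp only [shiftPair_scaled]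
    have h4 := (tendsto_eval_scaled h (shiftPair q n m v)).const_mul (q⁻¹ ^ N)
    split_ifs with hnm
    · subst hnm
      have h5 := (tendsto_shiftCoef_self (NeZero.ne N) hv n).mul h4
      rwa [← leadingPart, eval_shiftPair_leadingPart hδ, one_mul] at h5
    · have h5 := (tendsto_shiftCoef_of_ne (NeZero.ne N) hv hnm).mul h4
      rwa [zero_mul] at h5
  have h6 := (((h1.const_mul (r * q⁻¹ ^ N)).add (h2.const_mul ((q ^ N - q⁻¹ ^ N) / N))).sub
    h3).div_const ((q - q⁻¹) ^ 2)
  rw [← leadingPart] at h6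
  have hval : levelEnergy q N δ * eval v (leadingPart φ δ) =
      (r * q⁻¹ ^ N * eval v (leadingPart φ δ) +
        (q ^ N - q⁻¹ ^ N) / N * ((∑ n, (δ n : ℂ)) * eval v (leadingPart φ δ)) -
        ∑ m, ∑ n, if n = m then q⁻¹ ^ N * ((q ^ 2) ^ δ m * eval v (leadingPart φ δ)) else 0) /
        (q - q⁻¹) ^ 2 := by
    simp only [Finset.sum_ite_eq', Finset.mem_univ, if_true]
    rw [levelEnergy, ← Finset.sum_div, Finset.sum_sub_distrib, Finset.sum_add_distrib,
      ← Finset.mul_sum, ← Finset.mul_sum, ← Finset.mul_sum, ← Finset.sum_mul]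
    simp
    ring
  rw [hval]
  refine h6.congr' ?_
  filter_upwards [eventually_scaled_injective hv,
    eventually_scaled_ne hv (pairWeight_ne_zero (N := N)) (param N)] with ε hi hp
  rw [div_eq_iff (pow_ne_zero 2 hκ)]
  have := eval_genPoly_kerHam hq hqN φ hi hp
  rw [mul_comm _ ((q - q⁻¹) ^ 2), mul_left_comm ((q - q⁻¹) ^ 2), this]
  simp only [mul_sub, mul_add, Finset.mul_sum]
  congr 1
  · ring
  · refine Finset.sum_congr rfl fun m _ => Finset.sum_congr rfl fun n _ => ?_
    ring

/-- The Hamiltonian acts on the leading part at the level `δ` as the scalar `levelEnergy`. -/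
theorem weightLE_genPoly_kerHam (hq : q ≠ 0) (hqN : q ^ (2 * N) ≠ 1) (hδ : ∀ n, δ n ≤ N)
    (h : WeightLE (pairWeight N r) (genPoly r φ) (levelWeight N δ)) :
    WeightLE (pairWeight N r) (genPoly r (φ ∘ₗ kerHam N q)) (levelWeight N δ) :=
  weightLE_of_tendsto fun _ hv => ⟨_, tendsto_genPoly_kerHam hq hqN hδ h hv⟩

theorem leadingPart_kerHam (hq : q ≠ 0) (hqN : q ^ (2 * N) ≠ 1) (hδ : ∀ n, δ n ≤ N)
    (h : WeightLE (pairWeight N r) (genPoly r φ) (levelWeight N δ)) :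
    leadingPart (φ ∘ₗ kerHam N q) δ = levelEnergy q N δ • leadingPart φ δ := by
  rw [← sub_eq_zero]
  refine eq_zero_of_eval_generic fun v hv => ?_
  rw [map_sub, smul_eval, sub_eq_zero]
  exact tendsto_nhds_unique (tendsto_eval_scaled (weightLE_genPoly_kerHam hq hqN hδ h) v)
    (tendsto_genPoly_kerHam hq hqN hδ h hv)

end Transfer

/-! ### Symmetry and vanishing of the generating polynomial -/

section Vanishing

open MvPolynomial

lemma X_sub_X_dvd_of_mul {σ : Type*} {a b c d : σ} (hac : a ≠ c) (hbc : b ≠ c) (hab : a ≠ b)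
    {p : MvPolynomial σ ℂ} (h : ∀ v : σ → ℂ, v c = v d → eval v ((X a - X b) * p) = 0) :
    X c - X d ∣ p := by
  classical
  refine X_sub_X_dvd fun v hv => ?_
  have h0 := aeval_update_eq_zero h
  rw [map_mul, map_sub, aeval_X, aeval_X, Function.update_of_ne hac, Function.update_of_ne hbc,
    mul_eq_zero, sub_eq_zero, X_inj, or_iff_right hab] at h0
  have h1 := congrArg (aeval v) h0
  change aeval v (bind₁ (Function.update X c (X d)) p) = _ at h1
  rw [aeval_bind₁, map_zero] at h1
  refine Eq.trans (congrArg (fun f => aeval f p) (funext fun i => ?_)) h1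
  by_cases hi : i = c
  · subst hi; simp [hv]
  · simp [Function.update_of_ne hi]

variable {N r : ℕ} {φ : (Finset (Fin N) → ℂ) →ₗ[ℂ] ℂ}

lemma genPoly_vanish {r : ℕ} (hφ : genPoly r φ = 0) {u : Fin (r + 1) × Bool → ℂ}
    {n m : Fin (r + 1)} (hu : u (n, false) = u (m, true)) : eval u (genPoly (r + 1) φ) = 0 := by
  have h : setFun N u = (∏ p, (param N p - u (n, false))) • setFun N
      (fun i : Fin r × Bool => u (if i.2 then m.succAbove i.1 else n.succAbove i.1, i.2)) := by
    funext I
    rw [Pi.smul_apply, smul_eq_mul, ← Finset.prod_mul_prod_compl I, setFun, setFun, productFun,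
      productFun, mul_mul_mul_comm, ← Finset.prod_mul_distrib, ← Finset.prod_mul_distrib]
    congr 1
    · refine Finset.prod_congr rfl fun x _ => ?_
      rw [rootProd, Fin.prod_univ_succAbove _ n]
      rfl
    · refine Finset.prod_congr rfl fun x _ => ?_
      rw [rootProd, Fin.prod_univ_succAbove _ m, hu]
      rfl
  rw [eval_genPoly, h, map_smul, ← eval_genPoly, hφ, map_zero, smul_zero]

lemma rename_genPoly (π : Equiv.Perm (Fin r)) :
    rename (Prod.map π id) (genPoly r φ) = genPoly r φ := by
  refine MvPolynomial.funext fun u => ?_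
  rw [eval_rename, eval_genPoly, eval_genPoly]
  congr 1
  funext I
  have h : ∀ (b : Bool), rootProd (fun n => (u ∘ Prod.map π id) (n, b)) =
      rootProd (fun n => u (n, b)) := by
    intro b
    funext w
    exact Equiv.prod_comp π fun n => w - u (n, b)
  rw [setFun, h, h, ← setFun]

lemma exists_genPoly_ne_zero [NeZero N] (hφ : φ ≠ 0) : ∃ r, genPoly r φ ≠ 0 := by
  classical
  obtain ⟨J, hJ⟩ : ∃ J, φ (Pi.single J 1) ≠ 0 := by
    by_contra! h
    refine hφ (LinearMap.ext fun F => ?_)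
    rw [map_eq_sum_single]
    simp [h]
  refine ⟨N, fun h => ?_⟩
  set u : Fin N × Bool → ℂ := fun i => if (i.1 ∈ J ↔ i.2 = true) then param N i.1 else 0 with hu
  have h0 : ∀ I, I ≠ J → setFun N u I = 0 := by
    intro I hI
    obtain ⟨x, hx⟩ : ∃ x, ¬ (x ∈ I ↔ x ∈ J) := by
      by_contra! h
      exact hI (Finset.ext h)
    rw [setFun, productFun]
    by_cases hxI : x ∈ I
    · have hxJ : x ∉ J := fun h => hx (by tauto)
      rw [Finset.prod_eq_zero hxI, zero_mul]
      exact Finset.prod_eq_zero (Finset.mem_univ x) (by simp [hu, hxJ])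
    · have hxJ : x ∈ J := by tauto
      rw [Finset.prod_eq_zero (Finset.mem_compl.2 hxI), mul_zero]
      exact Finset.prod_eq_zero (Finset.mem_univ x) (by simp [hu, hxJ])
  have h1 : setFun N u J ≠ 0 := by
    rw [setFun, productFun]
    refine mul_ne_zero ?_ ?_
    · refine Finset.prod_ne_zero_iff.2 fun x hx => Finset.prod_ne_zero_iff.2 fun n _ => ?_
      by_cases hn : n ∈ J
      · simp [hu, hn, param_ne_zero]
      · have : x ≠ n := fun h => hn (h ▸ hx)
        simpa [hu, hn, sub_eq_zero] using fun h => this (param_injective h)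
    · refine Finset.prod_ne_zero_iff.2 fun x hx => Finset.prod_ne_zero_iff.2 fun n _ => ?_
      by_cases hn : n ∈ J
      · have : x ≠ n := fun h => (Finset.mem_compl.1 hx) (h ▸ hn)
        simpa [hu, hn, sub_eq_zero] using fun h => this (param_injective h)
      · simp [hu, hn, param_ne_zero]
  have h2 := eval_genPoly φ u
  rw [h, map_zero, map_eq_sum_single, Finset.sum_eq_single J] at h2
  · exact mul_ne_zero hJ h1 h2.symm
  · intro I _ hI
    rw [h0 I hI, mul_zero]
  · simp

end Vanishing

section LevelSpacing

open MvPolynomial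

variable {N r : ℕ} {g : MvPolynomial (Fin r × Bool) ℂ}

lemma one_le_pairDegree (hg : ∀ (v : Fin r × Bool → ℂ) (n m : Fin r), v (n, false) = v (m, true) →
    eval v g = 0) {d : Fin r × Bool →₀ ℕ} (hd : d ∈ g.support) (n : Fin r) :
    1 ≤ pairDegree d n := by
  classical
  obtain ⟨p, rfl⟩ := X_sub_X_dvd fun v hv => hg v n n hv
  by_contra hlt
  have h1 : d (n, false) = 0 := by simp only [pairDegree] at hlt; omega
  have h2 : d (n, true) = 0 := by simp only [pairDegree] at hlt; omega
  rw [mem_support_iff, sub_mul, coeff_sub, coeff_X_mul', coeff_X_mul', if_neg (by simp [h1]),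
    if_neg (by simp [h2])] at hd
  simp at hd

/-- A swap-symmetric polynomial has a leading monomial whose pair degrees are ordered. -/
lemma pairDegree_le_of_symmetric (hN : N ≠ 0) {n m : Fin r} (hnm : n < m)
    (hsym : rename (Prod.map (Equiv.swap n m) id) g = g) {d : Fin r × Bool →₀ ℕ}
    (hd : d ∈ g.support) (hw : WeightLE (pairWeight N r) g (Finsupp.weight (pairWeight N r) d)) :
    pairDegree d n ≤ pairDegree d m := by
  classical
  have hinj : Function.Injective (Prod.map (Equiv.swap n m) (id : Bool → Bool)) :=
    (Equiv.swap n m).injective.prodMap Function.injective_id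
  have hd' : Finsupp.mapDomain (Prod.map (Equiv.swap n m) (id : Bool → Bool)) d ∈ g.support := by
    rw [mem_support_iff, ← hsym, coeff_rename_mapDomain _ hinj]
    exact mem_support_iff.1 hd
  have h1 := hw _ hd'
  rw [weight_pairWeight, weight_pairWeight] at h1
  have h2 : ∀ k, pairDegree (Finsupp.mapDomain (Prod.map (Equiv.swap n m) (id : Bool → Bool)) d) k =
      pairDegree d (Equiv.swap n m k) := by
    intro k
    have h3 : ∀ b, (k, b) = Prod.map (Equiv.swap n m) (id : Bool → Bool)
      (Equiv.swap n m k, b) := by simp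
    rw [pairDegree, h3 false, h3 true, Finsupp.mapDomain_apply hinj, Finsupp.mapDomain_apply hinj,
      pairDegree]
  by_contra! hlt
  refine absurd h1 (not_le.2 ?_)
  have hm : m ∈ Finset.univ.erase n := by simp [hnm.ne']
  have h3 : ∑ k ∈ (Finset.univ.erase n).erase m, pairDegree d k * (N + 1) ^ (k : ℕ) =
      ∑ k ∈ (Finset.univ.erase n).erase m, pairDegree d (Equiv.swap n m k) * (N + 1) ^ (k : ℕ) :=
    Finset.sum_congr rfl fun k hk => by
      rw [Equiv.swap_apply_of_ne_of_ne (Finset.ne_of_mem_erase (Finset.mem_of_mem_erase hk))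
        (Finset.ne_of_mem_erase hk)]
  simp only [levelWeight, h2]
  rw [← Finset.add_sum_erase _ _ (Finset.mem_univ n), ← Finset.add_sum_erase _ _ hm,
    ← Finset.add_sum_erase _ (fun k => pairDegree d (Equiv.swap n m k) * _) (Finset.mem_univ n),
    ← Finset.add_sum_erase _ (fun k => pairDegree d (Equiv.swap n m k) * _) hm,
    Equiv.swap_apply_left, Equiv.swap_apply_right, ← add_assoc, ← add_assoc,
    ← h3]
  refine Nat.add_lt_add_right ?_ _
  have hB : (N + 1) ^ (n : ℕ) < (N + 1) ^ (m : ℕ) := Nat.pow_lt_pow_right (by omega) hnm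
  nlinarith

lemma pairDegree_add_two_le (hN : N ≠ 0) (hg0 : g ≠ 0)
    (hg : ∀ (v : Fin r × Bool → ℂ) (n m : Fin r), v (n, false) = v (m, true) → eval v g = 0)
    (hsym : ∀ π : Equiv.Perm (Fin r), rename (Prod.map π id) g = g)
    (hle : ∀ d ∈ g.support, ∀ n, pairDegree d n ≤ N) {d : Fin r × Bool →₀ ℕ}
    (hd : d ∈ g.support) (hw : WeightLE (pairWeight N r) g (Finsupp.weight (pairWeight N r) d))
    {n m : Fin r} (hnm : n < m) : pairDegree d n + 2 ≤ pairDegree d m := by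
  classical
  obtain ⟨p, rfl⟩ : X (n, true) - X (m, false) ∣ g :=
    X_sub_X_dvd fun v hv => hg v m n hv.symm
  obtain ⟨h, rfl⟩ : X (n, false) - X (m, true) ∣ p :=
    X_sub_X_dvd_of_mul (by simp) (by simp [hnm.ne']) (by simp) fun v hv => hg v n m hv
  have hh0 : h ≠ 0 := right_ne_zero_of_mul (right_ne_zero_of_mul hg0)
  have hhs : rename (Prod.map (Equiv.swap n m) id) h = h := by
    have h1 := hsym (Equiv.swap n m)
    rw [map_mul, map_mul, map_sub, map_sub] at h1
    simp only [rename_X, Prod.map_apply, Equiv.swap_apply_left, Equiv.swap_apply_right, id] at h1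
    refine mul_left_cancel₀ (left_ne_zero_of_mul hg0) (mul_left_cancel₀
      (left_ne_zero_of_mul (right_ne_zero_of_mul hg0)) ?_)
    linear_combination h1
  obtain ⟨e, he, hew⟩ := exists_weightLE (pairWeight N r) hh0
  have hγ : ∀ b b', pairWeight N r (n, b) < pairWeight N r (m, b') :=
    fun b b' => pairWeight_lt hN hnm
  have h1 := mem_support_sub_mul (hγ false true) he hew
  have h2 := mem_support_sub_mul (hγ true false) h1.1 h1.2
  have h3 : Finsupp.weight (pairWeight N r) d = Finsupp.weight (pairWeight N r)
      (e + Finsupp.single (m, true) 1 + Finsupp.single (m, false) 1) :=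
    le_antisymm (h2.2 _ hd) (hw _ h2.1)
  rw [weight_pairWeight, weight_pairWeight] at h3
  rw [levelWeight_injective (hle _ hd) (hle _ h2.1) h3]
  have h4 := pairDegree_le_of_symmetric hN hnm hhs he hew
  simp [pairDegree, hnm.ne] at h4 ⊢
  omega

end LevelSpacing

section UpperBound

open MvPolynomial

variable {N : ℕ} [NeZero N] {q : ℂ}

/-- Every eigenvalue is the energy of a sequence of levels with gaps at least two. -/
theorem exists_levelEnergy_eq (hq : q ≠ 0) (hqN : q ^ (2 * N) ≠ 1) {E : ℂ}
    {φ : (Finset (Fin N) → ℂ) →ₗ[ℂ] ℂ} (hφ0 : φ ≠ 0) (hφ : φ ∘ₗ kerHam N q = E • φ) :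
    ∃ (r : ℕ) (δ : Fin r → ℕ), (∀ n, 1 ≤ δ n) ∧ (∀ n, δ n ≤ N) ∧
      (∀ n m, n < m → δ n + 2 ≤ δ m) ∧ E = levelEnergy q N δ := by
  classical
  have hex := exists_genPoly_ne_zero hφ0
  obtain ⟨r, hg0, hmin⟩ : ∃ r, genPoly r φ ≠ 0 ∧ ∀ k < r, genPoly k φ = 0 :=
    ⟨Nat.find hex, Nat.find_spec hex, fun k hk => not_not.1 (Nat.find_min hex hk)⟩
  have hg : ∀ (v : Fin r × Bool → ℂ) (n m : Fin r), v (n, false) = v (m, true) →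
      eval v (genPoly r φ) = 0 := by
    cases r with
    | zero => exact fun _ n => n.elim0
    | succ r => exact fun v n m => genPoly_vanish (hmin r r.lt_succ_self)
  obtain ⟨d, hd, hw⟩ := exists_weightLE (pairWeight N r) hg0
  have hle : ∀ n, pairDegree d n ≤ N := pairDegree_le hd
  refine ⟨r, pairDegree d, one_le_pairDegree hg hd, hle, fun n m hnm =>
    pairDegree_add_two_le (NeZero.ne N) hg0 hg rename_genPoly (fun _ => pairDegree_le) hd hw hnm, ?_⟩
  have h0 : coeff d (leadingPart φ (pairDegree d)) ≠ 0 := by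
    rw [leadingPart, coeff_weightedHomogeneousComponent, if_pos (weight_pairWeight d)]
    exact mem_support_iff.1 hd
  rw [weight_pairWeight] at hw
  have h1 := congrArg (coeff d) (leadingPart_kerHam hq hqN hle hw)
  rw [hφ, leadingPart, map_smul, map_smul, ← leadingPart, coeff_smul, coeff_smul] at h1
  exact mul_right_cancel₀ h0 h1

end UpperBound

/-! ### Functionals with prescribed leading part -/

section LevelFunctional

open MvPolynomial Filter Topology

variable {N r : ℕ} {κ : Fin r → ℕ}

/-- The linear functional on functions of `r`-element sets attached to the exponents `κ`. -/
def levelFunctional (N : ℕ) {r : ℕ} (κ : Fin r → ℕ) : (Finset (Fin N) → ℂ) →ₗ[ℂ] ℂ :=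
  ∑ t : Fin r ↪ Fin N, ((∏ n, param N (t n) ^ κ n) /
    ∏ y ∈ (Finset.univ.map t)ᶜ, ∏ n, (param N y - param N (t n))) •
    LinearMap.proj (Finset.univ.map t)

/-- The sum of the monomials with exponents given by the permutations of `κ`. -/
def permSum (κ : Fin r → ℕ) : MvPolynomial (Fin r) ℂ :=
  ∑ σ : Equiv.Perm (Fin r), ∏ n, X (σ n) ^ κ n

/-- The values of `levelFunctional` as a polynomial in the variables `t`. -/
def levelPoly (N : ℕ) (κ : Fin r → ℕ) (s : Fin r → ℂ) : MvPolynomial (Fin r) ℂ :=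
  ∑ t : Fin r ↪ Fin N, C ((∏ n, param N (t n) ^ κ n) /
    (∏ y ∈ (Finset.univ.map t)ᶜ, ∏ n, (param N y - param N (t n))) *
    ∏ n, rootProd s (param N (t n))) *
    ∏ y ∈ (Finset.univ.map t)ᶜ, ∏ m, (C (param N y) - X m)

lemma eval_genPoly_levelFunctional (u : Fin r × Bool → ℂ) :
    eval u (genPoly r (levelFunctional N κ)) =
      eval (fun m => u (m, true)) (levelPoly N κ fun n => u (n, false)) := by
  rw [eval_genPoly, levelFunctional, levelPoly, LinearMap.sum_apply, map_sum]
  refine Finset.sum_congr rfl fun t _ => ?_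
  rw [LinearMap.smul_apply, LinearMap.proj_apply, setFun, productFun, Finset.prod_map, map_mul,
    eval_C, smul_eq_mul, ← mul_assoc, map_prod]
  simp [rootProd]

lemma degreeOf_C_sub_X_le (c : ℂ) (i m : Fin r) :
    degreeOf i (C c - X m : MvPolynomial (Fin r) ℂ) ≤ if m = i then 1 else 0 := by
  refine (degreeOf_sub_le _ _ _).trans ?_
  rw [degreeOf_C, degreeOf_X, Nat.zero_max]
  split_ifs with h h' <;> simp_all

lemma degreeOf_prod_le {ι : Type*} (S : Finset ι) (f : ι → MvPolynomial (Fin r) ℂ) (i : Fin r)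
    {w : ι → ℕ} (h : ∀ k ∈ S, degreeOf i (f k) ≤ w k) :
    degreeOf i (∏ k ∈ S, f k) ≤ ∑ k ∈ S, w k :=
  (MvPolynomial.degreeOf_prod_le i S f).trans (Finset.sum_le_sum h)

lemma degreeOf_levelPoly_le (s : Fin r → ℂ) (i : Fin r) :
    degreeOf i (levelPoly N κ s) ≤ N - r := by
  refine (degreeOf_sum_le _ _ _).trans (Finset.sup_le fun t _ => ?_)
  refine (degreeOf_C_mul_le _ _ _).trans ?_
  refine (degreeOf_prod_le _ _ i (w := fun _ => 1) fun y _ => ?_).trans ?_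
  · exact (degreeOf_prod_le _ _ i fun m _ => degreeOf_C_sub_X_le _ i m).trans (by simp)
  · simp [Finset.card_compl]

lemma degreeOf_perm_monomial_le {K : ℕ} (hκ : ∀ n, κ n ≤ K) (σ : Equiv.Perm (Fin r)) (i : Fin r) :
    degreeOf i (∏ n, X (σ n) ^ κ n : MvPolynomial (Fin r) ℂ) ≤ K := by
  refine (degreeOf_prod_le _ _ i (w := fun n => if σ n = i then K else 0) fun n _ => ?_).trans ?_
  · refine (degreeOf_pow_le _ _ _).trans ?_
    rw [degreeOf_X]
    split_ifs with h h' <;> simp_all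
  · rw [Equiv.sum_comp σ fun n => if n = i then K else 0]
    simp

lemma degreeOf_permSum_le {K : ℕ} (hκ : ∀ n, κ n ≤ K) (i : Fin r) :
    degreeOf i (permSum κ) ≤ K :=
  (degreeOf_sum_le _ _ _).trans (Finset.sup_le fun σ _ => degreeOf_perm_monomial_le hκ σ i)

lemma degreeOf_det_vandermonde_le (i : Fin r) :
    degreeOf i (Matrix.vandermonde (X : Fin r → MvPolynomial (Fin r) ℂ)).det ≤ r - 1 := by
  rw [Matrix.det_apply']
  refine (degreeOf_sum_le _ _ _).trans (Finset.sup_le fun σ _ => ?_)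
  simp only [← map_intCast (C (σ := Fin r) (R := ℂ))]
  exact (degreeOf_C_mul_le _ _ _).trans
    (degreeOf_perm_monomial_le (κ := fun n : Fin r => (n : ℕ)) (fun n => by omega) σ i)

lemma eval_det_vandermonde_ne_zero_iff (t : Fin r → ℂ) :
    eval t (Matrix.vandermonde (X : Fin r → MvPolynomial (Fin r) ℂ)).det ≠ 0 ↔
      Function.Injective t := by
  rw [← Matrix.det_vandermonde_ne_zero_iff, RingHom.map_det]
  have : (eval t).mapMatrix (Matrix.vandermonde (X : Fin r → MvPolynomial (Fin r) ℂ)) =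
      Matrix.vandermonde t := by
    ext i j
    simp [Matrix.vandermonde_apply]
  rw [this]

variable [NeZero N]

lemma eval_levelPoly_param (s : Fin r → ℂ) (τ : Fin r ↪ Fin N) :
    eval (fun m => param N (τ m)) (levelPoly N κ s) =
      (∏ n, rootProd s (param N (τ n))) * eval (fun m => param N (τ m)) (permSum κ) := by
  classical
  set D := ∏ y ∈ (Finset.univ.map τ)ᶜ, ∏ n, (param N y - param N (τ n)) with hD
  have hD0 : D ≠ 0 := by
    refine Finset.prod_ne_zero_iff.2 fun y hy => Finset.prod_ne_zero_iff.2 fun n _ => ?_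
    refine sub_ne_zero.2 fun h => Finset.mem_compl.1 hy ?_
    rw [param_injective h]
    simp
  have hperm : ∀ σ : Equiv.Perm (Fin r),
      Finset.univ.map (σ.toEmbedding.trans τ) = Finset.univ.map τ := by
    intro σ
    rw [← Finset.map_map, Finset.map_univ_equiv]
  rw [levelPoly, permSum, map_sum, map_sum, Finset.mul_sum]
  symm
  refine Finset.sum_of_injOn (fun σ => σ.toEmbedding.trans τ) ?_ (by simp) ?_ ?_
  · intro σ _ σ' _ h
    exact Equiv.ext fun n => τ.injective (DFunLike.congr_fun h n)
  · intro t _ ht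
    have hne : Finset.univ.map t ≠ Finset.univ.map τ := by
      intro h
      refine ht ?_
      have h1 : ∀ n, ∃ m, τ m = t n := fun n => by
        have : t n ∈ Finset.univ.map τ := h ▸ Finset.mem_map_of_mem t (Finset.mem_univ n)
        simpa using this
      choose f hf using h1
      have hfi : Function.Injective f := fun a b hab => t.injective (by rw [← hf, ← hf, hab])
      exact ⟨Equiv.ofBijective f (Finite.injective_iff_bijective.1 hfi), by simp,
        Function.Embedding.ext fun n => hf n⟩
    obtain ⟨x, hx, hx'⟩ : ∃ x ∈ Finset.univ.map τ, x ∉ Finset.univ.map t := by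
      by_contra! h
      exact hne (Finset.eq_of_subset_of_card_le h (by simp)).symm
    obtain ⟨m, -, rfl⟩ := Finset.mem_map.1 hx
    rw [map_mul, map_prod]
    refine mul_eq_zero_of_right _ (Finset.prod_eq_zero (Finset.mem_compl.2 hx') ?_)
    rw [map_prod]
    exact Finset.prod_eq_zero (Finset.mem_univ m) (by simp)
  · intro σ _
    simp only [hperm, Function.Embedding.trans_apply, Equiv.coe_toEmbedding]
    have h1 : ∏ y ∈ (Finset.univ.map τ)ᶜ, ∏ n, (param N y - param N (τ (σ n))) = D :=
      Finset.prod_congr rfl fun y _ => Equiv.prod_comp σ fun n => param N y - param N (τ n)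
    rw [h1, Equiv.prod_comp σ fun n => rootProd s (param N (τ n))]
    simp only [map_mul, map_prod, eval_C, map_sub, eval_X, map_pow, ← hD]
    field_simp

/-- Interpolation of the generating polynomial of `levelFunctional`. -/
lemma eval_levelPoly (hκ : ∀ n, κ n + 2 * r ≤ N) (s : Fin r → ℂ) {t : Fin r → ℂ}
    (ht : Function.Injective t) :
    eval t (levelPoly N κ s) = (∏ n, rootProd s (t n)) * eval t (permSum κ) := by
  classical
  set R : MvPolynomial (Fin r) ℂ := (∏ n, ∏ k, (X n - C (s k))) * permSum κ with hR
  have hRe : ∀ t, eval t R = (∏ n, rootProd s (t n)) * eval t (permSum κ) := by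
    intro t
    simp [hR, rootProd, map_prod]
  have hRd : ∀ i, degreeOf i R ≤ N - r := by
    intro i
    have h2 : degreeOf i (permSum κ) ≤ N - 2 * r :=
      degreeOf_permSum_le (fun n => by have := hκ n; omega) i
    have h1 : degreeOf i (∏ n, ∏ k, (X n - C (s k)) : MvPolynomial (Fin r) ℂ) ≤ r := by
      refine (degreeOf_prod_le _ _ i (w := fun n => r * if n = i then 1 else 0) fun n _ => ?_).trans
        (by simp)
      refine (degreeOf_prod_le _ _ i (w := fun _ => if n = i then 1 else 0) fun k _ => ?_).trans
        (by simp)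
      rw [← neg_sub, degreeOf_neg]
      exact degreeOf_C_sub_X_le _ i n
    have h3 := degreeOf_mul_le i (∏ n, ∏ k, (X n - C (s k))) (permSum κ)
    rw [← hR] at h3
    have := hκ i
    omega
  have key : (Matrix.vandermonde (X : Fin r → MvPolynomial (Fin r) ℂ)).det *
      (levelPoly N κ s - R) = 0 := by
    refine eq_zero_of_eval_zero_at_prod_finset _
      (fun _ => Finset.univ.map ⟨param N, param_injective⟩) ?_ ?_
    · intro i
      have h1 := degreeOf_mul_le i (Matrix.vandermonde (X : Fin r → MvPolynomial (Fin r) ℂ)).det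
        (levelPoly N κ s - R)
      have h2 := degreeOf_sub_le i (levelPoly N κ s) R
      have h3 := degreeOf_levelPoly_le (N := N) (κ := κ) s i
      have h4 := hRd i
      have h5 := degreeOf_det_vandermonde_le i
      have h6 := hκ i
      have h7 := i.2
      rw [Finset.card_map, Finset.card_univ, Fintype.card_fin]
      omega
    · intro x hx
      by_cases hxi : Function.Injective x
      · have h1 : ∀ i, ∃ p, param N p = x i := fun i => by simpa using hx i
        choose p hp using h1
        have hpi : Function.Injective p := fun a b hab => hxi (by rw [← hp, ← hp, hab])
        obtain rfl : (fun m => param N (p m)) = x := funext hp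
        have h2 := eval_levelPoly_param (κ := κ) s ⟨p, hpi⟩
        rw [Function.Embedding.coeFn_mk] at h2
        rw [map_mul, map_sub, hRe, h2, sub_self, mul_zero]
      · rw [map_mul, not_not.1 ((eval_det_vandermonde_ne_zero_iff x).not.2 hxi), zero_mul]
  have h1 := congrArg (eval t) key
  rw [map_mul, map_zero, mul_eq_zero, or_iff_right ((eval_det_vandermonde_ne_zero_iff t).2 ht),
    map_sub, sub_eq_zero, hRe] at h1
  exact h1

end LevelFunctional

section LevelFunctionalLeading

open MvPolynomial Filter Topology

variable {N r : ℕ} {κ δ : Fin r → ℕ}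

/-- The polynomial `permSum` in the second variables of the pairs. -/
def pairPermSum (κ : Fin r → ℕ) : MvPolynomial (Fin r × Bool) ℂ :=
  rename (fun n => (n, true)) (permSum κ)

lemma pairPermSum_eq_sum (κ : Fin r → ℕ) : pairPermSum κ =
    ∑ σ : Equiv.Perm (Fin r), monomial (∑ n, Finsupp.single (σ n, true) (κ n)) 1 := by
  rw [pairPermSum, permSum, map_sum]
  refine Finset.sum_congr rfl fun σ _ => ?_
  rw [map_prod, monomial_sum_one]
  refine Finset.prod_congr rfl fun n _ => ?_
  rw [map_pow, rename_X, X_pow_eq_monomial]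

lemma weight_perm_monomial (κ : Fin r → ℕ) (σ : Equiv.Perm (Fin r)) :
    Finsupp.weight (pairWeight N r) (∑ n, Finsupp.single (σ n, true) (κ n)) =
      ∑ n, κ n * (N + 1) ^ (σ n : ℕ) := by
  simp [Finsupp.weight_single, pairWeight]

lemma weightLE_pairPermSum (hκ : Monotone κ) :
    WeightLE (pairWeight N r) (pairPermSum κ) (levelWeight N κ) := by
  classical
  rw [pairPermSum_eq_sum]
  refine WeightLE.sum _ fun σ _ d hd => ?_
  rw [Finset.mem_singleton.1 (support_monomial_subset hd), weight_perm_monomial]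
  refine Monovary.sum_mul_comp_perm_le_sum_mul (f := κ) (g := fun n => (N + 1) ^ (n : ℕ)) ?_
  exact hκ.monovary fun a b hab => Nat.pow_le_pow_right (by omega) hab

lemma weightedHomogeneousComponent_pairPermSum_ne_zero (κ : Fin r → ℕ) :
    weightedHomogeneousComponent (pairWeight N r) (levelWeight N κ) (pairPermSum κ) ≠ 0 := by
  classical
  intro h
  have h1 := congrArg (coeff (∑ n, Finsupp.single (n, true) (κ n))) h
  rw [coeff_weightedHomogeneousComponent, if_pos (by exact weight_perm_monomial κ 1), coeff_zero,
    pairPermSum_eq_sum, coeff_sum] at h1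
  simp only [coeff_monomial] at h1
  rw [Finset.sum_boole, Nat.cast_eq_zero, Finset.card_eq_zero] at h1
  exact Finset.filter_eq_empty_iff.1 h1 (Finset.mem_univ 1) rfl

lemma sum_max_pow (B : ℕ) (hB : 0 < B) :
    ∑ n : Fin r, ∑ m : Fin r, max (B ^ (n : ℕ)) (B ^ (m : ℕ)) =
      ∑ n : Fin r, (2 * (n : ℕ) + 1) * B ^ (n : ℕ) := by
  induction r with
  | zero => simp
  | succ r ih =>
    rw [Fin.sum_univ_castSucc, Fin.sum_univ_castSucc (n := r)]
    simp only [Fin.sum_univ_castSucc (n := r), Finset.sum_add_distrib, Fin.val_castSucc,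
      Fin.val_last, ih, max_self]
    have h : ∀ n : Fin r, B ^ (n : ℕ) ≤ B ^ r := fun n => Nat.pow_le_pow_right hB n.2.le
    simp only [max_eq_right (h _), max_eq_left (h _)]
    simp
    ring

lemma levelWeight_eq_add (hδ : ∀ n, δ n = κ n + (2 * (n : ℕ) + 1)) :
    levelWeight N δ = (∑ n : Fin r, ∑ m : Fin r, max (pairWeight N r (n, true))
      (pairWeight N r (m, false))) + levelWeight N κ := by
  simp only [pairWeight]
  rw [sum_max_pow _ (by omega), levelWeight, levelWeight, ← Finset.sum_add_distrib]
  exact Finset.sum_congr rfl fun n _ => by rw [hδ]; ring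

variable [NeZero N]

lemma tendsto_levelFunctional (hκ : Monotone κ) (hκN : ∀ n, κ n + 2 * r ≤ N)
    (hδ : ∀ n, δ n = κ n + (2 * (n : ℕ) + 1)) {v : Fin r × Bool → ℂ} (hv : IsGenericPoint v) :
    Tendsto (fun ε => ε ^ levelWeight N δ * eval (scaled (pairWeight N r) v ε)
        (genPoly r (levelFunctional N κ))) (𝓝[≠] 0)
      (𝓝 ((∏ n, ∏ m, scaledDiff (pairWeight N r) v (n, true) (m, false) 0) *
        eval v (weightedHomogeneousComponent (pairWeight N r) (levelWeight N κ)
          (pairPermSum κ)))) := by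
  have h1 : Tendsto (fun ε => ∏ n, ∏ m, scaledDiff (pairWeight N r) v (n, true) (m, false) ε)
      (𝓝[≠] 0) (𝓝 (∏ n, ∏ m, scaledDiff (pairWeight N r) v (n, true) (m, false) 0)) :=
    tendsto_finsetProd _ fun n _ => tendsto_finsetProd _ fun m _ => tendsto_scaledDiff _ _
  refine (h1.mul (tendsto_eval_scaled (weightLE_pairPermSum hκ) v)).congr' ?_
  filter_upwards [eventually_scaled_injective hv, self_mem_nhdsWithin] with ε hi hε
  have hε : ε ≠ 0 := hε
  rw [eval_genPoly_levelFunctional, eval_levelPoly hκN _ fun a b hab => congrArg Prod.fst (hi hab),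
    levelWeight_eq_add hδ, pow_add, pairPermSum, eval_rename, mul_mul_mul_comm]
  congr 1
  simp only [rootProd, ← Finset.prod_pow_eq_pow_sum, ← Finset.prod_mul_distrib,
    scaled_sub_scaled _ _ hε]
  refine Finset.prod_congr rfl fun n _ => Finset.prod_congr rfl fun m _ => ?_
  rw [← mul_assoc, ← mul_pow, mul_inv_cancel₀ hε, one_pow, one_mul]

/-- `levelFunctional` has leading weight `levelWeight N δ`. -/
theorem exists_leadingPart_ne_zero (hκ : Monotone κ) (hκN : ∀ n, κ n + 2 * r ≤ N)
    (hδ : ∀ n, δ n = κ n + (2 * (n : ℕ) + 1)) :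
    ∃ φ : (Finset (Fin N) → ℂ) →ₗ[ℂ] ℂ,
      WeightLE (pairWeight N r) (genPoly r φ) (levelWeight N δ) ∧ leadingPart φ δ ≠ 0 := by
  have hw : WeightLE (pairWeight N r) (genPoly r (levelFunctional N κ)) (levelWeight N δ) :=
    weightLE_of_tendsto fun _ hv => ⟨_, tendsto_levelFunctional hκ hκN hδ hv⟩
  refine ⟨levelFunctional N κ, hw, fun h0 => ?_⟩
  refine weightedHomogeneousComponent_pairPermSum_ne_zero (N := N) κ
    (eq_zero_of_eval_generic fun v hv => ?_)
  have h1 := tendsto_nhds_unique (tendsto_eval_scaled hw v) (tendsto_levelFunctional hκ hκN hδ hv)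
  rw [← leadingPart, h0, map_zero, eq_comm, mul_eq_zero] at h1
  refine h1.resolve_left (Finset.prod_ne_zero_iff.2 fun n _ => Finset.prod_ne_zero_iff.2 fun m _ =>
    scaledDiff_zero_ne_zero hv (by simp))

end LevelFunctionalLeading

section LowerBound

open MvPolynomial

variable {N r : ℕ} {q : ℂ} {δ : Fin r → ℕ}

/-- The functionals whose generating polynomial has weight at most `w`. -/
def weightSubmodule (N r w : ℕ) : Submodule ℂ ((Finset (Fin N) → ℂ) →ₗ[ℂ] ℂ) where
  carrier := {φ | WeightLE (pairWeight N r) (genPoly r φ) w}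
  add_mem' h h' := by
    rw [Set.mem_ofPred_eq, map_add]
    exact h.add h'
  zero_mem' := by
    rw [Set.mem_ofPred_eq, map_zero, ← C_0]
    exact weightLE_C _ _
  smul_mem' a φ h := by
    rw [Set.mem_ofPred_eq, map_smul, smul_eq_C_mul]
    exact ((weightLE_C a 0).mul h).mono (zero_add w).le

/-- The action of the Hamiltonian on functionals, shifted by a scalar. -/
def dualKerHam (N : ℕ) (q E : ℂ) :
    ((Finset (Fin N) → ℂ) →ₗ[ℂ] ℂ) →ₗ[ℂ] ((Finset (Fin N) → ℂ) →ₗ[ℂ] ℂ) :=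
  LinearMap.lcomp ℂ ℂ (kerHam N q) - E • LinearMap.id

/-- Every level with a functional with nonzero leading part gives an eigenvalue. -/
theorem exists_eigenfunctional [NeZero N] (hq : q ≠ 0) (hqN : q ^ (2 * N) ≠ 1)
    (hδ : ∀ n, δ n ≤ N) (h : ∃ φ : (Finset (Fin N) → ℂ) →ₗ[ℂ] ℂ,
      WeightLE (pairWeight N r) (genPoly r φ) (levelWeight N δ) ∧ leadingPart φ δ ≠ 0) :
    ∃ φ : (Finset (Fin N) → ℂ) →ₗ[ℂ] ℂ, φ ≠ 0 ∧ φ ∘ₗ kerHam N q = levelEnergy q N δ • φ := by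
  obtain ⟨φ₀, hw₀, h₀⟩ := h
  set W := weightSubmodule N r (levelWeight N δ)
  have hmap : ∀ φ ∈ W, dualKerHam N q (levelEnergy q N δ) φ ∈ W := fun φ hφ =>
    W.sub_mem (weightLE_genPoly_kerHam hq hqN hδ hφ) (W.smul_mem _ hφ)
  have hlead : ∀ φ ∈ W, leadingPart (dualKerHam N q (levelEnergy q N δ) φ) δ = 0 := by
    intro φ hφ
    have : dualKerHam N q (levelEnergy q N δ) φ = φ ∘ₗ kerHam N q - levelEnergy q N δ • φ := rfl
    rw [this, leadingPart, map_sub, map_sub, map_smul, map_smul, ← leadingPart, ← leadingPart,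
      leadingPart_kerHam hq hqN hδ hφ, sub_self]
  have hninj : ¬ Function.Injective ((dualKerHam N q (levelEnergy q N δ)).restrict hmap) := by
    rw [LinearMap.injective_iff_surjective]
    intro hs
    obtain ⟨φ, hφ⟩ := hs ⟨φ₀, hw₀⟩
    have h1 : dualKerHam N q (levelEnergy q N δ) φ = φ₀ := congrArg Subtype.val hφ
    exact h₀ (by rw [← h1, hlead φ φ.2])
  rw [injective_iff_map_eq_zero] at hninj
  push Not at hninj
  obtain ⟨φ, h1, h2⟩ := hninj
  refine ⟨φ, fun h => h2 (Subtype.ext h), ?_⟩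
  have h3 : dualKerHam N q (levelEnergy q N δ) φ = 0 := congrArg Subtype.val h1
  exact sub_eq_zero.1 h3

end LowerBound

/-! ### Levels and motifs -/

section Motifs

variable {N r : ℕ} {q : ℂ} {δ : Fin r → ℕ}

lemma add_two_mul_le (hgap : ∀ n m, n < m → δ n + 2 ≤ δ m) {n m : Fin r} {k : ℕ}
    (hk : (n : ℕ) + k = m) : δ n + 2 * k ≤ δ m := by
  induction k generalizing m with
  | zero =>
    obtain rfl : n = m := Fin.ext hk
    rfl
  | succ k ih =>
    have h1 := ih (m := ⟨n + k, by omega⟩) rfl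
    have h2 := hgap ⟨n + k, by omega⟩ m (Fin.lt_def.2 (by simp only; omega))
    omega

/-- Sequences of levels with gaps at least two give eigenvalues. -/
theorem exists_eigenfunctional_of_gap [NeZero N] (hq : q ≠ 0) (hqN : q ^ (2 * N) ≠ 1)
    (h1 : ∀ n, 1 ≤ δ n) (hN : ∀ n, δ n < N) (hgap : ∀ n m, n < m → δ n + 2 ≤ δ m) :
    ∃ φ : (Finset (Fin N) → ℂ) →ₗ[ℂ] ℂ, φ ≠ 0 ∧ φ ∘ₗ kerHam N q = levelEnergy q N δ • φ := by
  have hlow : ∀ n : Fin r, 2 * (n : ℕ) + 1 ≤ δ n := fun n => by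
    have h2 := add_two_mul_le hgap (n := ⟨0, n.pos⟩) (m := n) (k := n) (by simp)
    have h3 := h1 ⟨0, n.pos⟩
    omega
  refine exists_eigenfunctional hq hqN (fun n => (hN n).le)
    (exists_leadingPart_ne_zero (κ := fun n => δ n - (2 * (n : ℕ) + 1)) ?_ ?_ ?_)
  · intro n m hnm
    have h2 := add_two_mul_le hgap (n := n) (m := m) (k := m - n) (by
      have := Fin.le_def.1 hnm
      omega)
    simp only
    omega
  · intro n
    have h2 := add_two_mul_le hgap (n := n) (m := ⟨r - 1, Nat.sub_one_lt_of_lt n.2⟩) (k := r - 1 - n)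
      (by simp only; omega)
    have h3 := hN ⟨r - 1, Nat.sub_one_lt_of_lt n.2⟩
    have h4 := hlow n
    omega
  · intro n
    exact (Nat.sub_add_cancel (hlow n)).symm

lemma levelEnergy_eq_sum [NeZero N] (hq : q ≠ 0) (hδ : ∀ n, δ n ≤ N) :
    levelEnergy q N δ = ∑ n, epsL N q (N - δ n) := by
  refine Finset.sum_congr rfl fun n _ => ?_
  have hN : (N : ℂ) ≠ 0 := Nat.cast_ne_zero.2 (NeZero.ne N)
  have h1 : q ^ δ n * (q ^ (N - δ n) - q⁻¹ ^ (N - δ n)) = q ^ N - q⁻¹ ^ N * (q ^ 2) ^ δ n := by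
    have h2 : q ^ N = q ^ δ n * q ^ (N - δ n) := by rw [← pow_add, Nat.add_sub_cancel' (hδ n)]
    rw [inv_pow, inv_pow, h2]
    field_simp
    ring
  rw [epsL, Nat.sub_sub_self (hδ n), qint, qint, Nat.cast_sub (hδ n), mul_div_assoc', h1]
  field_simp
  ring

lemma epsL_zero : epsL N q 0 = 0 := by simp [epsL, qint]

lemma exists_motif_of_gap (h1 : ∀ n, 1 ≤ δ n) (hN : ∀ n, δ n ≤ N)
    (hgap : ∀ n m, n < m → δ n + 2 ≤ δ m) :
    ∃ μ : Finset ℕ, IsMotif N μ ∧ ∑ n, epsL N q (N - δ n) = ∑ m ∈ μ, epsL N q m := by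
  have hinj : Function.Injective fun n => N - δ n := by
    intro n m h
    by_contra hnm
    have h2 := hN n
    have h3 := hN m
    simp only at h
    rcases Ne.lt_or_gt hnm with hlt | hlt
    · have := hgap _ _ hlt; omega
    · have := hgap _ _ hlt; omega
  refine ⟨(Finset.univ.image fun n => N - δ n).erase 0, ⟨?_, ?_⟩, ?_⟩
  · intro m hm
    obtain ⟨h0, hm⟩ := Finset.mem_erase.1 hm
    obtain ⟨n, -, rfl⟩ := Finset.mem_image.1 hm
    have := h1 n
    exact Finset.mem_Icc.2 ⟨by omega, by omega⟩
  · intro m hm hm'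
    obtain ⟨a, -, rfl⟩ := Finset.mem_image.1 (Finset.mem_of_mem_erase hm)
    obtain ⟨b, -, hb⟩ := Finset.mem_image.1 (Finset.mem_of_mem_erase hm')
    have h2 := hN a
    have h3 := hN b
    rcases lt_trichotomy a b with hlt | rfl | hlt
    · have := hgap _ _ hlt; omega
    · omega
    · have := hgap _ _ hlt; omega
  · rw [Finset.sum_erase _ epsL_zero, Finset.sum_image fun n _ m _ h => hinj h]

lemma exists_gap_of_motif {μ : Finset ℕ} (hμ : IsMotif N μ) :
    ∃ (r : ℕ) (δ : Fin r → ℕ), (∀ n, 1 ≤ δ n) ∧ (∀ n, δ n < N) ∧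
      (∀ n m, n < m → δ n + 2 ≤ δ m) ∧
      ∑ m ∈ μ, epsL N q m = ∑ n, epsL N q (N - δ n) := by
  have hμN : ∀ m ∈ μ, 1 ≤ m ∧ m < N := fun m hm => by
    have := Finset.mem_Icc.1 (hμ.1 hm)
    omega
  set e := (μ.image fun m => N - m).orderEmbOfFin rfl with he
  have hmem : ∀ n, N - e n ∈ μ ∧ 1 ≤ e n ∧ e n < N := by
    intro n
    obtain ⟨m, hm, hmn⟩ := Finset.mem_image.1 (Finset.orderEmbOfFin_mem
      (μ.image fun m => N - m) rfl n)
    have h2 := hμN m hm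
    rw [← he] at hmn
    have h3 : N - e n = m := by omega
    exact ⟨h3 ▸ hm, by omega, by omega⟩
  refine ⟨_, e, fun n => (hmem n).2.1, fun n => (hmem n).2.2, ?_, ?_⟩
  · intro n m hnm
    have h2 := e.strictMono hnm
    by_contra hlt
    refine hμ.2 _ (hmem m).1 ?_
    have h3 := (hmem m).2.2
    have h4 : N - e m + 1 = N - e n := by omega
    exact h4 ▸ (hmem n).1
  · symm
    refine Finset.sum_nbij (fun n => N - e n) (fun n _ => (hmem n).1) ?_ ?_ fun _ _ => rfl
    · intro n _ m _ h
      have h2 := (hmem n).2.2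
      have h3 := (hmem m).2.2
      simp only at h
      exact e.injective (by omega)
    · intro m hm
      have h2 := hμN m hm
      have h3 : N - m ∈ Set.range e := by
        rw [he, Finset.range_orderEmbOfFin]
        exact Finset.mem_image_of_mem _ hm
      obtain ⟨n, hn⟩ := h3
      exact ⟨n, by simp, by simp only; omega⟩

end Motifs

/-- The set of eigenvalues of `H^L` is exactly the set of strictly additive
motif energies `Σ_{m=1}^M ε^L(μ_m)`, `μ ∈ 𝓜_N`. -/
theorem eigenvalues_HL_eq_motif_energies (N : ℕ) (hN : 0 < N) (q : ℂ) (hq0 : q ≠ 0)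
    (hq : q ^ (2 * N) ≠ 1) :
    {c : ℂ | ∃ ψ : Chain N, ψ ≠ 0 ∧ HL N q ψ = c • ψ}
      = {E : ℂ | ∃ μ : Finset ℕ, IsMotif N μ ∧ E = ∑ n ∈ μ, epsL N q n} := by
  have : NeZero N := ⟨hN.ne'⟩
  ext E
  rw [Set.mem_ofPred_eq, Set.mem_ofPred_eq, exists_eigenvector_HL_iff hq0 hq]
  constructor
  · rintro ⟨φ, hφ0, hφ⟩
    obtain ⟨r, δ, h1, hδ, hgap, rfl⟩ := exists_levelEnergy_eq hq0 hq hφ0 hφ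
    obtain ⟨μ, hμ, hE⟩ := exists_motif_of_gap (q := q) h1 hδ hgap
    exact ⟨μ, hμ, (levelEnergy_eq_sum hq0 hδ).trans hE⟩
  · rintro ⟨μ, hμ, rfl⟩
    obtain ⟨r, δ, h1, hδ, hgap, hE⟩ := exists_gap_of_motif (q := q) hμ
    rw [hE, ← levelEnergy_eq_sum hq0 fun n => (hδ n).le]
    exact exists_eigenfunctional_of_gap hq0 hq h1 hδ hgap

end Stmt2
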